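/- There exist constants C > 0 and κ₀ > 0 such that for every κ ≥ κ₀, both the lower global critical field H_{C3}(κ) and the upper global critical field H̄_{C3}(κ) satisfy |H(κ) − κ/Θ₀ − C₁·k_max·Θ₀^{−3/2}| ≤ C·κ^{−1/2}. -/

import Mathlib

open MeasureTheory Filter Set Topology

noncomputable section

namespace SC

/-- The plane `ℝ²`. -/
abbrev Plane := ℝ × ℝ

/-- Squared Euclidean norm on the plane. -/
def esq (v : Plane) : ℝ := v.1 ^ 2 + v.2 ^ 2

/-- Euclidean dot product on the plane. -/
def dot2 (v w : Plane) : ℝ := v.1 * w.1 + v.2 * w.2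

/-- The reference vector potential `F₀(x) = (-x₂/2, x₁/2)`, with `curl F₀ = 1`. -/
def F0 : Plane → Plane := fun x => (-x.2 / 2, x.1 / 2)

/-- `u` is of class `Cⁿ` on a neighborhood of the closure of `Ω`. -/
def CNearCl {E : Type*} [NormedAddCommGroup E] [NormedSpace ℝ E]
    (n : ℕ) (Ω : Set Plane) (u : Plane → E) : Prop :=
  ∃ U : Set Plane, IsOpen U ∧ closure Ω ⊆ U ∧ ContDiffOn ℝ n u U

/-- The pointwise squared magnetic gradient `|(-i∇ - B·A)u|²`. -/
def magSq (B : ℝ) (A : Plane → Plane) (u : Plane → ℂ) (x : Plane) : ℝ :=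
  ‖(-Complex.I) * fderiv ℝ u x ((1 : ℝ), (0 : ℝ)) - ((B * (A x).1 : ℝ) : ℂ) * u x‖ ^ 2 +
  ‖(-Complex.I) * fderiv ℝ u x ((0 : ℝ), (1 : ℝ)) - ((B * (A x).2 : ℝ) : ℂ) * u x‖ ^ 2

/-- `curl A = ∂₁A₂ - ∂₂A₁`. -/
def curl2 (A : Plane → Plane) (x : Plane) : ℝ :=
  fderiv ℝ (fun y => (A y).2) x ((1 : ℝ), (0 : ℝ)) -
    fderiv ℝ (fun y => (A y).1) x ((0 : ℝ), (1 : ℝ))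

/-- The variational ground state energy `λ₁(B·A)` of the magnetic Neumann Laplacian. -/
def lam1A (Ω : Set Plane) (B : ℝ) (A : Plane → Plane) : ℝ :=
  sInf { r : ℝ | ∃ u : Plane → ℂ, CNearCl 1 Ω u ∧ (∫ x in Ω, ‖u x‖ ^ 2) ≠ 0 ∧
    r = (∫ x in Ω, magSq B A u x) / (∫ x in Ω, ‖u x‖ ^ 2) }

/-- `λ₁(B) = λ₁(B·F₀)`. -/
def lam1 (Ω : Set Plane) (B : ℝ) : ℝ := lam1A Ω B F0

/-- The Ginzburg–Landau energy functional. -/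
def GLenergy (Ω : Set Plane) (κ H : ℝ) (ψ : Plane → ℂ) (A : Plane → Plane) : ℝ :=
  ∫ x in Ω, (magSq (κ * H) A ψ x - κ ^ 2 * ‖ψ x‖ ^ 2 + κ ^ 2 / 2 * ‖ψ x‖ ^ 4
    + κ ^ 2 * H ^ 2 * (curl2 A x - 1) ^ 2)

/-- Admissible Ginzburg–Landau configurations. -/
def GLadm (Ω : Set Plane) (ψ : Plane → ℂ) (A : Plane → Plane) : Prop :=
  CNearCl 1 Ω ψ ∧ CNearCl 1 Ω A

/-- The normal state is a minimizer at `(κ, H)`. -/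
def NormalMin (Ω : Set Plane) (κ H : ℝ) : Prop :=
  ∀ ψ A, GLadm Ω ψ A → 0 ≤ GLenergy Ω κ H ψ A

/-- The normal state is the unique minimizer at `(κ, H)`. -/
def NormalUnique (Ω : Set Plane) (κ H : ℝ) : Prop :=
  NormalMin Ω κ H ∧
  ∀ ψ A, GLadm Ω ψ A → (∫ x in Ω, ‖ψ x‖ ^ 2) ≠ 0 → 0 < GLenergy Ω κ H ψ A

/-- `(ψ, A)` is a minimizer of the Ginzburg–Landau energy at `(κ, H)`. -/
def IsGLMin (Ω : Set Plane) (κ H : ℝ) (ψ : Plane → ℂ) (A : Plane → Plane) : Prop :=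
  GLadm Ω ψ A ∧ ∀ ψ' A', GLadm Ω ψ' A' → GLenergy Ω κ H ψ A ≤ GLenergy Ω κ H ψ' A'

/-- Lower global critical field. -/
def HC3low (Ω : Set Plane) (κ : ℝ) : ℝ := sInf {H : ℝ | 0 < H ∧ NormalMin Ω κ H}

/-- Upper global critical field. -/
def HC3up (Ω : Set Plane) (κ : ℝ) : ℝ :=
  sInf {H : ℝ | 0 < H ∧ ∀ H', H < H' → NormalUnique Ω κ H'}

/-- Lower local critical field. -/
def HlocLow (Ω : Set Plane) (κ : ℝ) : ℝ :=
  sInf {H : ℝ | 0 < H ∧ κ ^ 2 ≤ lam1 Ω (κ * H)}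

/-- Upper local critical field. -/
def HlocUp (Ω : Set Plane) (κ : ℝ) : ℝ :=
  sInf {H : ℝ | 0 < H ∧ ∀ H', H < H' → κ ^ 2 ≤ lam1 Ω (κ * H')}

/-- The inward unit normal `ν(s) = (-γ₂'(s), γ₁'(s))`. -/
def nuVec (γ : ℝ → Plane) (s : ℝ) : Plane := (-(deriv γ s).2, (deriv γ s).1)

/-- The curvature `k(s) = ⟨γ''(s), ν(s)⟩`. -/
def curvOf (γ : ℝ → Plane) (s : ℝ) : ℝ := dot2 (deriv (deriv γ) s) (nuVec γ s)

/-- The maximal curvature. -/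
def kmaxOf (γ : ℝ → Plane) : ℝ := sSup (Set.range (curvOf γ))

/-- A smooth counterclockwise arclength parametrization of the boundary of `Ω`. -/
structure BoundaryParam (Ω : Set Plane) where
  γ : ℝ → Plane
  L : ℝ
  L_pos : 0 < L
  smooth : ContDiff ℝ (⊤ : ℕ∞) γ
  periodic : Function.Periodic γ L
  unit_speed : ∀ s, esq (deriv γ s) = 1
  injOn : Set.InjOn γ (Set.Ico 0 L)
  range_eq : Set.range γ = frontier Ω
  inward : ∀ s, ∃ ε > 0, ∀ t ∈ Set.Ioo (0 : ℝ) ε, γ s + t • nuVec γ s ∈ Ω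

/-- The non-degeneracy assumption: finitely many points of maximal curvature,
all of them non-degenerate maxima. -/
def NonDegen {Ω : Set Plane} (P : BoundaryParam Ω) : Prop :=
  ∃ (N : ℕ) (s : Fin N → ℝ), 0 < N ∧ (∀ j, s j ∈ Set.Ico 0 P.L) ∧
    (∀ j, curvOf P.γ (s j) = kmaxOf P.γ) ∧
    (∀ t ∈ Set.Ico 0 P.L, (∀ j, t ≠ s j) → curvOf P.γ t < kmaxOf P.γ) ∧
    (∀ j, deriv (deriv (curvOf P.γ)) (s j) < 0)

/-- The ground state energy `μ(ζ)` of the de Gennes half-line model operator. -/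
def muGen (ζ : ℝ) : ℝ :=
  sInf { r : ℝ | ∃ φ : ℝ → ℝ, ContDiff ℝ 1 φ ∧ HasCompactSupport φ ∧
    (∃ τ, 0 < τ ∧ φ τ ≠ 0) ∧
    r = (∫ τ in Set.Ioi (0 : ℝ), ((deriv φ τ) ^ 2 + (τ + ζ) ^ 2 * (φ τ) ^ 2)) /
        (∫ τ in Set.Ioi (0 : ℝ), (φ τ) ^ 2) }

/-- The de Gennes constant `Θ₀`. -/
def Theta0 : ℝ := sInf (Set.range muGen)

/-- Standard facts about the de Gennes constant, taken as hypotheses. -/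
structure DeGennes where
  ξ₀ : ℝ
  u₀ : ℝ → ℝ
  theta_lb : 1 / 2 < Theta0
  theta_ub : Theta0 < 1
  ξ₀_mem : ξ₀ ∈ Set.Ioo (-1 : ℝ) 0
  ξ₀_min : muGen ξ₀ = Theta0
  ξ₀_uniq : ∀ ζ, muGen ζ = Theta0 → ζ = ξ₀
  ξ₀_sq : ξ₀ ^ 2 = Theta0
  u₀_pos : ∀ τ, 0 ≤ τ → 0 < u₀ τ
  u₀_smooth : ContDiffOn ℝ 2 u₀ (Set.Ici 0)
  u₀_sq_int : IntegrableOn (fun τ => (u₀ τ) ^ 2) (Set.Ioi 0)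
  u₀_normalized : (∫ τ in Set.Ioi (0 : ℝ), (u₀ τ) ^ 2) = 1
  u₀_neumann : derivWithin u₀ (Set.Ici 0) 0 = 0
  u₀_ode : ∀ τ ∈ Set.Ioi (0 : ℝ),
    -(deriv (deriv u₀) τ) + (τ + ξ₀) ^ 2 * u₀ τ = Theta0 * u₀ τ

/-- The universal constant `C₁ = u₀(0)²/3`. -/
def DeGennes.C1 (D : DeGennes) : ℝ := (D.u₀ 0) ^ 2 / 3

/-- Condition (★) on a vector field `A` at field strength `B` with constant `C₀`. -/
def StarCond (Ω : Set Plane) (C₀ B : ℝ) (A : Plane → Plane) : Prop :=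
  CNearCl 2 Ω A ∧
  (∀ x ∈ closure Ω, ‖A x‖ ≤ C₀) ∧
  (∀ x ∈ closure Ω, ‖fderiv ℝ A x‖ ≤ C₀) ∧
  (∀ x ∈ closure Ω, ‖fderiv ℝ (fderiv ℝ A) x‖ ≤ C₀) ∧
  (∀ x ∈ closure Ω, |curl2 A x - 1| ≤ C₀ * B ^ (-(1 : ℝ) / 4)) ∧
  (∀ x ∈ closure Ω, ‖fderiv ℝ (curl2 A) x‖ ≤ C₀ * B ^ (-(1 : ℝ) / 4)) ∧
  (∀ x ∈ frontier Ω, curl2 A x = 1)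

/-- The open unit disc. -/
def unitDisc : Set Plane := {x : Plane | x.1 ^ 2 + x.2 ^ 2 < 1}

/-- `Δ_B`: distance from `B/2 + ξ₀√B + δ₀` to the nearest integer. -/
def DeltaB (ξ₀ δ₀ B : ℝ) : ℝ :=
  sInf (Set.range (fun m : ℤ => |(m : ℝ) - B / 2 - ξ₀ * Real.sqrt B - δ₀|))

/-- Euclidean distance to the boundary of `Ω`. -/
def distBdry (Ω : Set Plane) (x : Plane) : ℝ :=
  sInf ((fun y => Real.sqrt (esq (x - y))) '' frontier Ω)

end SC

namespace SC

theorem antitoneOn_Ici_of_deriv {F F' : ℝ → ℝ} {a : ℝ} (hc : ContinuousOn F (Ici a))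
    (hd : ∀ x, a < x → HasDerivAt F (F' x) x) (h : ∀ x, a < x → F' x ≤ 0) :
    AntitoneOn F (Ici a) := by
  refine antitoneOn_of_hasDerivWithinAt_nonpos (f' := F') (convex_Ici a) hc ?_ ?_
  · intro x hx
    rw [interior_Ici] at hx
    exact (hd x hx).hasDerivWithinAt
  · intro x hx
    rw [interior_Ici] at hx
    exact h x hx

theorem linear_upper_bound {F F' : ℝ → ℝ} {a c : ℝ} (hc : ContinuousOn F (Ici a))
    (hd : ∀ x, a < x → HasDerivAt F (F' x) x) (h : ∀ x, a < x → F' x ≤ c) :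
    ∀ x, a ≤ x → F x ≤ F a + c * (x - a) := by
  have := antitoneOn_Ici_of_deriv (F := fun x => F x - c * x) (F' := fun x => F' x - c)
    (a := a) (hc.sub (by fun_prop))
    (fun x hx => ((hd x hx).sub ((hasDerivAt_id x).const_mul c)).congr_deriv (by simp))
    (fun x hx => by linarith [h x hx])
  intro x hx
  have h1 := this (mem_Ici.2 le_rfl) (mem_Ici.2 hx) hx
  simp only at h1
  linarith

theorem nonneg_of_antitoneOn_tendsto_zero {F : ℝ → ℝ} {a : ℝ} (hF : AntitoneOn F (Ici a))
    (h0 : Tendsto F atTop (𝓝 0)) : ∀ x, a ≤ x → 0 ≤ F x := by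
  intro x hx
  refine le_of_tendsto h0 ?_
  filter_upwards [eventually_ge_atTop x] with y hy
  exact hF hx (mem_Ici.2 (hx.trans hy)) hy

/-- A positive square-integrable solution on the half-line of
`-u'' + (τ + ξ)² u = Θ u`, `u'(0) = 0`, with `ξ² = Θ` (the function `v` is `u'`). -/
structure HalfLineState (ξ Θ : ℝ) (u v : ℝ → ℝ) : Prop where
  lb : -1 < ξ
  neg : ξ < 0
  sq : ξ ^ 2 = Θ
  pos : ∀ τ, 0 ≤ τ → 0 < u τ
  cu : ContinuousOn u (Ici 0)
  cv : ContinuousOn v (Ici 0)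
  du : ∀ τ, 0 < τ → HasDerivAt u (v τ) τ
  dv : ∀ τ, 0 < τ → HasDerivAt v (((τ + ξ) ^ 2 - Θ) * u τ) τ
  v0 : v 0 = 0
  int : IntegrableOn (fun τ => u τ ^ 2) (Ioi 0)

theorem DeGennes.halfLineState (D : DeGennes) :
    HalfLineState D.ξ₀ Theta0 D.u₀ (derivWithin D.u₀ (Ici 0)) := by
  have hdiff : DifferentiableOn ℝ D.u₀ (Ici 0) := D.u₀_smooth.differentiableOn (by norm_num)
  have hv1 : ContDiffOn ℝ 1 (derivWithin D.u₀ (Ici 0)) (Ici 0) :=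
    D.u₀_smooth.derivWithin (uniqueDiffOn_Ici 0) (by norm_num)
  have heq : ∀ τ, 0 < τ → derivWithin D.u₀ (Ici 0) τ = deriv D.u₀ τ := fun τ hτ =>
    derivWithin_of_mem_nhds (Ici_mem_nhds hτ)
  refine ⟨D.ξ₀_mem.1, D.ξ₀_mem.2, D.ξ₀_sq, D.u₀_pos, hdiff.continuousOn, hv1.continuousOn, ?_, ?_,
    D.u₀_neumann, D.u₀_sq_int⟩
  · intro τ hτ
    rw [heq τ hτ]
    exact ((hdiff τ hτ.le).differentiableAt (Ici_mem_nhds hτ)).hasDerivAt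
  · intro τ hτ
    have h1 : DifferentiableAt ℝ (derivWithin D.u₀ (Ici 0)) τ :=
      ((hv1.differentiableOn one_ne_zero) τ hτ.le).differentiableAt (Ici_mem_nhds hτ)
    have h2 : deriv (derivWithin D.u₀ (Ici 0)) τ = deriv (deriv D.u₀) τ := by
      apply Filter.EventuallyEq.deriv_eq
      filter_upwards [Ioi_mem_nhds hτ] with x hx using heq x hx
    have h3 := D.u₀_ode τ hτ
    have h4 : ((τ + D.ξ₀) ^ 2 - Theta0) * D.u₀ τ = deriv (derivWithin D.u₀ (Ici 0)) τ := by
      rw [h2]; linarith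
    rw [h4]
    exact h1.hasDerivAt

namespace HalfLineState

variable {ξ Θ : ℝ} {u v : ℝ → ℝ}

/-- The quantity `u'² - ((τ + ξ)² - Θ) u²`. -/
def mom (ξ Θ : ℝ) (u v : ℝ → ℝ) (τ : ℝ) : ℝ := v τ ^ 2 - ((τ + ξ) ^ 2 - Θ) * u τ ^ 2

/-- The logarithmic derivative `-u'/u`. -/
def logDer (u v : ℝ → ℝ) (τ : ℝ) : ℝ := -(v τ) / u τ

/-- The derivative of `-u'/u`. -/
def logDer' (ξ Θ : ℝ) (u v : ℝ → ℝ) (τ : ℝ) : ℝ := logDer u v τ ^ 2 - (τ + ξ) ^ 2 + Θ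

theorem theta_pos (S : HalfLineState ξ Θ u v) : 0 < Θ := by
  have := S.neg.ne
  rw [← S.sq]; positivity

theorem theta_lt (S : HalfLineState ξ Θ u v) : Θ < 1 := by
  rw [← S.sq]; nlinarith [S.lb, S.neg]

theorem v_eq (S : HalfLineState ξ Θ u v) {τ : ℝ} (hτ : 0 ≤ τ) : v τ = -(logDer u v τ * u τ) := by
  have := (S.pos τ hτ).ne'
  rw [logDer]; field_simp

theorem mom_eq (S : HalfLineState ξ Θ u v) {τ : ℝ} (hτ : 0 ≤ τ) :
    mom ξ Θ u v τ = logDer' ξ Θ u v τ * u τ ^ 2 := by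
  rw [mom, logDer', S.v_eq hτ]; ring

theorem mom_cont (S : HalfLineState ξ Θ u v) : ContinuousOn (mom ξ Θ u v) (Ici 0) := by
  have := S.cu
  have := S.cv
  unfold mom
  fun_prop

theorem mom_zero (S : HalfLineState ξ Θ u v) : mom ξ Θ u v 0 = 0 := by
  rw [mom, S.v0, ← S.sq]; ring

theorem mom_deriv (S : HalfLineState ξ Θ u v) {τ : ℝ} (hτ : 0 < τ) :
    HasDerivAt (mom ξ Θ u v) (-2 * (τ + ξ) * u τ ^ 2) τ := by
  have h := ((S.dv τ hτ).pow 2).sub (((((hasDerivAt_id τ).add_const ξ).pow 2).sub_const Θ).mul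
    ((S.du τ hτ).pow 2))
  refine h.congr_deriv ?_
  simp
  ring

theorem logDer_cont (S : HalfLineState ξ Θ u v) : ContinuousOn (logDer u v) (Ici 0) :=
  S.cv.neg.div S.cu fun x hx => (S.pos x hx).ne'

theorem logDer_deriv (S : HalfLineState ξ Θ u v) {τ : ℝ} (hτ : 0 < τ) :
    HasDerivAt (logDer u v) (logDer' ξ Θ u v τ) τ := by
  have h := (S.dv τ hτ).neg.div (S.du τ hτ) (S.pos τ hτ.le).ne'
  refine h.congr_deriv ?_
  have := (S.pos τ hτ.le).ne'
  rw [logDer', logDer]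
  simp
  field_simp
  ring

theorem logDer'_deriv (S : HalfLineState ξ Θ u v) {τ : ℝ} (hτ : 0 < τ) :
    HasDerivAt (logDer' ξ Θ u v)
      (2 * logDer u v τ * logDer' ξ Θ u v τ - 2 * (τ + ξ)) τ := by
  have h := (((S.logDer_deriv hτ).pow 2).sub (((hasDerivAt_id τ).add_const ξ).pow 2)).add_const Θ
  refine h.congr_deriv ?_
  simp

theorem mom_antitone (S : HalfLineState ξ Θ u v) : AntitoneOn (mom ξ Θ u v) (Ici (-ξ)) :=
  antitoneOn_Ici_of_deriv (S.mom_cont.mono (Ici_subset_Ici.2 (by linarith [S.neg])))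
    (fun x hx => S.mom_deriv (by linarith [S.neg]))
    (fun x hx => by
      have : 0 ≤ (x + ξ) * u x ^ 2 := mul_nonneg (by linarith) (sq_nonneg _)
      linarith)

theorem not_growing (S : HalfLineState ξ Θ u v) {T : ℝ} (hT : 0 ≤ T)
    (h : ∀ τ, T < τ → 0 ≤ u τ * v τ) : False := by
  have hm := antitoneOn_Ici_of_deriv (F := fun τ => -u τ ^ 2) (F' := fun τ => -(2 * (u τ * v τ)))
    (a := T) (by have := S.cu.mono (Ici_subset_Ici.2 hT); fun_prop)
    (fun x hx => by
      refine ((S.du x (by linarith)).pow 2).neg.congr_deriv ?_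
      simp; ring)
    (fun x hx => by linarith [h x hx])
  have hInt : IntegrableOn (fun _ : ℝ => u T ^ 2) (Ioi T) := by
    refine Integrable.mono' (S.int.mono_set (Ioi_subset_Ioi hT))
      aestronglyMeasurable_const ?_
    filter_upwards [ae_restrict_mem measurableSet_Ioi] with x hx
    rw [Real.norm_of_nonneg (sq_nonneg _)]
    have := hm (mem_Ici.2 le_rfl) (mem_Ici.2 (le_of_lt hx)) (le_of_lt hx)
    simp only at this
    linarith
  rw [integrableOn_const_iff] at hInt
  rcases hInt with h | h
  · exact (S.pos T hT).ne' (by simpa using h)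
  · simp at h

theorem mom_nonneg (S : HalfLineState ξ Θ u v) {τ : ℝ} (hτ : 0 ≤ τ) : 0 ≤ mom ξ Θ u v τ := by
  rcases le_total τ (-ξ) with h | h
  · have hmono : MonotoneOn (mom ξ Θ u v) (Icc 0 (-ξ)) := by
      refine monotoneOn_of_hasDerivWithinAt_nonneg (f' := fun τ => -2 * (τ + ξ) * u τ ^ 2)
        (convex_Icc _ _) (S.mom_cont.mono Icc_subset_Ici_self) ?_ ?_
      · intro x hx
        rw [interior_Icc] at hx
        exact (S.mom_deriv hx.1).hasDerivWithinAt
      · intro x hx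
        rw [interior_Icc] at hx
        have : 0 ≤ (-(x + ξ)) * u x ^ 2 := mul_nonneg (by linarith [hx.2]) (sq_nonneg _)
        linarith
    rw [← S.mom_zero]
    exact hmono ⟨le_rfl, by linarith [S.neg]⟩ ⟨hτ, h⟩ hτ
  · by_contra! hneg
    set c := -mom ξ Θ u v τ with hc
    have hcpos : 0 < c := by linarith
    have hlow := linear_upper_bound (F := fun x => -(u x * v x))
      (F' := fun x => -(v x ^ 2 + ((x + ξ) ^ 2 - Θ) * u x ^ 2)) (a := τ) (c := -c)
      (by
        have := S.cu.mono (Ici_subset_Ici.2 hτ)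
        have := S.cv.mono (Ici_subset_Ici.2 hτ)
        fun_prop)
      (fun x hx => by
        refine ((S.du x (by linarith)).mul (S.dv x (by linarith))).neg.congr_deriv ?_
        ring)
      (fun x hx => by
        have h1 := S.mom_antitone (mem_Ici.2 h) (mem_Ici.2 (h.trans hx.le)) hx.le
        have h2 : mom ξ Θ u v x ≤ -c := by rw [hc]; linarith
        rw [mom] at h2
        nlinarith [sq_nonneg (v x)])
    refine S.not_growing (T := max τ (τ + -(u τ * v τ) / c)) (hτ.trans (le_max_left _ _)) ?_
    intro x hx
    have hx1 : τ < x := lt_of_le_of_lt (le_max_left _ _) hx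
    have hx2 : τ + -(u τ * v τ) / c < x := lt_of_le_of_lt (le_max_right _ _) hx
    have h3 := hlow x hx1.le
    have h4 : -(u τ * v τ) / c < x - τ := by linarith
    rw [div_lt_iff₀ hcpos] at h4
    nlinarith

theorem logDer'_nonneg (S : HalfLineState ξ Θ u v) {τ : ℝ} (hτ : 0 ≤ τ) :
    0 ≤ logDer' ξ Θ u v τ := by
  have h := S.mom_nonneg hτ
  rw [S.mom_eq hτ] at h
  exact nonneg_of_mul_nonneg_left h (pow_pos (S.pos τ hτ) 2)

theorem logDer_zero (S : HalfLineState ξ Θ u v) : logDer u v 0 = 0 := by simp [logDer, S.v0]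

theorem logDer_nonneg (S : HalfLineState ξ Θ u v) {τ : ℝ} (hτ : 0 ≤ τ) : 0 ≤ logDer u v τ := by
  have := linear_upper_bound (F := fun x => -logDer u v x) (F' := fun x => -logDer' ξ Θ u v x)
    (a := 0) (c := 0) S.logDer_cont.neg (fun x hx => (S.logDer_deriv hx).neg)
    (fun _ hx => by linarith [S.logDer'_nonneg hx.le]) τ hτ
  simp only [S.logDer_zero] at this
  linarith

theorem v_nonpos (S : HalfLineState ξ Θ u v) {τ : ℝ} (hτ : 0 ≤ τ) : v τ ≤ 0 := by
  rw [S.v_eq hτ]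
  have := mul_nonneg (S.logDer_nonneg hτ) (S.pos τ hτ).le
  linarith

theorem u_antitone (S : HalfLineState ξ Θ u v) : AntitoneOn u (Ici 0) :=
  antitoneOn_Ici_of_deriv S.cu S.du fun _ hx => S.v_nonpos hx.le

theorem logDer_gt (S : HalfLineState ξ Θ u v) {τ : ℝ} (hτ : 0 ≤ τ) : τ + ξ < logDer u v τ := by
  by_contra! hle
  have hq := S.logDer_nonneg hτ
  have hZ := antitoneOn_Ici_of_deriv
    (F := fun x => (logDer u v x - (x + ξ)) * (u x * Real.exp (-(x + ξ) ^ 2 / 2)))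
    (F' := fun x => -(1 - Θ) * (u x * Real.exp (-(x + ξ) ^ 2 / 2))) (a := τ)
    (by
      have := S.cu.mono (Ici_subset_Ici.2 hτ)
      have := S.logDer_cont.mono (Ici_subset_Ici.2 hτ)
      fun_prop)
    (fun x hx => by
      have hx0 : 0 < x := by linarith
      have he : HasDerivAt (fun x => Real.exp (-(x + ξ) ^ 2 / 2))
          (Real.exp (-(x + ξ) ^ 2 / 2) * (-(x + ξ))) x := by
        refine HasDerivAt.exp ?_
        refine ((((hasDerivAt_id x).add_const ξ).pow 2).neg.div_const 2).congr_deriv ?_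
        simp; ring
      refine (((S.logDer_deriv hx0).sub ((hasDerivAt_id x).add_const ξ)).mul
        ((S.du x hx0).mul he)).congr_deriv ?_
      rw [logDer', S.v_eq hx0.le]
      simp
      ring)
    (fun x hx => by
      have := mul_pos (S.pos x (by linarith)) (Real.exp_pos (-(x + ξ) ^ 2 / 2))
      nlinarith [S.theta_lt])
  have hz : ∀ x, τ ≤ x → logDer u v x - (x + ξ) ≤ 0 := by
    intro x hx
    have h1 := hZ (mem_Ici.2 le_rfl) (mem_Ici.2 hx) hx
    simp only at h1
    have h2 : (logDer u v τ - (τ + ξ)) * (u τ * Real.exp (-(τ + ξ) ^ 2 / 2)) ≤ 0 :=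
      mul_nonpos_of_nonpos_of_nonneg (by linarith)
        (mul_pos (S.pos τ hτ) (Real.exp_pos _)).le
    by_contra! h3
    have := mul_pos h3 (mul_pos (S.pos x (by linarith)) (Real.exp_pos (-(x + ξ) ^ 2 / 2)))
    linarith
  have hlin := linear_upper_bound (F := fun x => logDer u v x - (x + ξ))
    (F' := fun x => logDer' ξ Θ u v x - 1) (a := τ) (c := -(1 - Θ))
    (by
      have := S.logDer_cont.mono (Ici_subset_Ici.2 hτ)
      fun_prop)
    (fun x hx => (S.logDer_deriv (by linarith)).sub ((hasDerivAt_id x).add_const ξ))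
    (fun x hx => by
      have h1 := hz x hx.le
      have h2 := S.logDer_nonneg (τ := x) (by linarith)
      rw [logDer']
      nlinarith)
  have hΘ := S.theta_lt
  set x := τ + 2 + 1 / (1 - Θ) with hx
  have h1Θ : 0 < 1 / (1 - Θ) := by apply one_div_pos.2; linarith
  have hxτ : τ ≤ x := by linarith
  have h1 := hlin x hxτ
  have h2 := S.logDer'_nonneg (τ := x) (by linarith)
  have h3 := S.logDer_nonneg (τ := x) (by linarith)
  rw [logDer'] at h2
  have h4 : (1 - Θ) * (x - τ) = 2 * (1 - Θ) + 1 := by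
    rw [hx]
    have : 1 - Θ ≠ 0 := by linarith
    field_simp
    ring
  have h5 : logDer u v x - (x + ξ) ≤ -1 := by nlinarith
  have hxw : 1 < x + ξ := by nlinarith [S.lb]
  nlinarith

theorem gaussian_bound (S : HalfLineState ξ Θ u v) {τ : ℝ} (hτ : 0 ≤ τ) :
    u τ ^ 2 ≤ u 0 ^ 2 * Real.exp (ξ ^ 2) * Real.exp (-(τ + ξ) ^ 2) := by
  have hZ := antitoneOn_Ici_of_deriv
    (F := fun x => u x ^ 2 * Real.exp ((x + ξ) ^ 2))
    (F' := fun x => -2 * (logDer u v x - (x + ξ)) * (u x ^ 2 * Real.exp ((x + ξ) ^ 2))) (a := 0)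
    (by
      have := S.cu
      fun_prop)
    (fun x hx => by
      have he : HasDerivAt (fun x => Real.exp ((x + ξ) ^ 2))
          (Real.exp ((x + ξ) ^ 2) * (2 * (x + ξ))) x := by
        refine HasDerivAt.exp ?_
        refine ((((hasDerivAt_id x).add_const ξ).pow 2)).congr_deriv ?_
        simp
      refine (((S.du x hx).pow 2).mul he).congr_deriv ?_
      rw [S.v_eq hx.le]
      simp
      ring)
    (fun x hx => by
      have h1 := S.logDer_gt hx.le
      have : 0 < u x ^ 2 * Real.exp ((x + ξ) ^ 2) :=
        mul_pos (pow_pos (S.pos x hx.le) 2) (Real.exp_pos _)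
      nlinarith)
  have := hZ (mem_Ici.2 le_rfl) (mem_Ici.2 hτ) hτ
  simp only [zero_add] at this
  rw [Real.exp_neg, ← div_eq_mul_inv, le_div_iff₀ (Real.exp_pos _)]
  exact this

theorem tendsto_exp_neg_sq (ξ : ℝ) (n : ℕ) :
    Tendsto (fun τ : ℝ => (1 + τ) ^ n * Real.exp (-(τ + ξ) ^ 2)) atTop (𝓝 0) := by
  have h1 : Tendsto (fun τ : ℝ => (1 + τ) ^ n * Real.exp (-(1 + τ)) * Real.exp (5 / 4 - ξ))
      atTop (𝓝 0) := by
    have h2 := ((Real.tendsto_pow_mul_exp_neg_atTop_nhds_zero n).comp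
      (tendsto_atTop_add_const_left atTop (1 : ℝ) tendsto_id)).mul_const (Real.exp (5 / 4 - ξ))
    rw [zero_mul] at h2
    exact h2
  refine squeeze_zero' ?_ ?_ h1
  · filter_upwards [eventually_ge_atTop 0] with τ hτ
    positivity
  · filter_upwards [eventually_ge_atTop 0] with τ hτ
    rw [mul_assoc, ← Real.exp_add]
    gcongr
    nlinarith [sq_nonneg (τ + ξ - 1 / 2)]

theorem tendsto_poly_sq (S : HalfLineState ξ Θ u v) (n : ℕ) :
    Tendsto (fun τ : ℝ => (1 + τ) ^ n * u τ ^ 2) atTop (𝓝 0) := by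
  have h1 := (tendsto_exp_neg_sq ξ n).const_mul (u 0 ^ 2 * Real.exp (ξ ^ 2))
  rw [mul_zero] at h1
  refine squeeze_zero' ?_ ?_ h1
  · filter_upwards [eventually_ge_atTop 0] with τ hτ
    positivity
  · filter_upwards [eventually_ge_atTop 0] with τ hτ
    have := mul_le_mul_of_nonneg_left (S.gaussian_bound hτ) (pow_nonneg (by linarith : 0 ≤ 1 + τ) n)
    linarith

theorem tendsto_sq (S : HalfLineState ξ Θ u v) : Tendsto (fun τ : ℝ => u τ ^ 2) atTop (𝓝 0) := by
  simpa using S.tendsto_poly_sq 0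

theorem tendsto_mom (S : HalfLineState ξ Θ u v) : Tendsto (mom ξ Θ u v) atTop (𝓝 0) := by
  rw [Metric.tendsto_atTop]
  intro ℓ hℓ
  have hex : ∃ T, 1 - ξ ≤ T ∧ mom ξ Θ u v T < ℓ := by
    by_contra! hcon
    have hu := linear_upper_bound (F := u) (F' := v) (a := 1 - ξ) (c := -Real.sqrt ℓ)
      (S.cu.mono (Ici_subset_Ici.2 (by linarith [S.neg])))
      (fun x hx => S.du x (by linarith [S.neg]))
      (fun x hx => by
        have h1 := hcon x hx.le
        rw [mom] at h1
        have h2 : 0 ≤ ((x + ξ) ^ 2 - Θ) * u x ^ 2 :=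
          mul_nonneg (by nlinarith [S.theta_lt]) (sq_nonneg _)
        have h3 := S.v_nonpos (τ := x) (by linarith [S.neg])
        have h4 : Real.sqrt ℓ ≤ -v x := Real.sqrt_le_iff.2 ⟨by linarith, by nlinarith⟩
        linarith)
    have hs := Real.sqrt_pos.2 hℓ
    have hu1 := S.pos (1 - ξ) (by linarith [S.neg])
    have h0 : 0 ≤ u (1 - ξ) / Real.sqrt ℓ := by positivity
    have h1 := hu (1 - ξ + u (1 - ξ) / Real.sqrt ℓ) (by linarith)
    have h2 := S.pos (1 - ξ + u (1 - ξ) / Real.sqrt ℓ) (by linarith [S.neg])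
    have h3 : Real.sqrt ℓ * (u (1 - ξ) / Real.sqrt ℓ) = u (1 - ξ) := by field_simp
    nlinarith
  obtain ⟨T, hT, hTl⟩ := hex
  refine ⟨T, fun n hn => ?_⟩
  have h1 := S.mom_antitone (mem_Ici.2 (by linarith)) (mem_Ici.2 (by linarith)) hn
  rw [Real.dist_eq, sub_zero, abs_of_nonneg (S.mom_nonneg (by linarith [S.neg]))]
  linarith

theorem mul_sq_deriv (S : HalfLineState ξ Θ u v) {b b' τ : ℝ} {f : ℝ → ℝ} (hτ : 0 < τ)
    (hf : HasDerivAt f b' τ) (hb : f τ = b) :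
    HasDerivAt (fun x => f x * u x ^ 2) ((b' - 2 * logDer u v τ * b) * u τ ^ 2) τ := by
  refine (hf.mul ((S.du τ hτ).pow 2)).congr_deriv ?_
  rw [S.v_eq hτ.le, hb]
  simp
  ring

theorem gap_deriv (S : HalfLineState ξ Θ u v) {τ : ℝ} (hτ : 0 < τ) :
    HasDerivAt (fun x => u x ^ 2 - mom ξ Θ u v x)
      (-2 * (logDer u v τ - (τ + ξ)) * u τ ^ 2) τ := by
  refine (((S.du τ hτ).pow 2).sub (S.mom_deriv hτ)).congr_deriv ?_
  rw [S.v_eq hτ.le]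
  simp
  ring

theorem gap_tendsto (S : HalfLineState ξ Θ u v) :
    Tendsto (fun x => u x ^ 2 - mom ξ Θ u v x) atTop (𝓝 0) := by
  simpa using S.tendsto_sq.sub S.tendsto_mom

theorem gap_cont (S : HalfLineState ξ Θ u v) :
    ContinuousOn (fun x => u x ^ 2 - mom ξ Θ u v x) (Ici 0) := by
  have := S.cu
  have := S.mom_cont
  fun_prop

theorem gap_antitone (S : HalfLineState ξ Θ u v) :
    StrictAntiOn (fun x => u x ^ 2 - mom ξ Θ u v x) (Ici 0) := by
  refine strictAntiOn_of_deriv_neg (convex_Ici 0) S.gap_cont fun x hx => ?_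
  rw [interior_Ici] at hx
  rw [(S.gap_deriv hx).deriv]
  have h1 := S.logDer_gt (le_of_lt hx)
  have h2 := pow_pos (S.pos x (le_of_lt hx)) 2
  nlinarith

theorem gap_eq (S : HalfLineState ξ Θ u v) {τ : ℝ} (hτ : 0 ≤ τ) :
    u τ ^ 2 - mom ξ Θ u v τ = (1 - logDer' ξ Θ u v τ) * u τ ^ 2 := by
  rw [S.mom_eq hτ]; ring

theorem gap_pos (S : HalfLineState ξ Θ u v) {τ : ℝ} (hτ : 0 ≤ τ) :
    0 < u τ ^ 2 - mom ξ Θ u v τ := by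
  have h1 := nonneg_of_antitoneOn_tendsto_zero S.gap_antitone.antitoneOn S.gap_tendsto (τ + 1)
    (by linarith)
  have h2 := S.gap_antitone (mem_Ici.2 hτ) (mem_Ici.2 (by linarith : 0 ≤ τ + 1)) (by linarith)
  simp only at h1 h2
  linarith

theorem logDer'_lt_one (S : HalfLineState ξ Θ u v) {τ : ℝ} (hτ : 0 ≤ τ) :
    logDer' ξ Θ u v τ < 1 := by
  have h := S.gap_pos hτ
  rw [S.gap_eq hτ] at h
  have := pos_of_mul_pos_left h (sq_nonneg _)
  linarith

theorem logDer_le (S : HalfLineState ξ Θ u v) {τ : ℝ} (hτ : 0 ≤ τ) : logDer u v τ ≤ τ := by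
  have := linear_upper_bound (c := 1) S.logDer_cont (fun x hx => S.logDer_deriv hx)
    (fun x hx => (S.logDer'_lt_one hx.le).le) τ hτ
  rw [S.logDer_zero] at this
  linarith

theorem gap_le (S : HalfLineState ξ Θ u v) {τ : ℝ} (hτ : 0 < τ + ξ) :
    (1 - logDer' ξ Θ u v τ) * (τ + ξ) ^ 2 ≤ 1 / 2 := by
  have hneg := S.neg
  have hgt : ∀ x, 0 < x + ξ → x + ξ < logDer u v x := fun x hx => S.logDer_gt (by linarith)
  have hF := antitoneOn_Ici_of_deriv (a := τ)
    (F := fun x => 1 / 2 / (x + ξ) ^ 2 * u x ^ 2 - (u x ^ 2 - mom ξ Θ u v x))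
    (F' := fun x => (-1 / (x + ξ) ^ 3 - 2 * logDer u v x * (1 / 2 / (x + ξ) ^ 2)) * u x ^ 2
      - -2 * (logDer u v x - (x + ξ)) * u x ^ 2)
    (by
      have := S.cu.mono (Ici_subset_Ici.2 (by linarith : 0 ≤ τ))
      have := S.gap_cont.mono (Ici_subset_Ici.2 (by linarith : 0 ≤ τ))
      refine ContinuousOn.sub (ContinuousOn.mul (ContinuousOn.div (by fun_prop) (by fun_prop) ?_)
        (by fun_prop)) this
      intro x hx
      have : 0 < x + ξ := by linarith [mem_Ici.1 hx]
      positivity)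
    (fun x hx => by
      have hx0 : 0 < x + ξ := by linarith
      refine (S.mul_sq_deriv (by linarith) ?_ rfl).sub (S.gap_deriv (by linarith))
      refine (((((hasDerivAt_id x).add_const ξ).pow 2).inv (pow_pos hx0 2).ne').const_mul
        (1 / 2 : ℝ)).congr_deriv ?_
      simp
      field_simp)
    (fun x hx => by
      have hx0 : 0 < x + ξ := by linarith
      have h1 := hgt x hx0
      have h2 := S.logDer'_lt_one (τ := x) (by linarith)
      have h3 := pow_pos (S.pos x (by linarith)) 2
      rw [logDer'] at h2
      set q := logDer u v x
      set w := x + ξ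
      have hq0 : 0 < q := hx0.trans h1
      have h4 : q - w ≤ q / w ^ 2 * (1 / 2) + 1 / w ^ 3 * (1 / 2) := by
        have h5 : (q - w) * (2 * w) ≤ 1 := by nlinarith [S.theta_pos]
        have h6 : q - w ≤ 1 / (2 * w) := by rw [le_div_iff₀ (by positivity)]; exact h5
        have h7 : 1 / (2 * w) ≤ q / w ^ 2 * (1 / 2) := by
          rw [div_mul_div_comm, div_le_div_iff₀ (by positivity) (by positivity)]
          nlinarith
        have : 0 ≤ 1 / w ^ 3 * (1 / 2) := by positivity
        linarith
      have h5 : -1 / w ^ 3 - 2 * q * (1 / 2 / w ^ 2) = -(1 / w ^ 3) - q / w ^ 2 := by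
        field_simp
      rw [h5]
      have : (-(1 / w ^ 3) - q / w ^ 2 + 2 * (q - w)) ≤ 0 := by linarith
      nlinarith)
  have hlim : Tendsto (fun x => 1 / 2 / (x + ξ) ^ 2 * u x ^ 2 - (u x ^ 2 - mom ξ Θ u v x))
      atTop (𝓝 0) := by
    have h1 : Tendsto (fun x => 1 / 2 / (x + ξ) ^ 2) atTop (𝓝 0) := by
      refine Tendsto.div_atTop tendsto_const_nhds ?_
      exact (tendsto_pow_atTop two_ne_zero).comp (tendsto_atTop_add_const_right _ ξ tendsto_id)
    simpa using (h1.mul S.tendsto_sq).sub S.gap_tendsto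
  have h := nonneg_of_antitoneOn_tendsto_zero hF hlim τ le_rfl
  rw [S.gap_eq (by linarith)] at h
  have h3 := pow_pos (S.pos τ (by linarith)) 2
  have h4 : 0 ≤ (1 / 2 / (τ + ξ) ^ 2 - (1 - logDer' ξ Θ u v τ)) * u τ ^ 2 := by linarith
  have h5 := nonneg_of_mul_nonneg_left h4 h3
  have h6 : 1 - logDer' ξ Θ u v τ ≤ 1 / 2 / (τ + ξ) ^ 2 := by linarith
  rwa [le_div_iff₀ (by positivity)] at h6

theorem gap_le' (S : HalfLineState ξ Θ u v) {τ : ℝ} (hτ : 0 ≤ τ) :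
    (1 - logDer' ξ Θ u v τ) * (1 + τ) ^ 2 ≤ 9 := by
  have h0 := S.logDer'_nonneg hτ
  have h1 := S.logDer'_lt_one hτ
  rcases le_total τ 2 with h | h
  · nlinarith
  · have hw : 1 + τ ≤ 3 * (τ + ξ) := by linarith [S.lb]
    have h2 := S.gap_le (τ := τ) (by linarith)
    have h3 : (1 + τ) ^ 2 ≤ 9 * (τ + ξ) ^ 2 := by nlinarith
    nlinarith

theorem gap_ge (S : HalfLineState ξ Θ u v) :
    ∃ c > 0, ∀ τ, 0 ≤ τ → c ≤ (1 - logDer' ξ Θ u v τ) * (1 + τ) ^ 2 := by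
  have hΘ := S.theta_lt
  obtain ⟨T, hT2, hTp⟩ : ∃ T, 2 ≤ T ∧ ∀ τ, T ≤ τ → 1 - logDer' ξ Θ u v τ ≤ (1 - Θ) / 2 := by
    refine ⟨2 + 18 / (1 - Θ), ?_, ?_⟩
    · have : 0 < 18 / (1 - Θ) := div_pos (by norm_num) (by linarith)
      linarith
    · intro τ hτ
      have h18 : 0 < 18 / (1 - Θ) := div_pos (by norm_num) (by linarith)
      have h1 := S.gap_le' (τ := τ) (by linarith)
      have h2 : 18 / (1 - Θ) ≤ τ := by linarith
      rw [div_le_iff₀ (by linarith)] at h2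
      have h3 := S.logDer'_lt_one (τ := τ) (by linarith)
      by_contra! h4
      nlinarith
  have hF := antitoneOn_Ici_of_deriv (a := T)
    (F := fun x => (u x ^ 2 - mom ξ Θ u v x) - (1 - Θ) / 8 / (1 + x) ^ 2 * u x ^ 2)
    (F' := fun x => -2 * (logDer u v x - (x + ξ)) * u x ^ 2 -
      (-((1 - Θ) / 4) / (1 + x) ^ 3 - 2 * logDer u v x * ((1 - Θ) / 8 / (1 + x) ^ 2)) * u x ^ 2)
    (by
      have := S.cu.mono (Ici_subset_Ici.2 (by linarith : 0 ≤ T))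
      have := S.gap_cont.mono (Ici_subset_Ici.2 (by linarith : 0 ≤ T))
      refine ContinuousOn.sub this (ContinuousOn.mul (ContinuousOn.div (by fun_prop)
        (by fun_prop) ?_) (by fun_prop))
      intro x hx
      have : 0 < 1 + x := by linarith [mem_Ici.1 hx]
      positivity)
    (fun x hx => by
      have hx0 : 0 < 1 + x := by linarith
      refine (S.gap_deriv (by linarith)).sub (S.mul_sq_deriv (by linarith) ?_ rfl)
      refine (((((hasDerivAt_id x).const_add 1).pow 2).inv (pow_pos hx0 2).ne').const_mul
        ((1 - Θ) / 8)).congr_deriv ?_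
      simp
      field_simp
      ring)
    (fun x hx => by
      have h1 := S.logDer_gt (τ := x) (by linarith)
      have h2 := hTp x hx.le
      have h3 := pow_pos (S.pos x (by linarith)) 2
      have h4 := S.logDer_le (τ := x) (by linarith)
      rw [logDer'] at h2
      set q := logDer u v x
      have hx1 : 0 < 1 + x := by linarith
      have hneg := S.neg
      have hlb := S.lb
      have h5 : (1 - Θ) / 2 ≤ (q - (x + ξ)) * (2 * (1 + x)) := by nlinarith
      have h6 : (1 - Θ) / 4 / (1 + x) ≤ q - (x + ξ) := by
        rw [div_le_iff₀ hx1]; linarith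
      have h7 : (1 - Θ) / 4 / (1 + x) ^ 3 ≤ (1 - Θ) / 4 / (1 + x) := by
        apply div_le_div_of_nonneg_left (by linarith) hx1
        nlinarith [pow_pos hx1 2]
      have h8 : 2 * q * ((1 - Θ) / 8 / (1 + x) ^ 2) ≤ (1 - Θ) / 4 / (1 + x) := by
        rw [div_div, mul_div_assoc', div_le_div_iff₀ (by positivity) hx1]
        have : 0 ≤ (1 - Θ) * (1 + x) * ((1 + x) - q) :=
          mul_nonneg (mul_nonneg (by linarith) hx1.le) (by linarith)
        nlinarith
      have h9 : -2 * (q - (x + ξ)) -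
        (-((1 - Θ) / 4) / (1 + x) ^ 3 - 2 * q * ((1 - Θ) / 8 / (1 + x) ^ 2)) ≤ 0 := by
        rw [neg_div]; linarith
      nlinarith)
  have hlim : Tendsto (fun x => (u x ^ 2 - mom ξ Θ u v x) -
      (1 - Θ) / 8 / (1 + x) ^ 2 * u x ^ 2) atTop (𝓝 0) := by
    have h1 : Tendsto (fun x : ℝ => (1 - Θ) / 8 / (1 + x) ^ 2) atTop (𝓝 0) := by
      refine Tendsto.div_atTop tendsto_const_nhds ?_
      exact (tendsto_pow_atTop two_ne_zero).comp (tendsto_atTop_add_const_left _ 1 tendsto_id)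
    simpa using S.gap_tendsto.sub (h1.mul S.tendsto_sq)
  have hfar : ∀ τ, T ≤ τ → (1 - Θ) / 8 ≤ (1 - logDer' ξ Θ u v τ) * (1 + τ) ^ 2 := by
    intro τ hτ
    have h := nonneg_of_antitoneOn_tendsto_zero hF hlim τ hτ
    rw [S.gap_eq (by linarith)] at h
    have h3 := pow_pos (S.pos τ (by linarith)) 2
    have h4 : 0 ≤ (1 - logDer' ξ Θ u v τ - (1 - Θ) / 8 / (1 + τ) ^ 2) * u τ ^ 2 := by linarith
    have h5 := nonneg_of_mul_nonneg_left h4 h3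
    have hx1 : 0 < 1 + τ := by linarith
    have h6 : (1 - Θ) / 8 / (1 + τ) ^ 2 ≤ 1 - logDer' ξ Θ u v τ := by linarith
    rwa [div_le_iff₀ (by positivity)] at h6
  have hT := S.gap_pos (τ := T) (by linarith)
  have hu0 := pow_pos (S.pos 0 le_rfl) 2
  refine ⟨min ((1 - Θ) / 8) ((u T ^ 2 - mom ξ Θ u v T) / u 0 ^ 2), by
    refine lt_min (by linarith) (by positivity), fun τ hτ => ?_⟩
  rcases le_total T τ with h | h
  · exact (min_le_left _ _).trans (hfar τ h)
  · refine (min_le_right _ _).trans ?_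
    have h1 := S.gap_antitone.antitoneOn (mem_Ici.2 hτ) (mem_Ici.2 (hτ.trans h)) h
    have h2 := S.u_antitone (mem_Ici.2 le_rfl) (mem_Ici.2 hτ) hτ
    have h3 := S.pos τ hτ
    have h4 := S.logDer'_lt_one hτ
    simp only [S.gap_eq hτ] at h1
    have h5 : (u T ^ 2 - mom ξ Θ u v T) / u 0 ^ 2 ≤ 1 - logDer' ξ Θ u v τ := by
      rw [div_le_iff₀ hu0]
      have : u τ ^ 2 ≤ u 0 ^ 2 := by gcongr
      nlinarith
    have h6 : 1 ≤ (1 + τ) ^ 2 := by nlinarith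
    nlinarith

end HalfLineState

/-- The data of a boundary layer: the profile `u`, its logarithmic derivative `-q`, the derivative
`h` of `q`, and the first order corrector `r`, with the bounds used in the energy estimates. -/
structure BoundaryProfile (ξ Θ C₁ M : ℝ) (u q h r : ℝ → ℝ) : Prop where
  lb : -1 < ξ
  neg : ξ < 0
  theta_pos : 0 < Θ
  one_le : 1 ≤ M
  pos : ∀ τ, 0 ≤ τ → 0 < u τ
  cu : ContinuousOn u (Ici 0)
  cq : ContinuousOn q (Ici 0)
  cr : ContinuousOn r (Ici 0)
  du : ∀ τ, 0 < τ → HasDerivAt u (-(q τ * u τ)) τ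
  dq : ∀ τ, 0 < τ → HasDerivAt q (h τ) τ
  dh : ∀ τ, 0 < τ → HasDerivAt h (2 * q τ * h τ - 2 * (τ + ξ)) τ
  dr : ∀ τ, 0 < τ → HasDerivAt r (2 * q τ * r τ + (q τ - h τ * (τ + ξ)) - C₁) τ
  rel : ∀ τ, h τ = q τ ^ 2 - (τ + ξ) ^ 2 + Θ
  q_nonneg : ∀ τ, 0 ≤ τ → 0 ≤ q τ
  q_le : ∀ τ, 0 ≤ τ → q τ ≤ τ
  h_nonneg : ∀ τ, 0 ≤ τ → 0 ≤ h τ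
  h_le : ∀ τ, 0 ≤ τ → h τ ≤ 1
  gap_lower : ∀ τ, 0 ≤ τ → 1 ≤ M * (1 + τ) ^ 2 * (1 - h τ)
  gap_upper : ∀ τ, 0 ≤ τ → (1 - h τ) * (1 + τ) ^ 2 ≤ M
  g_nonneg : ∀ τ, 0 ≤ τ → 0 ≤ q τ - h τ * (τ + ξ)
  g_decay : ∀ τ, 0 ≤ τ → (q τ - h τ * (τ + ξ)) * (1 + τ) ≤ M
  r_decay : ∀ τ, 0 ≤ τ → |r τ| * (1 + τ) ≤ M
  h_small : ∀ τ, 0 ≤ τ → h τ ≤ M * τ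
  g_small : ∀ τ, 0 ≤ τ → q τ - h τ * (τ + ξ) ≤ M * τ
  r_small : ∀ τ, 0 ≤ τ → |r τ| ≤ M * τ
  u_decay : ∀ τ, 0 ≤ τ → u τ ^ 2 ≤ M * Real.exp (-(τ + ξ) ^ 2)

namespace HalfLineState

variable {ξ Θ : ℝ} {u v : ℝ → ℝ}

/-- The first moment function `q - h · (τ + ξ)`. -/
def layerField (ξ Θ : ℝ) (u v : ℝ → ℝ) (τ : ℝ) : ℝ :=
  logDer u v τ - logDer' ξ Θ u v τ * (τ + ξ)

theorem layerField_nonneg (S : HalfLineState ξ Θ u v) {τ : ℝ} (hτ : 0 ≤ τ) :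
    0 ≤ layerField ξ Θ u v τ := by
  have h1 := S.logDer_gt hτ
  have h2 := S.logDer_nonneg hτ
  have h3 := S.logDer'_nonneg hτ
  have h4 := S.logDer'_lt_one hτ
  rw [layerField]
  rcases le_total 0 (τ + ξ) with h | h <;> nlinarith

theorem layerField_decay (S : HalfLineState ξ Θ u v) {τ : ℝ} (hτ : 0 ≤ τ) :
    layerField ξ Θ u v τ * (1 + τ) ≤ 9 := by
  have h1 := S.logDer_gt hτ
  have h2 := S.logDer_nonneg hτ
  have h3 := S.logDer'_nonneg hτ
  have h4 := S.logDer'_lt_one hτ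
  have h5 := S.logDer_le hτ
  have hlb := S.lb
  have hneg := S.neg
  have hg := S.layerField_nonneg hτ
  rcases le_total τ 2 with h | h
  · have : layerField ξ Θ u v τ ≤ 3 := by
      rw [layerField]; nlinarith
    nlinarith
  · have hw : 1 ≤ τ + ξ := by linarith
    have h6 := S.gap_le (τ := τ) (by linarith)
    have h7 : (logDer u v τ - (τ + ξ)) * (logDer u v τ + (τ + ξ)) ≤ 1 := by
      have : logDer' ξ Θ u v τ = logDer u v τ ^ 2 - (τ + ξ) ^ 2 + Θ := rfl
      have := S.theta_pos
      nlinarith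
    have h8 : (logDer u v τ - (τ + ξ)) * (τ + ξ) ≤ 1 / 2 := by nlinarith
    have h9 : layerField ξ Θ u v τ * (τ + ξ) ≤ 1 := by
      have : layerField ξ Θ u v τ = (logDer u v τ - (τ + ξ)) +
        (1 - logDer' ξ Θ u v τ) * (τ + ξ) := by rw [layerField]; ring
      rw [this]; nlinarith
    nlinarith

theorem logDer'_small (S : HalfLineState ξ Θ u v) {τ : ℝ} (hτ : 0 ≤ τ) :
    logDer' ξ Θ u v τ ≤ 2 * τ := by
  have h2 := S.logDer_nonneg hτ
  have h5 := S.logDer_le hτ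
  have hlb := S.lb
  have := S.sq
  rw [logDer']
  nlinarith

theorem layerField_small (S : HalfLineState ξ Θ u v) {τ : ℝ} (hτ : 0 ≤ τ) :
    layerField ξ Θ u v τ ≤ 3 * τ := by
  have h5 := S.logDer_le hτ
  have h3 := S.logDer'_nonneg hτ
  have hlb := S.lb
  have := S.logDer'_small hτ
  rw [layerField]
  nlinarith

/-- The function `C₁ (1 - ∫₀^τ u²) - (u² + (τ + ξ) u u' + ((τ + ξ)² - Θ) m) / 3`. -/
def corrNum (ξ Θ : ℝ) (u v : ℝ → ℝ) (τ : ℝ) : ℝ :=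
  u 0 ^ 2 / 3 * (1 - ∫ x in (0)..τ, u x ^ 2) -
    (u τ ^ 2 + (τ + ξ) * (u τ * v τ) + ((τ + ξ) ^ 2 - Θ) * mom ξ Θ u v τ) / 3

theorem corrNum_zero (S : HalfLineState ξ Θ u v) : corrNum ξ Θ u v 0 = 0 := by
  have := S.sq
  simp [corrNum, S.v0, mom_zero S]

theorem intervalIntegrable_sq (S : HalfLineState ξ Θ u v) {τ : ℝ} (hτ : 0 ≤ τ) :
    IntervalIntegrable (fun x => u x ^ 2) volume 0 τ := by
  refine (ContinuousOn.pow (S.cu.mono ?_) 2).intervalIntegrable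
  rw [uIcc_of_le hτ]
  exact fun x hx => hx.1

theorem corrNum_deriv (S : HalfLineState ξ Θ u v) {τ : ℝ} (hτ : 0 < τ) :
    HasDerivAt (corrNum ξ Θ u v) ((layerField ξ Θ u v τ - u 0 ^ 2 / 3) * u τ ^ 2) τ := by
  have hc : ContinuousOn (fun x => u x ^ 2) (Ioi 0) := (S.cu.mono Ioi_subset_Ici_self).pow 2
  have h1 : HasDerivAt (fun τ => ∫ x in (0)..τ, u x ^ 2) (u τ ^ 2) τ :=
    intervalIntegral.integral_hasDerivAt_right (S.intervalIntegrable_sq hτ.le)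
      (hc.stronglyMeasurableAtFilter isOpen_Ioi τ hτ) (hc.continuousAt (Ioi_mem_nhds hτ))
  have hw : HasDerivAt (fun x : ℝ => x + ξ) 1 τ := (hasDerivAt_id τ).add_const ξ
  have h2 := ((h1.const_sub 1).const_mul (u 0 ^ 2 / 3)).sub
    (((((S.du τ hτ).pow 2).add (hw.mul ((S.du τ hτ).mul (S.dv τ hτ)))).add
      (((hw.pow 2).sub_const Θ).mul (S.mom_deriv hτ))).div_const 3)
  refine h2.congr_deriv ?_
  have hm := S.mom_eq hτ.le
  rw [mom] at hm
  simp only [layerField, mom, S.v_eq hτ.le, Pi.pow_apply] at hm ⊢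
  simp
  linear_combination (-(τ + ξ)) * hm - u τ * S.v_eq hτ.le / 3

theorem corrNum_cont (S : HalfLineState ξ Θ u v) : ContinuousOn (corrNum ξ Θ u v) (Ici 0) := by
  have h1 := S.cu
  have h2 := S.cv
  have h3 := S.mom_cont
  have h4 : ContinuousOn (fun τ => ∫ x in (0)..τ, u x ^ 2) (Ici 0) := by
    have : IntegrableOn (fun x => u x ^ 2) (Ici 0) := by
      rw [integrableOn_Ici_iff_integrableOn_Ioi]; exact S.int
    intro x hx
    have hx1 := intervalIntegral.continuousOn_primitive_interval (μ := volume)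
      (f := fun x => u x ^ 2) (a := 0) (b := x + 1)
      (this.mono_set (by rw [uIcc_of_le (by linarith [mem_Ici.1 hx])]; exact fun y hy => hy.1))
    rw [uIcc_of_le (by linarith [mem_Ici.1 hx])] at hx1
    refine (hx1 x ⟨hx, by linarith⟩).mono_of_mem_nhdsWithin ?_
    rw [mem_nhdsWithin_iff_exists_mem_nhds_inter]
    exact ⟨Iio (x + 1), Iio_mem_nhds (by linarith), fun y hy => ⟨hy.2, hy.1.le⟩⟩
  unfold corrNum
  fun_prop

theorem corrNum_tendsto (S : HalfLineState ξ Θ u v) (hn : (∫ τ in Ioi (0 : ℝ), u τ ^ 2) = 1) :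
    Tendsto (corrNum ξ Θ u v) atTop (𝓝 0) := by
  have h1 := intervalIntegral_tendsto_integral_Ioi (0 : ℝ) S.int tendsto_id
  rw [hn] at h1
  have hΘ := S.theta_lt
  have hΘ' := S.theta_pos
  have hlb := S.lb
  have hneg := S.neg
  have h2 : Tendsto (fun τ => (τ + ξ) * (u τ * v τ)) atTop (𝓝 0) := by
    refine squeeze_zero_norm' ?_ (S.tendsto_poly_sq 2)
    filter_upwards [eventually_ge_atTop 0] with τ hτ
    have ha := S.logDer_nonneg hτ
    have hb := S.logDer_le hτ
    have hc : |τ + ξ| ≤ 1 + τ := abs_le.2 ⟨by linarith, by linarith⟩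
    have hd : (τ + ξ) * (u τ * v τ) = -((τ + ξ) * (logDer u v τ * u τ ^ 2)) := by
      rw [S.v_eq hτ]; ring
    rw [hd, norm_neg, Real.norm_eq_abs, abs_mul, abs_of_nonneg (mul_nonneg ha (sq_nonneg _))]
    calc _ ≤ (1 + τ) * ((1 + τ) * u τ ^ 2) := by
          gcongr
          linarith
      _ = _ := by ring
  have h3 : Tendsto (fun τ => ((τ + ξ) ^ 2 - Θ) * mom ξ Θ u v τ) atTop (𝓝 0) := by
    refine squeeze_zero_norm' ?_ (S.tendsto_poly_sq 2)
    filter_upwards [eventually_ge_atTop 0] with τ hτ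
    have ha := S.mom_nonneg hτ
    have hb := S.gap_pos hτ
    have hc : |(τ + ξ) ^ 2 - Θ| ≤ (1 + τ) ^ 2 := abs_le.2 ⟨by nlinarith, by nlinarith⟩
    rw [Real.norm_eq_abs, abs_mul, abs_of_nonneg ha]
    gcongr
    linarith
  have h4 := ((h1.const_sub 1).const_mul (u 0 ^ 2 / 3)).sub
    (((S.tendsto_sq.add h2).add h3).div_const 3)
  have h5 : corrNum ξ Θ u v = fun τ => u 0 ^ 2 / 3 * (1 - ∫ x in (0)..τ, u x ^ 2) -
    (u τ ^ 2 + (τ + ξ) * (u τ * v τ) + ((τ + ξ) ^ 2 - Θ) * mom ξ Θ u v τ) / 3 := rfl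
  rw [h5]
  simpa using h4

/-- The first order corrector. -/
def corrector (ξ Θ : ℝ) (u v : ℝ → ℝ) (τ : ℝ) : ℝ := corrNum ξ Θ u v τ / u τ ^ 2

theorem corrector_deriv (S : HalfLineState ξ Θ u v) {τ : ℝ} (hτ : 0 < τ) :
    HasDerivAt (corrector ξ Θ u v) (2 * logDer u v τ * corrector ξ Θ u v τ +
      layerField ξ Θ u v τ - u 0 ^ 2 / 3) τ := by
  have hu := S.pos τ hτ.le
  refine ((S.corrNum_deriv hτ).div ((S.du τ hτ).pow 2) (pow_pos hu 2).ne').congr_deriv ?_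
  rw [corrector, S.v_eq hτ.le]
  simp
  field_simp
  ring

theorem corrector_cont (S : HalfLineState ξ Θ u v) : ContinuousOn (corrector ξ Θ u v) (Ici 0) :=
  S.corrNum_cont.div (S.cu.pow 2) fun x hx => (pow_pos (S.pos x hx) 2).ne'

theorem corrector_decay_far (S : HalfLineState ξ Θ u v) (hn : (∫ τ in Ioi (0 : ℝ), u τ ^ 2) = 1) :
    ∃ K, 0 ≤ K ∧ ∀ τ, 2 ≤ τ → |corrector ξ Θ u v τ| * (1 + τ) ≤ K := by
  set C₁ := u 0 ^ 2 / 3 with hC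
  have hC0 : 0 ≤ C₁ := by positivity
  set K := 3 / 2 * C₁ + 27 / 2 with hK
  have hK0 : 0 ≤ K := by positivity
  have key : ∀ σ : ℝ, (σ = 1 ∨ σ = -1) → ∀ τ, 2 ≤ τ → 0 ≤ K / (1 + τ) * u τ ^ 2 +
      σ * corrNum ξ Θ u v τ := by
    intro σ hσ
    refine nonneg_of_antitoneOn_tendsto_zero (antitoneOn_Ici_of_deriv
      (F' := fun x => (-K / (1 + x) ^ 2 - 2 * logDer u v x * (K / (1 + x))) * u x ^ 2 +
        σ * ((layerField ξ Θ u v x - C₁) * u x ^ 2)) ?_ ?_ ?_) ?_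
    · have h1 := S.cu.mono (Ici_subset_Ici.2 (by norm_num : (0 : ℝ) ≤ 2))
      have h2 := S.corrNum_cont.mono (Ici_subset_Ici.2 (by norm_num : (0 : ℝ) ≤ 2))
      refine ContinuousOn.add (ContinuousOn.mul (ContinuousOn.div (by fun_prop) (by fun_prop) ?_)
        (by fun_prop)) (by fun_prop)
      intro x hx
      have : 0 < 1 + x := by linarith [mem_Ici.1 hx]
      positivity
    · intro x hx
      have hx0 : 0 < 1 + x := by linarith
      refine (S.mul_sq_deriv (by linarith) ?_ rfl).add ((S.corrNum_deriv (by linarith)).const_mul σ)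
      refine ((hasDerivAt_const x K).div ((hasDerivAt_id x).const_add 1) hx0.ne').congr_deriv ?_
      simp
    · intro x hx
      have hx0 : 0 < 1 + x := by linarith
      have h1 := S.logDer_gt (τ := x) (by linarith)
      have h2 := S.lb
      have h3 := S.layerField_nonneg (τ := x) (by linarith)
      have h4 := S.layerField_decay (τ := x) (by linarith)
      have h5 : layerField ξ Θ u v x ≤ 9 := by nlinarith
      have h6 : 2 / 3 * K ≤ 2 * logDer u v x * (K / (1 + x)) := by
        rw [mul_div_assoc', le_div_iff₀ hx0]
        nlinarith
      have h7 : -K / (1 + x) ^ 2 ≤ 0 := div_nonpos_of_nonpos_of_nonneg (by linarith) (by positivity)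
      have h8 : σ * (layerField ξ Θ u v x - C₁) ≤ 9 + C₁ := by
        rcases hσ with rfl | rfl <;> linarith
      have h9 : -K / (1 + x) ^ 2 - 2 * logDer u v x * (K / (1 + x)) +
          σ * (layerField ξ Θ u v x - C₁) ≤ 0 := by linarith
      have := mul_nonpos_of_nonpos_of_nonneg h9 (sq_nonneg (u x))
      linarith
    · have h1 : Tendsto (fun τ => K / (1 + τ) * u τ ^ 2) atTop (𝓝 0) := by
        have := (tendsto_const_nhds (x := K)).div_atTop
          (tendsto_atTop_add_const_left atTop (1 : ℝ) tendsto_id)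
        simpa using this.mul S.tendsto_sq
      simpa using h1.add ((S.corrNum_tendsto hn).const_mul σ)
  refine ⟨K, hK0, fun τ hτ => ?_⟩
  have hu := pow_pos (S.pos τ (by linarith)) 2
  have h1 := key 1 (Or.inl rfl) τ hτ
  have h2 := key (-1) (Or.inr rfl) τ hτ
  have hx0 : 0 < 1 + τ := by linarith
  rw [← le_div_iff₀ hx0, corrector, abs_div, abs_of_pos hu, div_le_iff₀ hu, abs_le]
  constructor <;> linarith

theorem corrector_small_near (S : HalfLineState ξ Θ u v) :
    ∃ K, 0 ≤ K ∧ ∀ τ, 0 ≤ τ → τ ≤ 2 → |corrector ξ Θ u v τ| ≤ K * τ := by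
  set C₁ := u 0 ^ 2 / 3 with hC
  have hC0 : 0 ≤ C₁ := by positivity
  set c := (9 + C₁) * u 0 ^ 2 with hc
  have hc0 : 0 ≤ c := by positivity
  have hb : ∀ x, 0 < x → |(layerField ξ Θ u v x - C₁) * u x ^ 2| ≤ c := by
    intro x hx
    have h3 := S.layerField_nonneg (τ := x) hx.le
    have h4 := S.layerField_decay (τ := x) hx.le
    have h5 : layerField ξ Θ u v x ≤ 9 := by nlinarith
    have h6 : u x ≤ u 0 := S.u_antitone (mem_Ici.2 le_rfl) (mem_Ici.2 hx.le) hx.le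
    have h7 := (S.pos x hx.le).le
    rw [abs_mul, abs_of_nonneg (sq_nonneg (u x)), hc]
    gcongr
    exact abs_le.2 ⟨by linarith, by linarith⟩
  have h1 := linear_upper_bound S.corrNum_cont (fun x hx => S.corrNum_deriv hx)
    (fun x hx => (abs_le.1 (hb x hx)).2)
  have h2 := linear_upper_bound S.corrNum_cont.neg (fun x hx => (S.corrNum_deriv hx).neg)
    (c := c) (fun x hx => by rw [hC] at hb; linarith [(abs_le.1 (hb x hx)).1])
  have hu2 := S.pos 2 (by norm_num)
  refine ⟨c / u 2 ^ 2, by positivity, fun τ hτ hτ2 => ?_⟩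
  have h3 := h1 τ hτ
  have h4 := h2 τ hτ
  simp only [Pi.neg_apply, S.corrNum_zero, sub_zero, neg_zero, zero_add] at h3 h4
  have h5 : |corrNum ξ Θ u v τ| ≤ c * τ := abs_le.2 ⟨by linarith, by linarith⟩
  have h6 : u 2 ≤ u τ := S.u_antitone (mem_Ici.2 hτ) (mem_Ici.2 (by norm_num)) hτ2
  have hu := S.pos τ hτ
  rw [corrector, abs_div, abs_of_pos (pow_pos hu 2), div_mul_eq_mul_div]
  gcongr

theorem boundaryProfile (S : HalfLineState ξ Θ u v) (hn : (∫ τ in Ioi (0 : ℝ), u τ ^ 2) = 1) :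
    ∃ M, BoundaryProfile ξ Θ (u 0 ^ 2 / 3) M u (logDer u v) (logDer' ξ Θ u v)
      (corrector ξ Θ u v) := by
  obtain ⟨c, hc, hgap⟩ := S.gap_ge
  obtain ⟨K₁, hK₁, hfar⟩ := S.corrector_decay_far hn
  obtain ⟨K₂, hK₂, hnear⟩ := S.corrector_small_near
  set M := 9 + 1 / c + K₁ + 6 * K₂ + u 0 ^ 2 * Real.exp (ξ ^ 2) with hM
  have hc' : 0 < 1 / c := by positivity
  have hu' : 0 ≤ u 0 ^ 2 * Real.exp (ξ ^ 2) := by positivity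
  have hM9 : 9 ≤ M := by linarith
  refine ⟨M, S.lb, S.neg, S.theta_pos, by linarith, S.pos, S.cu, S.logDer_cont, S.corrector_cont,
    fun τ hτ => ?_, fun τ hτ => S.logDer_deriv hτ, fun τ hτ => S.logDer'_deriv hτ,
    fun τ hτ => S.corrector_deriv hτ,
    fun τ => rfl, fun τ hτ => S.logDer_nonneg hτ, fun τ hτ => S.logDer_le hτ,
    fun τ hτ => S.logDer'_nonneg hτ, fun τ hτ => (S.logDer'_lt_one hτ).le, fun τ hτ => ?_,
    fun τ hτ => (S.gap_le' hτ).trans hM9, fun τ hτ => S.layerField_nonneg hτ,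
    fun τ hτ => (S.layerField_decay hτ).trans hM9, fun τ hτ => ?_,
    fun τ hτ => (S.logDer'_small hτ).trans (by nlinarith),
    fun τ hτ => (S.layerField_small hτ).trans (by nlinarith), fun τ hτ => ?_, fun τ hτ => ?_⟩
  · rw [← S.v_eq hτ.le]
    exact S.du τ hτ
  · have h1 := hgap τ hτ
    have h2 : 1 / c * c = 1 := by field_simp
    nlinarith
  · rcases le_total τ 2 with h | h
    · have := hnear τ hτ h
      have h0 := abs_nonneg (corrector ξ Θ u v τ)
      nlinarith
    · linarith [hfar τ h]
  · rcases le_total τ 2 with h | h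
    · refine (hnear τ hτ h).trans ?_
      nlinarith
    · have := hfar τ h
      have h0 := abs_nonneg (corrector ξ Θ u v τ)
      nlinarith
  · refine (S.gaussian_bound hτ).trans ?_
    gcongr
    linarith

end HalfLineState

theorem DeGennes.boundaryProfile (D : DeGennes) :
    ∃ M u q h r, BoundaryProfile D.ξ₀ Theta0 D.C1 M u q h r := by
  obtain ⟨M, hM⟩ := D.halfLineState.boundaryProfile D.u₀_normalized
  exact ⟨M, _, _, _, _, hM⟩

theorem quadratic_form_nonneg {m b c V Y U : ℝ} (hm : 0 ≤ m) (hc : 0 ≤ c) (hb : b ^ 2 ≤ m * c)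
    (hV : 0 ≤ V) (hU : 0 ≤ U) (hY : Y ^ 2 ≤ V * U) : 0 ≤ m * V + 2 * b * Y + c * U := by
  have h1 : (2 * b * Y) ^ 2 ≤ (m * V + c * U) ^ 2 := by
    have : b ^ 2 * Y ^ 2 ≤ (m * c) * (V * U) := mul_le_mul hb hY (sq_nonneg _) (mul_nonneg hm hc)
    nlinarith [sq_nonneg (m * V - c * U)]
  have h2 := abs_le_of_sq_le_sq h1 (by positivity)
  linarith [(abs_le.1 h2).1]

namespace BoundaryProfile

variable {ξ Θ C₁ M : ℝ} {u q h r : ℝ → ℝ}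

theorem sq_r_le (P : BoundaryProfile ξ Θ C₁ M u q h r) {τ : ℝ} (hτ : 0 ≤ τ) :
    r τ ^ 2 ≤ M ^ 3 * (1 - h τ ^ 2) ∧ r τ ^ 2 ≤ M ^ 2 ∧ |r τ| ≤ M := by
  have h1 := P.gap_lower τ hτ
  have h2 := P.r_decay τ hτ
  have h3 := P.h_nonneg τ hτ
  have h4 := P.h_le τ hτ
  have hM := P.one_le
  have h5 : |r τ| ≤ M := by nlinarith [abs_nonneg (r τ)]
  have h6 : r τ ^ 2 * (1 + τ) ^ 2 ≤ M ^ 2 := by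
    rw [← sq_abs, ← mul_pow]
    exact pow_le_pow_left₀ (by positivity) h2 2
  refine ⟨?_, ?_, h5⟩
  · have h7 : r τ ^ 2 ≤ M ^ 3 * (1 - h τ) := by
      calc r τ ^ 2 = r τ ^ 2 * 1 := by ring
        _ ≤ r τ ^ 2 * (M * (1 + τ) ^ 2 * (1 - h τ)) := by gcongr
        _ = (r τ ^ 2 * (1 + τ) ^ 2) * (M * (1 - h τ)) := by ring
        _ ≤ M ^ 2 * (M * (1 - h τ)) := by
          have : 0 ≤ M * (1 - h τ) := mul_nonneg (by linarith) (by linarith)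
          gcongr
        _ = _ := by ring
    refine h7.trans (mul_le_mul_of_nonneg_left ?_ (by positivity))
    nlinarith
  · rw [← sq_abs]
    exact pow_le_pow_left₀ (abs_nonneg _) h5 2

theorem g_le (P : BoundaryProfile ξ Θ C₁ M u q h r) {τ : ℝ} (hτ : 0 ≤ τ) :
    q τ - h τ * (τ + ξ) ≤ M ∧ τ * (q τ - h τ * (τ + ξ)) ≤ M := by
  have h1 := P.g_decay τ hτ
  have h2 := P.g_nonneg τ hτ
  constructor <;> nlinarith

/-- The pointwise certificate giving the two-term lower bound of the boundary operator. -/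
theorem certificate (P : BoundaryProfile ξ Θ C₁ M u q h r) {τ K s D lap Zs X U : ℝ}
    (hτ : 0 ≤ τ) (hs : 0 < s) (hK : |K / s * τ| ≤ 1 / 2)
    (hlap : -(K / s) / (1 - K / s * τ) ≤ lap) (hD : |lap| ≤ D / s)
    (hZ : 0 ≤ Zs) (hU : 0 ≤ U) (hX : X ^ 2 ≤ Zs * U) :
    (Θ - K / s * C₁ - (K ^ 2 * (M ^ 3 + M ^ 2 + 2 * M) + D * |K| * M) / s ^ 2) * U ≤
      (1 - h τ ^ 2) * Zs +
      ((2 * q τ * h τ - 2 * (τ + ξ)) - 2 * h τ * (q τ - h τ * (τ + ξ) + K / s * r τ)) * X +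
      (h τ + (-(2 * q τ * h τ - 2 * (τ + ξ)) * (τ + ξ) +
        K / s * (2 * q τ * r τ + (q τ - h τ * (τ + ξ)) - C₁)) +
        lap * (q τ - h τ * (τ + ξ) + K / s * r τ) -
        (q τ - h τ * (τ + ξ) + K / s * r τ) ^ 2) * U := by
  obtain ⟨hr1, hr2, hr3⟩ := P.sq_r_le hτ
  obtain ⟨hg1, hg2⟩ := P.g_le hτ
  have hg0 := P.g_nonneg τ hτ
  have hrel := P.rel τ
  have hh0 := P.h_nonneg τ hτ
  have hh1 := P.h_le τ hτ
  have hM := P.one_le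
  have hDK : D * |K| * M / s ^ 2 = (D / s) * (|K / s| * M) := by
    rw [abs_div, abs_of_pos hs]; field_simp
  have hKs : K ^ 2 / s ^ 2 = (K / s) ^ 2 := by rw [div_pow]
  rw [add_div, hDK, mul_div_right_comm, hKs]
  set e := K / s with he
  set w := τ + ξ with hw
  set g0 := q τ - h τ * w with hg0'
  have h1e : 1 / 2 ≤ 1 - e * τ := by linarith [(abs_le.1 hK).2]
  have hV : 0 ≤ Zs - 2 * w * X + w ^ 2 * U := by
    have := quadratic_form_nonneg (m := 1) (b := -w) (c := w ^ 2) (V := Zs) (Y := X) (U := U)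
      (by norm_num) (sq_nonneg _) (by nlinarith) hZ hU hX
    linarith
  have hY : (X - w * U) ^ 2 ≤ (Zs - 2 * w * X + w ^ 2 * U) * U := by nlinarith
  have h1h : 0 ≤ 1 - h τ ^ 2 := by nlinarith
  have main := quadratic_form_nonneg (m := 1 - h τ ^ 2) (b := -(e * r τ * h τ))
    (c := e ^ 2 * M ^ 3) h1h (by positivity) (by
      have hhs : h τ ^ 2 ≤ 1 := by linarith
      calc (-(e * r τ * h τ)) ^ 2 = e ^ 2 * (r τ ^ 2 * h τ ^ 2) := by ring
        _ ≤ e ^ 2 * ((M ^ 3 * (1 - h τ ^ 2)) * 1) := by gcongr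
        _ = _ := by ring) hV hU hY
  have hlg : -(e * g0) - 2 * e ^ 2 * M ≤ lap * g0 := by
    have h1 : -e / (1 - e * τ) * g0 ≤ lap * g0 := mul_le_mul_of_nonneg_right hlap hg0
    have h2 : -e / (1 - e * τ) = -e - e ^ 2 * τ / (1 - e * τ) := by
      field_simp
      ring
    have h3 : e ^ 2 * τ / (1 - e * τ) * g0 ≤ 2 * e ^ 2 * M := by
      have : e ^ 2 * τ / (1 - e * τ) ≤ 2 * (e ^ 2 * τ) := by
        rw [div_le_iff₀ (by linarith)]
        have := mul_nonneg (mul_nonneg (sq_nonneg e) hτ) (sub_nonneg.2 h1e)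
        linarith
      calc _ ≤ 2 * (e ^ 2 * τ) * g0 := mul_le_mul_of_nonneg_right this hg0
        _ = 2 * e ^ 2 * (τ * g0) := by ring
        _ ≤ _ := by gcongr
    rw [h2, sub_mul, neg_mul] at h1
    linarith
  have hlr : -(D / s * (|e| * M)) ≤ lap * (e * r τ) := by
    have : |lap * (e * r τ)| ≤ D / s * (|e| * M) := by
      rw [abs_mul, abs_mul]
      exact mul_le_mul hD (mul_le_mul_of_nonneg_left hr3 (abs_nonneg _)) (by positivity)
        ((abs_nonneg _).trans hD)
    exact (abs_le.1 this).1
  have hr4 : e ^ 2 * r τ ^ 2 ≤ e ^ 2 * M ^ 2 := by gcongr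
  have hUb : 0 ≤ (lap * g0 + lap * (e * r τ) + e * g0 + 2 * e ^ 2 * M + D / s * (|e| * M) +
      (e ^ 2 * M ^ 2 - e ^ 2 * r τ ^ 2)) * U := mul_nonneg (by linarith) hU
  have hq : q τ = g0 + h τ * w := by rw [hg0']; ring
  have hrel' : (h τ - ((g0 + h τ * w) ^ 2 - w ^ 2 + Θ)) = 0 := by
    rw [← hq]; linarith
  rw [hq]
  linear_combination main + hUb - U * hrel'

end BoundaryProfile

/-- Completing the square in an orthonormal frame `n, n^⊥` for the first order operator
`D = p + i m` acting on `u = a + i b`. -/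
theorem frame_lower_bound {p₁ m₁ p₂ m₂ a b n₁ n₂ f f' G κ v : ℝ} (hn : n₁ ^ 2 + n₂ ^ 2 = 1) :
    (1 - f ^ 2) * ((n₂ * p₁ - n₁ * p₂) ^ 2 + (n₂ * m₁ - n₁ * m₂) ^ 2) +
      (f' - 2 * f * G) * (a * (n₂ * p₁ - n₁ * p₂) + b * (n₂ * m₁ - n₁ * m₂)) +
      (f * κ + v - G ^ 2) * (a ^ 2 + b ^ 2) ≤
    (p₁ ^ 2 + m₁ ^ 2 + (p₂ ^ 2 + m₂ ^ 2)) +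
      (f * (-2 * (p₁ * m₂ - m₁ * p₂) + κ * (a ^ 2 + b ^ 2)) - f' * n₁ * (a * p₂ + b * m₂) +
        f' * n₂ * (a * p₁ + b * m₁) + G * n₁ * (2 * (b * p₁ - a * m₁)) +
        G * n₂ * (2 * (b * p₂ - a * m₂)) + v * (a ^ 2 + b ^ 2)) := by
  have h1 : p₁ ^ 2 + m₁ ^ 2 + (p₂ ^ 2 + m₂ ^ 2) =
      (n₁ * p₁ + n₂ * p₂) ^ 2 + (n₁ * m₁ + n₂ * m₂) ^ 2 +
      ((n₂ * p₁ - n₁ * p₂) ^ 2 + (n₂ * m₁ - n₁ * m₂) ^ 2) := by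
    linear_combination (-(p₁ ^ 2 + m₁ ^ 2 + (p₂ ^ 2 + m₂ ^ 2))) * hn
  have h2 : p₁ * m₂ - m₁ * p₂ = -((n₁ * p₁ + n₂ * p₂) * (n₂ * m₁ - n₁ * m₂) -
      (n₁ * m₁ + n₂ * m₂) * (n₂ * p₁ - n₁ * p₂)) := by
    linear_combination (-(p₁ * m₂ - m₁ * p₂)) * hn
  rw [h1, h2]
  have h3 := sq_nonneg (-(n₁ * m₁ + n₂ * m₂) + f * (n₂ * p₁ - n₁ * p₂) + G * a)
  have h4 := sq_nonneg ((n₁ * p₁ + n₂ * p₂) + f * (n₂ * m₁ - n₁ * m₂) + G * b)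
  linarith

theorem blended_lower_bound {χ χ' h hp Ga Gp lap B b Zs X ρ L C ε : ℝ} (hχ₀ : 0 ≤ χ)
    (hχ₁ : χ ≤ 1) (hZ : 0 ≤ Zs) (hρ : 0 ≤ ρ) (hX : X ^ 2 ≤ Zs * ρ)
    (hA : L * ρ ≤ (1 - h ^ 2) * Zs + (hp - 2 * h * Ga) * X +
      (h * B + Gp + Ga * lap - Ga ^ 2) * ρ)
    (hB : L ≤ B) (hε : |χ' * (1 - h)| ≤ ε) (hC : |χ' * Ga| ≤ C) :
    (L - C - ε) * ρ - ε * Zs + ((1 - χ) * h + χ) * b * ρ ≤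
      (1 - ((1 - χ) * h + χ) ^ 2) * Zs +
      (((1 - χ) * hp + χ' * (1 - h)) - 2 * ((1 - χ) * h + χ) * ((1 - χ) * Ga)) * X +
      (((1 - χ) * h + χ) * (B + b) + ((1 - χ) * (Gp + Ga * lap) - χ' * Ga) -
        ((1 - χ) * Ga) ^ 2) * ρ := by
  have h1 : 0 ≤ (1 - h) ^ 2 * Zs + 2 * (-((1 - h) * Ga)) * X + Ga ^ 2 * ρ :=
    quadratic_form_nonneg (sq_nonneg _) (sq_nonneg _) (by nlinarith) hZ hρ hX
  have h2 := mul_nonneg (mul_nonneg hχ₀ (sub_nonneg.2 hχ₁)) h1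
  have h3 : |X| ≤ Zs + ρ := by
    refine abs_le_of_sq_le_sq (b := Zs + ρ) ?_ (by positivity)
    nlinarith
  have h4 : |χ' * (1 - h) * X| ≤ ε * (Zs + ρ) := by
    rw [abs_mul]
    exact mul_le_mul hε h3 (abs_nonneg _) ((abs_nonneg _).trans hε)
  have h5 := (abs_le.1 h4).1
  have h6 := mul_le_mul_of_nonneg_right (abs_le.1 hC).2 hρ
  have h7 := mul_le_mul_of_nonneg_left hA (sub_nonneg.2 hχ₁)
  have h8 := mul_le_mul_of_nonneg_left (mul_le_mul_of_nonneg_right hB hρ) hχ₀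
  linear_combination h2 + h5 + h6 + h7 + h8

/-- Derivative in the first coordinate direction. -/
def dx {E : Type*} [NormedAddCommGroup E] [NormedSpace ℝ E] (F : Plane → E) (x : Plane) : E :=
  fderiv ℝ F x ((1 : ℝ), (0 : ℝ))

/-- Derivative in the second coordinate direction. -/
def dy {E : Type*} [NormedAddCommGroup E] [NormedSpace ℝ E] (F : Plane → E) (x : Plane) : E :=
  fderiv ℝ F x ((0 : ℝ), (1 : ℝ))

/-- Continuously differentiable functions with compact support. -/
def TestFun (F : Plane → ℝ) : Prop := ContDiff ℝ 1 F ∧ HasCompactSupport F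

namespace TestFun

variable {F G : Plane → ℝ}

theorem differentiable (hF : TestFun F) : Differentiable ℝ F := hF.1.differentiable one_ne_zero

theorem continuous (hF : TestFun F) : Continuous F := hF.1.continuous

theorem continuous_fderiv_apply (hF : TestFun F) (v : Plane) :
    Continuous (fun x => fderiv ℝ F x v) :=
  (hF.1.continuous_fderiv one_ne_zero).clm_apply continuous_const

theorem compact_fderiv_apply (hF : TestFun F) (v : Plane) :
    HasCompactSupport (fun x => fderiv ℝ F x v) := hF.2.fderiv_apply ℝ v

theorem mul (hF : TestFun F) (hG : ContDiff ℝ 1 G) : TestFun (fun x => F x * G x) :=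
  ⟨hF.1.mul hG, hF.2.mul_right⟩

theorem integral_fderiv_eq_zero (hF : TestFun F) (v : Plane) : ∫ x, fderiv ℝ F x v = 0 := by
  have i1 : Integrable (fun x => fderiv ℝ F x v) :=
    (hF.continuous_fderiv_apply v).integrable_of_hasCompactSupport (hF.compact_fderiv_apply v)
  have i2 : Integrable F := hF.continuous.integrable_of_hasCompactSupport hF.2
  have := integral_mul_fderiv_eq_neg_fderiv_mul_of_integrable (μ := (volume : Measure Plane))
    (f := fun _ => (1 : ℝ)) (g := F) (v := v) (by simp) (by simpa using i1) (by simpa using i2)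
    (fun _ _ => differentiableAt_const _) (fun x _ => hF.differentiable x)
  simpa using this

theorem integral_fderiv_mul (hF : TestFun F) (hG : TestFun G) (v : Plane) :
    ∫ x, G x * fderiv ℝ F x v = - ∫ x, fderiv ℝ G x v * F x := by
  refine integral_mul_fderiv_eq_neg_fderiv_mul_of_integrable ?_ ?_ ?_
    (fun x _ => hG.differentiable x) (fun x _ => hF.differentiable x)
  · exact ((hG.continuous_fderiv_apply v).mul hF.continuous).integrable_of_hasCompactSupport
      hF.2.mul_left
  · exact (hG.continuous.mul (hF.continuous_fderiv_apply v)).integrable_of_hasCompactSupport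
      hG.2.mul_right
  · exact (hG.continuous.mul hF.continuous).integrable_of_hasCompactSupport hF.2.mul_left

theorem translate (hF : TestFun F) (w : Plane) : TestFun (fun x => F (x + w)) :=
  ⟨hF.1.comp (contDiff_id.add contDiff_const),
    hF.2.comp_homeomorph (Homeomorph.addRight w)⟩

theorem fderiv_translate (w x : Plane) : fderiv ℝ (fun x => F (x + w)) x = fderiv ℝ F (x + w) :=
  fderiv_comp_add_right w

theorem integral_cross (hF : TestFun F) (hG : TestFun G) (v w : Plane) :
    ∫ x, fderiv ℝ G x w * fderiv ℝ F x v = ∫ x, fderiv ℝ G x v * fderiv ℝ F x w := by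
  obtain ⟨D₁, hD₁⟩ := ContDiff.lipschitzWith_of_hasCompactSupport hF.2 hF.1 one_ne_zero
  obtain ⟨D₂, hD₂⟩ := ContDiff.lipschitzWith_of_hasCompactSupport hG.2 hG.1 one_ne_zero
  have iF := (hF.continuous_fderiv_apply v).integrable_of_hasCompactSupport
    (μ := volume) (hF.compact_fderiv_apply v)
  have iG := (hG.continuous_fderiv_apply v).integrable_of_hasCompactSupport
    (μ := volume) (hG.compact_fderiv_apply v)
  have h1 := hD₂.integral_inv_smul_sub_mul_tendsto_integral_lineDeriv_mul iF w
  have h2 := (hD₁.integral_inv_smul_sub_mul_tendsto_integral_lineDeriv_mul iG (-w)).neg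
  have h3 : ∀ t : ℝ, ∫ x, (t⁻¹ • (G (x + t • w) - G x)) * fderiv ℝ F x v =
      -∫ x, (t⁻¹ • (F (x + t • -w) - F x)) * fderiv ℝ G x v := by
    intro t
    have hT : TestFun (fun x => t⁻¹ * (G (x + t • w) - G x)) := by
      refine ⟨contDiff_const.mul ((hG.translate _).1.sub hG.1), ?_⟩
      have : HasCompactSupport (fun x => G (x + t • w) - G x) := by
        simp only [sub_eq_add_neg]
        exact (hG.translate (t • w)).2.add (hG.2.comp_left neg_zero)
      exact this.mul_left
    have h4 := hF.integral_fderiv_mul hT v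
    simp only [smul_eq_mul]
    rw [h4]
    congr 1
    have h5 : ∀ x, fderiv ℝ (fun x => t⁻¹ * (G (x + t • w) - G x)) x v * F x =
        t⁻¹ * (fderiv ℝ G (x + t • w) v * F x) - t⁻¹ * (fderiv ℝ G x v * F x) := by
      intro x
      have hd : HasFDerivAt (fun x => t⁻¹ * (G (x + t • w) - G x))
          (t⁻¹ • (fderiv ℝ G (x + t • w) - fderiv ℝ G x)) x := by
        refine HasFDerivAt.const_mul (HasFDerivAt.sub ?_ (hG.differentiable x).hasFDerivAt) _
        rw [← fderiv_translate]
        exact ((hG.translate _).differentiable x).hasFDerivAt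
      rw [hd.fderiv]
      simp
      ring
    have h6 : ∀ x, t⁻¹ * (F (x + t • -w) - F x) * fderiv ℝ G x v =
        t⁻¹ * (fderiv ℝ G x v * F (x + t • -w)) - t⁻¹ * (fderiv ℝ G x v * F x) := by
      intro x; ring
    have iA : Integrable (fun x => fderiv ℝ G x v * F x) :=
      ((hG.continuous_fderiv_apply v).mul hF.continuous).integrable_of_hasCompactSupport
        hF.2.mul_left
    have iB : Integrable (fun x => fderiv ℝ G x v * F (x + t • -w)) :=
      ((hG.continuous_fderiv_apply v).mul
        (hF.translate _).continuous).integrable_of_hasCompactSupport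
        (hF.translate _).2.mul_left
    have iC : Integrable (fun x => fderiv ℝ G (x + t • w) v * F x) :=
      (((hG.continuous_fderiv_apply v).comp (continuous_add_const (t • w))).mul
        hF.continuous).integrable_of_hasCompactSupport hF.2.mul_left
    simp_rw [h5, h6]
    rw [integral_sub (iC.const_mul _) (iA.const_mul _),
      integral_sub (iB.const_mul _) (iA.const_mul _)]
    congr 1
    rw [integral_const_mul, integral_const_mul]
    congr 1
    rw [← integral_add_right_eq_self (fun x => fderiv ℝ G x v * F (x + t • -w)) (t • w)]
    simp
  have h7 := tendsto_nhds_unique (h1.congr h3) h2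
  simp_rw [(hG.differentiable _).lineDeriv_eq_fderiv, (hF.differentiable _).lineDeriv_eq_fderiv]
    at h7
  rw [h7, ← integral_neg]
  congr 1
  ext x
  simp
  ring

end TestFun

/-- A sequence of cutoff functions exhausting `Ω`, whose gradients are controlled by `1 / d`. -/
structure Exhaustion (Ω : Set Plane) (d : Plane → ℝ) (c : ℕ → Plane → ℝ) (C : ℝ) : Prop where
  test : ∀ n, TestFun (c n)
  supp : ∀ n, tsupport (c n) ⊆ Ω
  nonneg : ∀ n x, 0 ≤ c n x
  le_one : ∀ n x, c n x ≤ 1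
  eventually_one : ∀ x ∈ Ω, ∀ᶠ n in atTop, c n =ᶠ[𝓝 x] fun _ => 1
  grad : ∀ n, ∀ x ∈ Ω, d x * |dx (c n) x| ≤ C ∧ d x * |dy (c n) x| ≤ C

/-- Continuously differentiable functions on `Ω`, with bounded gradient, bounded by a multiple
of `d`. -/
structure Vanishing (Ω : Set Plane) (d : Plane → ℝ) (C : ℝ) (F : Plane → ℝ) : Prop where
  smooth : ContDiffOn ℝ 1 F Ω
  le_dist : ∀ x ∈ Ω, |F x| ≤ C * d x
  bdd : ∀ x ∈ Ω, |F x| ≤ C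
  grad : ∀ x ∈ Ω, |dx F x| ≤ C ∧ |dy F x| ≤ C

theorem TestFun.mul_on {Ω : Set Plane} (hΩ : IsOpen Ω) {c F : Plane → ℝ} (hc : TestFun c)
    (hs : tsupport c ⊆ Ω) (hF : ContDiffOn ℝ 1 F Ω) : TestFun (fun x => c x * F x) := by
  refine ⟨contDiff_iff_contDiffAt.2 fun x => ?_, hc.2.mul_right⟩
  by_cases hx : x ∈ tsupport c
  · exact hc.1.contDiffAt.mul (hF.contDiffAt (hΩ.mem_nhds (hs hx)))
  · refine (contDiffAt_const (c := (0 : ℝ))).congr_of_eventuallyEq ?_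
    filter_upwards [notMem_tsupport_iff_eventuallyEq.1 hx] with y hy
    simp [hy]

theorem Vanishing.continuousOn_fderiv_apply {Ω : Set Plane} (hΩ : IsOpen Ω) {d F : Plane → ℝ}
    {C : ℝ} (hF : Vanishing Ω d C F) (v : Plane) : ContinuousOn (fun x => fderiv ℝ F x v) Ω :=
  (hF.smooth.continuousOn_fderiv_of_isOpen hΩ le_rfl).clm_apply continuousOn_const

theorem Vanishing.integrableOn {Ω : Set Plane} (hΩ : IsOpen Ω) (hfin : volume Ω ≠ ⊤)
    {d : Plane → ℝ} {C' K : ℝ}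
    {F α β₁ β₂ : Plane → ℝ} (hF : Vanishing Ω d C' F)
    (hα : Continuous α) (hβ₁ : Continuous β₁) (hβ₂ : Continuous β₂)
    (bα : ∀ x ∈ Ω, |α x| ≤ K) (bβ₁ : ∀ x ∈ Ω, |β₁ x| ≤ K) (bβ₂ : ∀ x ∈ Ω, |β₂ x| ≤ K) :
    IntegrableOn (fun x => F x * α x + dx F x * β₁ x + dy F x * β₂ x) Ω := by
  refine Integrable.mono' (g := fun _ => C' * K + C' * K + C' * K) (integrableOn_const hfin) ?_ ?_
  · have h1 := hF.smooth.continuousOn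
    have h2 := hF.continuousOn_fderiv_apply hΩ ((1 : ℝ), (0 : ℝ))
    have h3 := hF.continuousOn_fderiv_apply hΩ ((0 : ℝ), (1 : ℝ))
    exact (((h1.mul hα.continuousOn).add (h2.mul hβ₁.continuousOn)).add
      (h3.mul hβ₂.continuousOn)).aestronglyMeasurable hΩ.measurableSet
  · filter_upwards [ae_restrict_mem hΩ.measurableSet] with x hx
    have key : ∀ a b : ℝ, |a| ≤ C' → |b| ≤ K → |a * b| ≤ C' * K := fun a b ha hb => by
      rw [abs_mul]
      exact mul_le_mul ha hb (abs_nonneg _) ((abs_nonneg _).trans ha)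
    have e1 := key _ _ (hF.bdd x hx) (bα x hx)
    have e2 := key _ _ (hF.grad x hx).1 (bβ₁ x hx)
    have e3 := key _ _ (hF.grad x hx).2 (bβ₂ x hx)
    exact (abs_add_le _ _).trans (add_le_add ((abs_add_le _ _).trans (add_le_add e1 e2)) e3)

theorem integral_eq_zero_of_weak {Ω : Set Plane} (hΩ : IsOpen Ω) (hfin : volume Ω ≠ ⊤)
    {d : Plane → ℝ} {c : ℕ → Plane → ℝ} {C C' K : ℝ} (hc : Exhaustion Ω d c C)
    {F α β₁ β₂ : Plane → ℝ} (hF : Vanishing Ω d C' F)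
    (hα : Continuous α) (hβ₁ : Continuous β₁) (hβ₂ : Continuous β₂)
    (bα : ∀ x ∈ Ω, |α x| ≤ K) (bβ₁ : ∀ x ∈ Ω, |β₁ x| ≤ K) (bβ₂ : ∀ x ∈ Ω, |β₂ x| ≤ K)
    (weak : ∀ G, TestFun G → ∫ x, (G x * α x + dx G x * β₁ x + dy G x * β₂ x) = 0) :
    ∫ x in Ω, (F x * α x + dx F x * β₁ x + dy F x * β₂ x) = 0 := by
  rcases Ω.eq_empty_or_nonempty with rfl | ⟨x₀, hx₀⟩
  · simp
  have hC' : 0 ≤ C' := (abs_nonneg _).trans (hF.bdd x₀ hx₀)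
  have hK : 0 ≤ K := (abs_nonneg _).trans (bα x₀ hx₀)
  have hG : ∀ n, TestFun (fun x => c n x * F x) := fun n =>
    (hc.test n).mul_on hΩ (hc.supp n) hF.smooth
  have hder : ∀ n, ∀ x ∈ Ω, ∀ v, fderiv ℝ (fun x => c n x * F x) x v =
      c n x * fderiv ℝ F x v + F x * fderiv ℝ (c n) x v := by
    intro n x hx v
    have h1 : HasFDerivAt F (fderiv ℝ F x) x :=
      ((hF.smooth.contDiffAt (hΩ.mem_nhds hx)).differentiableAt one_ne_zero).hasFDerivAt
    have h2 : HasFDerivAt (fun x => c n x * F x) _ x :=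
      ((hc.test n).differentiable x).hasFDerivAt.mul h1
    rw [h2.fderiv]
    simp
  have hz : ∀ n, ∫ x in Ω, ((c n x * F x) * α x + dx (fun x => c n x * F x) x * β₁ x +
      dy (fun x => c n x * F x) x * β₂ x) = 0 := by
    intro n
    rw [← weak _ (hG n)]
    refine setIntegral_eq_integral_of_forall_compl_eq_zero fun x hx => ?_
    have h1 : x ∉ tsupport (c n) := fun h => hx (hc.supp n h)
    have h2 : (fun x => c n x * F x) =ᶠ[𝓝 x] fun _ => 0 := by
      filter_upwards [notMem_tsupport_iff_eventuallyEq.1 h1] with y hy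
      simp [hy]
    have h3 : fderiv ℝ (fun x => c n x * F x) x = 0 := by rw [h2.fderiv_eq]; simp
    have h4 := h2.eq_of_nhds
    simp [dx, dy, h3, h4]
  have hlim : Tendsto (fun n => ∫ x in Ω, ((c n x * F x) * α x +
      dx (fun x => c n x * F x) x * β₁ x + dy (fun x => c n x * F x) x * β₂ x)) atTop
      (𝓝 (∫ x in Ω, (F x * α x + dx F x * β₁ x + dy F x * β₂ x))) := by
    refine tendsto_integral_of_dominated_convergence
      (fun _ => C' * K + (C' + C' * C) * K + (C' + C' * C) * K) ?_ ?_ ?_ ?_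
    · intro n
      have h1 := (hG n).continuous
      have h2 := (hG n).continuous_fderiv_apply ((1 : ℝ), (0 : ℝ))
      have h3 := (hG n).continuous_fderiv_apply ((0 : ℝ), (1 : ℝ))
      exact (((h1.mul hα).add (h2.mul hβ₁)).add (h3.mul hβ₂)).aestronglyMeasurable
    · exact integrableOn_const hfin
    · intro n
      filter_upwards [ae_restrict_mem hΩ.measurableSet] with x hx
      have hb : ∀ a b : ℝ, |a| ≤ C' → d x * |b| ≤ C → |c n x * a + F x * b| ≤ C' + C' * C := by
        intro a b ha hb
        have h1 := hc.nonneg n x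
        have h2 := hc.le_one n x
        have h3 : |c n x * a| ≤ C' := by
          rw [abs_mul, abs_of_nonneg h1]
          nlinarith [abs_nonneg a]
        have h4 : |F x * b| ≤ C' * C := by
          rw [abs_mul]
          calc |F x| * |b| ≤ C' * d x * |b| :=
                mul_le_mul_of_nonneg_right (hF.le_dist x hx) (abs_nonneg b)
            _ = C' * (d x * |b|) := by ring
            _ ≤ C' * C := by gcongr
        exact (abs_add_le _ _).trans (add_le_add h3 h4)
      have e1 : |c n x * F x * α x| ≤ C' * K := by
        have h1 := hc.nonneg n x
        have h2 := hc.le_one n x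
        have h3 : |c n x * F x| ≤ C' := by
          rw [abs_mul, abs_of_nonneg h1]
          nlinarith [abs_nonneg (F x), hF.bdd x hx]
        rw [abs_mul]
        exact mul_le_mul h3 (bα x hx) (abs_nonneg _) hC'
      have e2 : |dx (fun x => c n x * F x) x * β₁ x| ≤ (C' + C' * C) * K := by
        have := hb _ _ (hF.grad x hx).1 (hc.grad n x hx).1
        rw [abs_mul, dx, hder n x hx]
        exact mul_le_mul this (bβ₁ x hx) (abs_nonneg _) ((abs_nonneg _).trans this)
      have e3 : |dy (fun x => c n x * F x) x * β₂ x| ≤ (C' + C' * C) * K := by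
        have := hb _ _ (hF.grad x hx).2 (hc.grad n x hx).2
        rw [abs_mul, dy, hder n x hx]
        exact mul_le_mul this (bβ₂ x hx) (abs_nonneg _) ((abs_nonneg _).trans this)
      exact (abs_add_le _ _).trans (add_le_add ((abs_add_le _ _).trans (add_le_add e1 e2)) e3)
    · filter_upwards [ae_restrict_mem hΩ.measurableSet] with x hx
      refine tendsto_const_nhds.congr' ?_
      filter_upwards [hc.eventually_one x hx] with n hn
      have h1 : (fun x => c n x * F x) =ᶠ[𝓝 x] F := by
        filter_upwards [hn] with y hy
        simp [hy]
      have h4 := hn.eq_of_nhds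
      rw [dx, dy, dx, dy, h1.fderiv_eq, h4, one_mul]
  simp_rw [hz] at hlim
  exact (tendsto_nhds_unique hlim tendsto_const_nhds)

section

/-- Real part of the first component of `(-i∇ - A)(a + ib)`. -/
def re1 (a b A₁ : Plane → ℝ) (x : Plane) : ℝ := dx b x - A₁ x * a x

/-- Imaginary part of the first component of `(-i∇ - A)(a + ib)`. -/
def im1 (a b A₁ : Plane → ℝ) (x : Plane) : ℝ := -dx a x - A₁ x * b x

/-- Real part of the second component of `(-i∇ - A)(a + ib)`. -/
def re2 (a b A₂ : Plane → ℝ) (x : Plane) : ℝ := dy b x - A₂ x * a x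

/-- Imaginary part of the second component of `(-i∇ - A)(a + ib)`. -/
def im2 (a b A₂ : Plane → ℝ) (x : Plane) : ℝ := -dy a x - A₂ x * b x

/-- The curl of the supercurrent of `a + ib`, up to sign. -/
def curlCurrent (a b A₁ A₂ : Plane → ℝ) (x : Plane) : ℝ :=
  -2 * (re1 a b A₁ x * im2 a b A₂ x - im1 a b A₁ x * re2 a b A₂ x) +
    (dx A₂ x - dy A₁ x) * (a x ^ 2 + b x ^ 2)

/-- First component of the supercurrent of `a + ib`. -/
def cur1 (a b A₁ : Plane → ℝ) (x : Plane) : ℝ := a x * re1 a b A₁ x + b x * im1 a b A₁ x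

/-- Second component of the supercurrent of `a + ib`. -/
def cur2 (a b A₂ : Plane → ℝ) (x : Plane) : ℝ := a x * re2 a b A₂ x + b x * im2 a b A₂ x

variable {a b A₁ A₂ : Plane → ℝ}

theorem TestFun.continuous_dx {F : Plane → ℝ} (hF : TestFun F) : Continuous (dx F) :=
  hF.continuous_fderiv_apply _

theorem TestFun.continuous_dy {F : Plane → ℝ} (hF : TestFun F) : Continuous (dy F) :=
  hF.continuous_fderiv_apply _

theorem TestFun.integrable_mul_fderiv {F G : Plane → ℝ} (hF : TestFun F) (hG : TestFun G)
    (v w : Plane) : Integrable (fun x => fderiv ℝ F x v * fderiv ℝ G x w) :=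
  ((hF.continuous_fderiv_apply v).mul
    (hG.continuous_fderiv_apply w)).integrable_of_hasCompactSupport
    (hF.compact_fderiv_apply v).mul_right

theorem fderiv_mul_apply {F G : Plane → ℝ} (hF : Differentiable ℝ F) (hG : Differentiable ℝ G)
    (x v : Plane) : fderiv ℝ (fun x => F x * G x) x v =
      F x * fderiv ℝ G x v + fderiv ℝ F x v * G x := by
  have h : HasFDerivAt (fun x => F x * G x) _ x := (hF x).hasFDerivAt.mul (hG x).hasFDerivAt
  rw [h.fderiv]
  simp [mul_comm]

theorem fderiv_normSq_apply (ha : Differentiable ℝ a) (hb : Differentiable ℝ b)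
    (x v : Plane) : fderiv ℝ (fun x => a x ^ 2 + b x ^ 2) x v =
      2 * (a x * fderiv ℝ a x v + b x * fderiv ℝ b x v) := by
  have h : HasFDerivAt (fun x => a x ^ 2 + b x ^ 2) _ x :=
    ((ha x).hasFDerivAt.pow 2).add ((hb x).hasFDerivAt.pow 2)
  rw [h.fderiv]
  simp
  ring

theorem weak_curlCurrent (ha : TestFun a) (hb : TestFun b) (hA₁ : ContDiff ℝ 1 A₁)
    (hA₂ : ContDiff ℝ 1 A₂) {G : Plane → ℝ} (hG : TestFun G) :
    ∫ x, (G x * curlCurrent a b A₁ A₂ x + dx G x * -cur2 a b A₂ x + dy G x * cur1 a b A₁ x)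
      = 0 := by
  have hρ : ContDiff ℝ 1 (fun x => a x ^ 2 + b x ^ 2) := (ha.1.pow 2).add (hb.1.pow 2)
  have hGa := hG.mul ha.1
  have hGb := hG.mul hb.1
  have h1 := hGa.integral_cross hb (1, 0) (0, 1)
  have h2 := hGb.integral_cross ha (1, 0) (0, 1)
  have hP := hG.mul (hA₂.mul hρ)
  have hQ := hG.mul (hA₁.mul hρ)
  have h3 := hP.integral_fderiv_eq_zero (1, 0)
  have h4 := hQ.integral_fderiv_eq_zero (0, 1)
  have i1 := hb.integrable_mul_fderiv hGa (0, 1) (1, 0)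
  have i2 := hb.integrable_mul_fderiv hGa (1, 0) (0, 1)
  have i3 := ha.integrable_mul_fderiv hGb (0, 1) (1, 0)
  have i4 := ha.integrable_mul_fderiv hGb (1, 0) (0, 1)
  have i5 := (hP.continuous_fderiv_apply (1, 0)).integrable_of_hasCompactSupport (μ := volume)
    (hP.compact_fderiv_apply _)
  have i6 := (hQ.continuous_fderiv_apply (0, 1)).integrable_of_hasCompactSupport (μ := volume)
    (hQ.compact_fderiv_apply _)
  have key : ∀ x, G x * curlCurrent a b A₁ A₂ x + dx G x * -cur2 a b A₂ x +
      dy G x * cur1 a b A₁ x =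
      (((fderiv ℝ b x (1, 0) * fderiv ℝ (fun x => G x * a x) x (0, 1) -
        fderiv ℝ b x (0, 1) * fderiv ℝ (fun x => G x * a x) x (1, 0)) +
      (fderiv ℝ a x (0, 1) * fderiv ℝ (fun x => G x * b x) x (1, 0) -
        fderiv ℝ a x (1, 0) * fderiv ℝ (fun x => G x * b x) x (0, 1))) +
      (fderiv ℝ (fun x => G x * (A₂ x * (a x ^ 2 + b x ^ 2))) x (1, 0) -
       fderiv ℝ (fun x => G x * (A₁ x * (a x ^ 2 + b x ^ 2))) x (0, 1))) := by
    intro x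
    have dA₁ := hA₁.differentiable one_ne_zero
    have dA₂ := hA₂.differentiable one_ne_zero
    have dρ := hρ.differentiable one_ne_zero
    have d1 : Differentiable ℝ (fun x => A₁ x * (a x ^ 2 + b x ^ 2)) := dA₁.mul dρ
    have d2 : Differentiable ℝ (fun x => A₂ x * (a x ^ 2 + b x ^ 2)) := dA₂.mul dρ
    rw [fderiv_mul_apply hG.differentiable ha.differentiable,
      fderiv_mul_apply hG.differentiable ha.differentiable,
      fderiv_mul_apply hG.differentiable hb.differentiable,
      fderiv_mul_apply hG.differentiable hb.differentiable,
      fderiv_mul_apply hG.differentiable d1,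
      fderiv_mul_apply hG.differentiable d2,
      fderiv_mul_apply dA₁ dρ, fderiv_mul_apply dA₂ dρ,
      fderiv_normSq_apply ha.differentiable hb.differentiable,
      fderiv_normSq_apply ha.differentiable hb.differentiable]
    simp only [curlCurrent, cur1, cur2, re1, re2, im1, im2, dx, dy]
    ring
  simp_rw [key]
  refine (integral_add ((i2.sub i1).add (i3.sub i4)) (i5.sub i6)).trans ?_
  have s1 := (integral_add (i2.sub i1) (i3.sub i4)).trans
    (congrArg₂ (· + ·) (integral_sub i2 i1) (integral_sub i3 i4))
  have s2 := integral_sub i5 i6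
  refine (congrArg₂ (· + ·) s1 s2).trans ?_
  rw [h3, h4, h1, h2]
  simp

theorem weak_divergence {ρ : Plane → ℝ} (hρ : ContDiff ℝ 1 ρ) {G : Plane → ℝ} (hG : TestFun G)
    (v : Plane) :
    ∫ x, (G x * fderiv ℝ ρ x v + fderiv ℝ G x v * ρ x) = 0 := by
  rw [← (hG.mul hρ).integral_fderiv_eq_zero v]
  congr 1
  ext x
  rw [fderiv_mul_apply hG.differentiable (hρ.differentiable one_ne_zero)]

/-- The divergence of `X |u|² - f J^⊥`, where `u = a + ib` and `J` is the supercurrent. -/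
def fieldDiv (f X₁ X₂ a b A₁ A₂ : Plane → ℝ) (x : Plane) : ℝ :=
  f x * curlCurrent a b A₁ A₂ x - dx f x * cur2 a b A₂ x + dy f x * cur1 a b A₁ x +
    (X₁ x * dx (fun x => a x ^ 2 + b x ^ 2) x + dx X₁ x * (a x ^ 2 + b x ^ 2)) +
    (X₂ x * dy (fun x => a x ^ 2 + b x ^ 2) x + dy X₂ x * (a x ^ 2 + b x ^ 2))

theorem exists_bound_of_bounded {Ω : Set Plane} (hΩ : Bornology.IsBounded Ω) {F : Plane → ℝ}
    (hF : Continuous F) : ∃ K, 0 ≤ K ∧ ∀ x ∈ Ω, |F x| ≤ K := by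
  obtain ⟨K, hK⟩ := hΩ.isCompact_closure.exists_bound_of_continuousOn hF.continuousOn
  exact ⟨max K 0, le_max_right _ _, fun x hx => (hK x (subset_closure hx)).trans (le_max_left _ _)⟩

theorem integral_fieldDiv {Ω : Set Plane} (hΩ : IsOpen Ω) (hbd : Bornology.IsBounded Ω)
    {d : Plane → ℝ} {c : ℕ → Plane → ℝ} {C C' : ℝ} (hc : Exhaustion Ω d c C)
    {f X₁ X₂ : Plane → ℝ} (hf : Vanishing Ω d C' f) (hX₁ : Vanishing Ω d C' X₁)
    (hX₂ : Vanishing Ω d C' X₂)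
    (ha : TestFun a) (hb : TestFun b) (hA₁ : ContDiff ℝ 1 A₁) (hA₂ : ContDiff ℝ 1 A₂) :
    IntegrableOn (fieldDiv f X₁ X₂ a b A₁ A₂) Ω ∧
      ∫ x in Ω, fieldDiv f X₁ X₂ a b A₁ A₂ x = 0 := by
  have hfin : volume Ω ≠ ⊤ := hbd.measure_lt_top.ne
  have hρ : ContDiff ℝ 1 (fun x => a x ^ 2 + b x ^ 2) := (ha.1.pow 2).add (hb.1.pow 2)
  have cρ := hρ.continuous
  have cdρ : ∀ v, Continuous (fun y => fderiv ℝ (fun x => a x ^ 2 + b x ^ 2) y v) := fun v =>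
    (hρ.continuous_fderiv one_ne_zero).clm_apply continuous_const
  have cdA₁ : ∀ v, Continuous (fun y => fderiv ℝ A₁ y v) := fun v =>
    (hA₁.continuous_fderiv one_ne_zero).clm_apply continuous_const
  have cdA₂ : ∀ v, Continuous (fun y => fderiv ℝ A₂ y v) := fun v =>
    (hA₂.continuous_fderiv one_ne_zero).clm_apply continuous_const
  have ca := ha.continuous
  have cb := hb.continuous
  have cA₁ := hA₁.continuous
  have cA₂ := hA₂.continuous
  have c1 : Continuous (re1 a b A₁) := hb.continuous_dx.sub (cA₁.mul ca)
  have c2 : Continuous (im1 a b A₁) := ha.continuous_dx.neg.sub (cA₁.mul cb)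
  have c3 : Continuous (re2 a b A₂) := hb.continuous_dy.sub (cA₂.mul ca)
  have c4 : Continuous (im2 a b A₂) := ha.continuous_dy.neg.sub (cA₂.mul cb)
  have cJ1 : Continuous (cur1 a b A₁) := (ca.mul c1).add (cb.mul c2)
  have cJ2 : Continuous (cur2 a b A₂) := (ca.mul c3).add (cb.mul c4)
  have cK : Continuous (curlCurrent a b A₁ A₂) :=
    (continuous_const.mul ((c1.mul c4).sub (c2.mul c3))).add (((cdA₂ _).sub (cdA₁ _)).mul cρ)
  have gen : ∀ {F α β₁ β₂ : Plane → ℝ}, Vanishing Ω d C' F → Continuous α → Continuous β₁ →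
      Continuous β₂ →
      (∀ G, TestFun G → ∫ x, (G x * α x + dx G x * β₁ x + dy G x * β₂ x) = 0) →
      IntegrableOn (fun x => F x * α x + dx F x * β₁ x + dy F x * β₂ x) Ω ∧
      ∫ x in Ω, (F x * α x + dx F x * β₁ x + dy F x * β₂ x) = 0 := by
    intro F α β₁ β₂ hF hα hβ₁ hβ₂ hw
    obtain ⟨K₁, h10, h1⟩ := exists_bound_of_bounded hbd hα
    obtain ⟨K₂, h20, h2⟩ := exists_bound_of_bounded hbd hβ₁
    obtain ⟨K₃, h30, h3⟩ := exists_bound_of_bounded hbd hβ₂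
    have e1 : ∀ x ∈ Ω, |α x| ≤ K₁ + K₂ + K₃ := fun x hx => (h1 x hx).trans (by linarith)
    have e2 : ∀ x ∈ Ω, |β₁ x| ≤ K₁ + K₂ + K₃ := fun x hx => (h2 x hx).trans (by linarith)
    have e3 : ∀ x ∈ Ω, |β₂ x| ≤ K₁ + K₂ + K₃ := fun x hx => (h3 x hx).trans (by linarith)
    exact ⟨hF.integrableOn hΩ hfin hα hβ₁ hβ₂ e1 e2 e3,
      integral_eq_zero_of_weak hΩ hfin hc hF hα hβ₁ hβ₂ e1 e2 e3 hw⟩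
  obtain ⟨i1, z1⟩ := gen hf cK cJ2.neg cJ1 (fun G hG => weak_curlCurrent ha hb hA₁ hA₂ hG)
  obtain ⟨i2, z2⟩ := gen hX₁ (cdρ (1, 0)) cρ (continuous_const (y := (0 : ℝ))) (fun G hG => by
    simpa [dx] using weak_divergence hρ hG (1, 0))
  obtain ⟨i3, z3⟩ := gen hX₂ (cdρ (0, 1)) (continuous_const (y := (0 : ℝ))) cρ (fun G hG => by
    simpa [dy] using weak_divergence hρ hG (0, 1))
  have key : fieldDiv f X₁ X₂ a b A₁ A₂ = fun x =>
      ((f x * curlCurrent a b A₁ A₂ x + dx f x * -cur2 a b A₂ x + dy f x * cur1 a b A₁ x) +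
      (X₁ x * fderiv ℝ (fun x => a x ^ 2 + b x ^ 2) x (1, 0) + dx X₁ x * (a x ^ 2 + b x ^ 2) +
        dy X₁ x * 0)) +
      (X₂ x * fderiv ℝ (fun x => a x ^ 2 + b x ^ 2) x (0, 1) + dx X₂ x * 0 +
        dy X₂ x * (a x ^ 2 + b x ^ 2)) := by
    ext x
    simp only [fieldDiv, dx, dy]
    ring
  rw [key]
  refine ⟨(i1.add i2).add i3, ?_⟩
  refine (integral_add (i1.add i2) i3).trans ?_
  refine (congrArg₂ (· + ·) ((integral_add i1 i2).trans (congrArg₂ (· + ·) z1 z2)) z3).trans ?_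
  simp

end

/-- The linear form `v ↦ ⟨n, v⟩`. -/
def dotL (n : Plane) : Plane →L[ℝ] ℝ :=
  n.1 • ContinuousLinearMap.fst ℝ ℝ ℝ + n.2 • ContinuousLinearMap.snd ℝ ℝ ℝ

@[simp] theorem dotL_apply (n v : Plane) : dotL n v = n.1 * v.1 + n.2 * v.2 := by
  simp [dotL]

/-- A function `t` on `Ω` behaving like the distance to the boundary where `t < δ`, with unit
gradient `N` and Laplacian bounded below in terms of an upper bound `K` of the curvature. -/
structure Collar (Ω : Set Plane) (K δ D : ℝ) (t : Plane → ℝ) (N : Plane → Plane) : Prop where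
  isOpen : IsOpen Ω
  δ_pos : 0 < δ
  K_le : |K| * δ ≤ 1 / 2
  pos : ∀ x ∈ Ω, 0 < t x
  cont : ContinuousOn t Ω
  compact : ∀ ε > 0, IsCompact {x | x ∈ Ω ∧ ε ≤ t x}
  grad : ∀ x ∈ Ω, t x < δ → HasFDerivAt t (dotL (N x)) x
  unit : ∀ x ∈ Ω, t x < δ → (N x).1 ^ 2 + (N x).2 ^ 2 = 1
  smooth : ∀ x ∈ Ω, t x < δ → ContDiffAt ℝ 1 N x
  grad_le : ∀ x ∈ Ω, t x < δ → ∀ v ∈ ({(1, 0), (0, 1)} : Set Plane),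
    |fderiv ℝ (fun y => (N y).1) x v| ≤ D ∧ |fderiv ℝ (fun y => (N y).2) x v| ≤ D
  laplacian : ∀ x ∈ Ω, t x < δ →
    -K / (1 - K * t x) ≤ dx (fun y => (N y).1) x + dy (fun y => (N y).2) x

namespace Collar

variable {Ω : Set Plane} {K δ D : ℝ} {t : Plane → ℝ} {N : Plane → Plane}

theorem isOpen_lt (hc : Collar Ω K δ D t N) : IsOpen {x | x ∈ Ω ∧ t x < δ} :=
  hc.cont.isOpen_inter_preimage hc.isOpen isOpen_Iio

theorem isOpen_gt (hc : Collar Ω K δ D t N) (ε : ℝ) : IsOpen {x | x ∈ Ω ∧ ε < t x} :=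
  hc.cont.isOpen_inter_preimage hc.isOpen isOpen_Ioi

theorem contDiffAt (hc : Collar Ω K δ D t N) {x : Plane} (hx : x ∈ Ω) (hxδ : t x < δ) :
    ContDiffAt ℝ 1 t x := by
  rw [contDiffAt_one_iff]
  refine ⟨fun y => dotL (N y), _, hc.isOpen_lt.mem_nhds ⟨hx, hxδ⟩, ?_,
    fun y hy => hc.grad y hy.1 hy.2⟩
  intro y hy
  have h := (hc.smooth y hy.1 hy.2).continuousAt
  have h1 : ContinuousAt (fun y => (N y).1) y := h.fst
  have h2 : ContinuousAt (fun y => (N y).2) y := h.snd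
  exact ((h1.smul continuousAt_const).add (h2.smul continuousAt_const)).continuousWithinAt

theorem hasFDerivAt_comp_mul (hc : Collar Ω K δ D t N) {β β' : ℝ → ℝ} {m F : Plane → ℝ}
    (hβ : ∀ s, 0 < s → HasDerivAt β (β' s) s)
    (hm : ∀ x ∈ Ω, t x < δ → ContDiffAt ℝ 1 m x)
    (hF : ∀ x ∈ Ω, t x < δ → F x = β (t x) * m x) {x : Plane} (hx : x ∈ Ω) (hxδ : t x < δ)
    (v : Plane) : fderiv ℝ F x v =
      β' (t x) * ((N x).1 * v.1 + (N x).2 * v.2) * m x + β (t x) * fderiv ℝ m x v := by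
  have h1 : F =ᶠ[𝓝 x] fun y => β (t y) * m y := by
    filter_upwards [hc.isOpen_lt.mem_nhds ⟨hx, hxδ⟩] with y hy using hF y hy.1 hy.2
  have h2 : HasFDerivAt (fun y => β (t y)) (β' (t x) • dotL (N x)) x :=
    (hβ _ (hc.pos x hx)).comp_hasFDerivAt x (hc.grad x hx hxδ)
  have h3 : HasFDerivAt (fun y => β (t y) * m y) _ x :=
    h2.mul ((hm x hx hxδ).differentiableAt one_ne_zero).hasFDerivAt
  rw [h1.fderiv_eq, h3.fderiv]
  simp
  ring

theorem contDiffAt_comp (hc : Collar Ω K δ D t N) {β β' : ℝ → ℝ}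
    (hβ : ∀ s, 0 < s → HasDerivAt β (β' s) s) (hβ' : ContinuousOn β' (Ioi 0)) {x : Plane}
    (hx : x ∈ Ω) (hxδ : t x < δ) : ContDiffAt ℝ 1 (fun y => β (t y)) x := by
  have h : ContDiffAt ℝ 1 β (t x) := by
    rw [contDiffAt_one_iff]
    refine ⟨fun s => ContinuousLinearMap.toSpanSingleton ℝ (β' s), _,
      isOpen_Ioi.mem_nhds (hc.pos x hx), ?_, fun y hy => (hβ y hy).hasFDerivAt⟩
    exact (ContinuousLinearMap.toSpanSingletonCLE (𝕜 := ℝ) (E := ℝ)).continuous.comp_continuousOn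
      hβ'
  exact h.comp x (hc.contDiffAt hx hxδ)

theorem vanishing (hc : Collar Ω K δ D t N) {β β' : ℝ → ℝ} {m F : Plane → ℝ} {c M : ℝ}
    (hβ : ∀ s, 0 < s → HasDerivAt β (β' s) s) (hβ' : ContinuousOn β' (Ioi 0))
    (bβ : ∀ s, 0 < s → s < δ → |β s| ≤ M * s) (bβ' : ∀ s, 0 < s → s < δ → |β' s| ≤ M)
    (hm : ∀ x ∈ Ω, t x < δ → ContDiffAt ℝ 1 m x)
    (bm : ∀ x ∈ Ω, t x < δ → |m x| ≤ 1)
    (bm' : ∀ x ∈ Ω, t x < δ → ∀ v ∈ ({(1, 0), (0, 1)} : Set Plane), |fderiv ℝ m x v| ≤ D)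
    (hF : ∀ x ∈ Ω, t x < δ → F x = β (t x) * m x) (hF' : ∀ x ∈ Ω, δ / 2 < t x → F x = c) :
    ∃ C, Vanishing Ω t C F := by
  have hδ := hc.δ_pos
  have hM : 0 ≤ M := by
    have := (abs_nonneg _).trans (bβ' (δ / 2) (by positivity) (by linarith))
    exact this
  have out : ∀ x ∈ Ω, ¬ t x < δ → F =ᶠ[𝓝 x] fun _ => c := fun x hx hxδ => by
    filter_upwards [(hc.isOpen_gt (δ / 2)).mem_nhds ⟨hx, by linarith⟩] with y hy
      using hF' y hy.1 hy.2
  refine ⟨M + M * δ * |D| + M * δ + 2 * |c| / δ + |c|, ?_, ?_, ?_, ?_⟩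
  · intro x hx
    refine ContDiffAt.contDiffWithinAt ?_
    by_cases hxδ : t x < δ
    · refine ((hc.contDiffAt_comp hβ hβ' hx hxδ).mul (hm x hx hxδ)).congr_of_eventuallyEq ?_
      filter_upwards [hc.isOpen_lt.mem_nhds ⟨hx, hxδ⟩] with y hy using hF y hy.1 hy.2
    · exact contDiffAt_const.congr_of_eventuallyEq (out x hx hxδ)
  · intro x hx
    have h0 := hc.pos x hx
    have e1 : 0 ≤ (M * δ * |D| + M * δ + |c|) * t x := by positivity
    by_cases hxδ : t x < δ
    · rw [hF x hx hxδ, abs_mul]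
      have e2 : |β (t x)| * |m x| ≤ M * t x * 1 :=
        mul_le_mul (bβ _ h0 hxδ) (bm x hx hxδ) (abs_nonneg _) (by positivity)
      have e3 : 0 ≤ 2 * |c| / δ * t x := by positivity
      linarith
    · rw [(out x hx hxδ).eq_of_nhds]
      have e2 : 2 * |c| / δ * δ ≤ 2 * |c| / δ * t x := by
        have : 0 ≤ 2 * |c| / δ := by positivity
        exact mul_le_mul_of_nonneg_left (not_lt.1 hxδ) this
      have e3 : 2 * |c| / δ * δ = 2 * |c| := by field_simp
      have e4 : 0 ≤ M * t x := by positivity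
      linarith [abs_nonneg c]
  · intro x hx
    have h0 := hc.pos x hx
    have e3 : 0 ≤ M * δ * |D| + 2 * |c| / δ := by positivity
    by_cases hxδ : t x < δ
    · rw [hF x hx hxδ, abs_mul]
      have e2 : |β (t x)| * |m x| ≤ M * t x * 1 :=
        mul_le_mul (bβ _ h0 hxδ) (bm x hx hxδ) (abs_nonneg _) (by positivity)
      have e4 : M * t x ≤ M * δ := mul_le_mul_of_nonneg_left hxδ.le hM
      linarith [abs_nonneg c]
    · rw [(out x hx hxδ).eq_of_nhds]
      have : 0 ≤ M * δ := by positivity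
      linarith
  · intro x hx
    have e3 : 0 ≤ M * δ + 2 * |c| / δ + |c| := by positivity
    have h0 := hc.pos x hx
    by_cases hxδ : t x < δ
    · have key : ∀ v ∈ ({(1, 0), (0, 1)} : Set Plane), |(N x).1 * v.1 + (N x).2 * v.2| ≤ 1 →
          |fderiv ℝ F x v| ≤ M + M * δ * |D| := by
        intro v hv hn
        rw [hc.hasFDerivAt_comp_mul hβ hm hF hx hxδ]
        refine (abs_add_le _ _).trans (add_le_add ?_ ?_)
        · rw [abs_mul, abs_mul]
          have e1 : |β' (t x)| * |(N x).1 * v.1 + (N x).2 * v.2| ≤ M * 1 :=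
            mul_le_mul (bβ' _ h0 hxδ) hn (abs_nonneg _) hM
          have := mul_le_mul e1 (bm x hx hxδ) (abs_nonneg _) (by linarith)
          linarith
        · rw [abs_mul]
          have e1 : |β (t x)| ≤ M * δ :=
            (bβ _ h0 hxδ).trans (mul_le_mul_of_nonneg_left hxδ.le hM)
          exact mul_le_mul e1 ((bm' x hx hxδ v hv).trans (le_abs_self D)) (abs_nonneg _)
            (by positivity)
      have hu := hc.unit x hx hxδ
      have k1 : |(N x).1| ≤ 1 := abs_le_one_iff_mul_self_le_one.2 (by nlinarith [sq_nonneg (N x).2])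
      have k2 : |(N x).2| ≤ 1 := abs_le_one_iff_mul_self_le_one.2 (by nlinarith [sq_nonneg (N x).1])
      have r1 := key (1, 0) (by simp) (by simpa using k1)
      have r2 := key (0, 1) (by simp) (by simpa using k2)
      exact ⟨by rw [dx]; linarith, by rw [dy]; linarith⟩
    · have : 0 ≤ M + M * δ * |D| := by positivity
      rw [dx, dy, (out x hx hxδ).fderiv_eq]
      simp
      linarith

end Collar

theorem Vanishing.mono {Ω : Set Plane} {d F : Plane → ℝ} {C C' : ℝ} (hF : Vanishing Ω d C F)
    (hd : ∀ x ∈ Ω, 0 ≤ d x) (h : C ≤ C') : Vanishing Ω d C' F where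
  smooth := hF.smooth
  le_dist x hx := (hF.le_dist x hx).trans (mul_le_mul_of_nonneg_right h (hd x hx))
  bdd x hx := (hF.bdd x hx).trans h
  grad x hx := ⟨(hF.grad x hx).1.trans h, (hF.grad x hx).2.trans h⟩

theorem exists_smoothTransition_bound :
    ∃ C, ∀ s, 0 ≤ s → |s * deriv Real.smoothTransition (s - 1)| ≤ C := by
  have hcd : Continuous (deriv Real.smoothTransition) :=
    (Real.smoothTransition.contDiff (n := 1)).continuous_deriv le_rfl
  have hc : Continuous fun s : ℝ => s * deriv Real.smoothTransition (s - 1) :=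
    continuous_id.mul (hcd.comp (continuous_id.sub continuous_const))
  obtain ⟨C, hC⟩ := (isCompact_Icc (a := (0 : ℝ)) (b := 2)).exists_bound_of_continuousOn
    hc.continuousOn
  refine ⟨C, fun s hs => ?_⟩
  by_cases h2 : s ≤ 2
  · exact hC s ⟨hs, h2⟩
  · have : Real.smoothTransition =ᶠ[𝓝 (s - 1)] fun _ => 1 := by
      filter_upwards [Ioi_mem_nhds (show (1 : ℝ) < s - 1 by linarith)] with y hy
        using Real.smoothTransition.one_of_one_le (le_of_lt hy)
    rw [this.deriv_eq]
    simp
    exact (abs_nonneg _).trans (hC 0 ⟨le_rfl, by norm_num⟩)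

theorem Collar.exists_exhaustion {Ω : Set Plane} {K δ D : ℝ} {t : Plane → ℝ}
    {N : Plane → Plane} (hc : Collar Ω K δ D t N) : ∃ c C, Exhaustion Ω t c C := by
  classical
  obtain ⟨C, hC⟩ := exists_smoothTransition_bound
  have hδ := hc.δ_pos
  obtain ⟨n₀, hn₀⟩ := exists_nat_gt (2 / δ)
  have hn₀' : (0 : ℝ) < n₀ := lt_trans (by positivity) hn₀
  set k : ℕ → ℝ := fun n => n + n₀ with hk
  have kpos : ∀ n, 0 < k n := fun n => by positivity
  have kδ : ∀ n, 2 < k n * δ := fun n => by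
    have : 2 < n₀ * δ := (div_lt_iff₀ hδ).1 hn₀
    have h2 : (0 : ℝ) ≤ n * δ := by positivity
    simp only [hk]; linarith
  set c : ℕ → Plane → ℝ := fun n x =>
    if x ∈ Ω then Real.smoothTransition (k n * t x - 1) else 0 with hcdef
  have c_in : ∀ n x, x ∈ Ω → c n =ᶠ[𝓝 x] fun y => Real.smoothTransition (k n * t y - 1) := by
    intro n x hx
    filter_upwards [hc.isOpen.mem_nhds hx] with y hy
    simp [hcdef, hy]
  have c_one : ∀ n x, x ∈ Ω → 2 < k n * t x → c n =ᶠ[𝓝 x] fun _ => 1 := by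
    intro n x hx h2
    filter_upwards [(hc.isOpen_gt (2 / k n)).mem_nhds ⟨hx, (div_lt_iff₀' (kpos n)).2 h2⟩]
      with y hy
    have := (div_lt_iff₀' (kpos n)).1 hy.2
    simp only [hcdef, hy.1, if_true]
    exact Real.smoothTransition.one_of_one_le (by linarith)
  have c_supp : ∀ n x, x ∉ {x | x ∈ Ω ∧ 1 / k n ≤ t x} → c n x = 0 := by
    intro n x hx
    simp only [hcdef]
    split_ifs with h
    · have : ¬ 1 / k n ≤ t x := fun h' => hx ⟨h, h'⟩
      rw [div_le_iff₀' (kpos n)] at this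
      exact Real.smoothTransition.zero_of_nonpos (by linarith)
    · rfl
  have cpt : ∀ n, IsCompact {x | x ∈ Ω ∧ 1 / k n ≤ t x} := fun n =>
    hc.compact _ (one_div_pos.2 (kpos n))
  have c_ts : ∀ n, tsupport (c n) ⊆ {x | x ∈ Ω ∧ 1 / k n ≤ t x} := fun n =>
    closure_minimal (fun x hx => by_contra fun h => hx (c_supp n x h)) (cpt n).isClosed
  refine ⟨c, C, ?_, fun n => (c_ts n).trans fun x hx => hx.1, ?_, ?_, ?_, ?_⟩
  · refine fun n => ⟨contDiff_iff_contDiffAt.2 fun x => ?_,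
      (cpt n).of_isClosed_subset (isClosed_tsupport _) (c_ts n)⟩
    by_cases hx : x ∈ Ω
    · by_cases hxδ : t x < δ
      · refine ContDiffAt.congr_of_eventuallyEq ?_ (c_in n x hx)
        exact Real.smoothTransition.contDiff.contDiffAt.comp x
          ((contDiffAt_const.mul (hc.contDiffAt hx hxδ)).sub contDiffAt_const)
      · refine contDiffAt_const.congr_of_eventuallyEq (c_one n x hx ?_)
        have := mul_le_mul_of_nonneg_left (not_lt.1 hxδ) (kpos n).le
        linarith [kδ n]
    · refine (contDiffAt_const (c := (0 : ℝ))).congr_of_eventuallyEq ?_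
      filter_upwards [(cpt n).isClosed.isOpen_compl.mem_nhds fun h => hx h.1] with y hy
        using c_supp n y hy
  · intro n x
    simp only [hcdef]
    split_ifs
    · exact Real.smoothTransition.nonneg _
    · exact le_rfl
  · intro n x
    simp only [hcdef]
    split_ifs
    · exact Real.smoothTransition.le_one _
    · exact zero_le_one
  · intro x hx
    obtain ⟨m, hm⟩ := exists_nat_gt (2 / t x)
    filter_upwards [eventually_ge_atTop m] with n hn
    refine c_one n x hx ?_
    have h1 := (div_lt_iff₀ (hc.pos x hx)).1 hm
    have h2 : (m : ℝ) ≤ k n := by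
      have : (m : ℝ) ≤ n := by exact_mod_cast hn
      simp only [hk]; linarith
    nlinarith [hc.pos x hx]
  · intro n x hx
    have h0 := hc.pos x hx
    by_cases hxδ : t x < δ
    · have hu := hc.unit x hx hxδ
      have k1 : |(N x).1| ≤ 1 := abs_le_one_iff_mul_self_le_one.2 (by nlinarith [sq_nonneg (N x).2])
      have k2 : |(N x).2| ≤ 1 := abs_le_one_iff_mul_self_le_one.2 (by nlinarith [sq_nonneg (N x).1])
      have h1 : HasDerivAt Real.smoothTransition
          (deriv Real.smoothTransition (k n * t x - 1)) (k n * t x - 1) :=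
        ((Real.smoothTransition.contDiff (n := 1)).differentiable one_ne_zero _).hasDerivAt
      have h2 : HasFDerivAt (fun y => Real.smoothTransition (k n * t y - 1))
          (deriv Real.smoothTransition (k n * t x - 1) • (k n • dotL (N x))) x :=
        HasDerivAt.comp_hasFDerivAt (f := fun y => k n * t y - 1) x h1
          (((hc.grad x hx hxδ).const_mul (k n)).sub_const 1)
      have h3 : ∀ z : ℝ, |z| ≤ 1 →
          t x * |deriv Real.smoothTransition (k n * t x - 1) * (k n * z)| ≤ C := by
        intro z hz
        have h4 := hC (k n * t x) (by have := kpos n; positivity)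
        have h5 : t x * |deriv Real.smoothTransition (k n * t x - 1) * (k n * z)| =
            |k n * t x * deriv Real.smoothTransition (k n * t x - 1)| * |z| := by
          simp only [abs_mul, abs_of_pos h0, abs_of_pos (kpos n)]
          ring
        rw [h5]
        exact (mul_le_of_le_one_right (abs_nonneg _) hz).trans h4
      rw [dx, dy, (c_in n x hx).fderiv_eq, h2.fderiv]
      simpa [abs_mul] using And.intro (h3 _ k1) (h3 _ k2)
    · have h1 : c n =ᶠ[𝓝 x] fun _ => 1 := by
        refine c_one n x hx ?_
        have := mul_le_mul_of_nonneg_left (not_lt.1 hxδ) (kpos n).le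
        linarith [kδ n]
      have h2 : 0 ≤ C := (abs_nonneg _).trans (hC 0 le_rfl)
      rw [dx, dy, h1.fderiv_eq]
      simpa using h2

/-- A smooth transition from `0` on `(-∞, δ/4]` to `1` on `[δ/2, ∞)`, with derivative `χ'`. -/
structure Transition (δ C : ℝ) (χ χ' : ℝ → ℝ) : Prop where
  deriv : ∀ y, HasDerivAt χ (χ' y) y
  cont : Continuous χ'
  nonneg : ∀ y, 0 ≤ χ y
  le_one : ∀ y, χ y ≤ 1
  zero : ∀ y, y ≤ δ / 4 → χ y = 0
  one : ∀ y, δ / 2 ≤ y → χ y = 1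
  deriv_zero : ∀ y, y < δ / 4 → χ' y = 0
  deriv_le : ∀ y, |χ' y| ≤ C

theorem exists_transition {δ : ℝ} (hδ : 0 < δ) : ∃ C χ χ', Transition δ C χ χ' := by
  have hcd : Continuous (deriv Real.smoothTransition) :=
    (Real.smoothTransition.contDiff (n := 1)).continuous_deriv le_rfl
  set χ : ℝ → ℝ := fun y => Real.smoothTransition (4 / δ * y - 1) with hχ
  set χ' : ℝ → ℝ := fun y => deriv Real.smoothTransition (4 / δ * y - 1) * (4 / δ) with hχ'
  have hd : ∀ y, HasDerivAt χ (χ' y) y := fun y => by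
    have h1 : HasDerivAt Real.smoothTransition
        (deriv Real.smoothTransition (4 / δ * y - 1)) (4 / δ * y - 1) :=
      ((Real.smoothTransition.contDiff (n := 1)).differentiable one_ne_zero _).hasDerivAt
    have h2 : HasDerivAt (fun y => 4 / δ * y - 1) (4 / δ) y := by
      simpa using ((hasDerivAt_id y).const_mul (4 / δ)).sub_const 1
    exact h1.comp y h2
  have hcont : Continuous χ' := by fun_prop
  have h0 : ∀ y, y ≤ δ / 4 → χ y = 0 := fun y hy => by
    refine Real.smoothTransition.zero_of_nonpos ?_
    have : 4 / δ * y ≤ 4 / δ * (δ / 4) := by gcongr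
    have e : 4 / δ * (δ / 4) = 1 := by field_simp
    linarith
  have h1 : ∀ y, δ / 2 ≤ y → χ y = 1 := fun y hy => by
    refine Real.smoothTransition.one_of_one_le ?_
    have : 4 / δ * (δ / 2) ≤ 4 / δ * y := by gcongr
    have e : 4 / δ * (δ / 2) = 2 := by field_simp; norm_num
    linarith
  have d0 : ∀ y, y < δ / 4 → χ' y = 0 := fun y hy => by
    have : χ =ᶠ[𝓝 y] fun _ => 0 := by
      filter_upwards [Iio_mem_nhds hy] with z hz using h0 z (le_of_lt hz)
    rw [← (hd y).deriv, this.deriv_eq]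
    simp
  have d1 : ∀ y, δ / 2 < y → χ' y = 0 := fun y hy => by
    have : χ =ᶠ[𝓝 y] fun _ => 1 := by
      filter_upwards [Ioi_mem_nhds hy] with z hz using h1 z (le_of_lt hz)
    rw [← (hd y).deriv, this.deriv_eq]
    simp
  obtain ⟨C, hC⟩ := (isCompact_Icc (a := δ / 4) (b := δ / 2)).exists_bound_of_continuousOn
    hcont.continuousOn
  have hC0 : 0 ≤ C := (norm_nonneg _).trans (hC (δ / 4) ⟨le_rfl, by linarith⟩)
  refine ⟨C, χ, χ', hd, hcont, fun _ => Real.smoothTransition.nonneg _,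
    fun _ => Real.smoothTransition.le_one _, h0, h1, d0, fun y => ?_⟩
  rcases lt_or_ge y (δ / 4) with hy | hy
  · rw [d0 y hy]; simpa using hC0
  rcases lt_or_ge (δ / 2) y with hy' | hy'
  · rw [d1 y hy']; simpa using hC0
  exact hC y ⟨hy, hy'⟩

namespace BoundaryProfile

variable {ξ Θ C₁ M : ℝ} {u q h r : ℝ → ℝ}

theorem continuousOn_h (P : BoundaryProfile ξ Θ C₁ M u q h r) : ContinuousOn h (Ici 0) := by
  have : h = fun τ => q τ ^ 2 - (τ + ξ) ^ 2 + Θ := funext P.rel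
  rw [this]
  have := P.cq
  fun_prop

/-- The tangential coefficient of the certificate, as a function of the distance. -/
def coefF (h χ : ℝ → ℝ) (s y : ℝ) : ℝ := (1 - χ y) * h (s * y) + χ y

/-- The derivative of `coefF`. -/
def coefF' (ξ : ℝ) (q h χ χ' : ℝ → ℝ) (s y : ℝ) : ℝ :=
  (1 - χ y) * (s * (2 * q (s * y) * h (s * y) - 2 * (s * y + ξ))) + χ' y * (1 - h (s * y))

/-- The normal coefficient of the certificate, as a function of the distance. -/
def coefG (ξ K : ℝ) (q h r χ : ℝ → ℝ) (s y : ℝ) : ℝ :=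
  (1 - χ y) * (s * (q (s * y) - h (s * y) * (s * y + ξ) + K / s * r (s * y)))

/-- The derivative of `coefG`. -/
def coefG' (ξ C₁ K : ℝ) (q h r χ χ' : ℝ → ℝ) (s y : ℝ) : ℝ :=
  (1 - χ y) * (s ^ 2 *
    (-(2 * q (s * y) * h (s * y) - 2 * (s * y + ξ)) * (s * y + ξ) +
      K / s * (2 * q (s * y) * r (s * y) + (q (s * y) - h (s * y) * (s * y + ξ)) - C₁))) -
  χ' y * (s * (q (s * y) - h (s * y) * (s * y + ξ) + K / s * r (s * y)))

theorem hasDerivAt_coefF (P : BoundaryProfile ξ Θ C₁ M u q h r) {δ C : ℝ} {χ χ' : ℝ → ℝ}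
    (T : Transition δ C χ χ') {s : ℝ} (hs : 0 < s) (y : ℝ) (hy : 0 < y) :
    HasDerivAt (coefF h χ s) (coefF' ξ q h χ χ' s y) y := by
  have l : HasDerivAt (fun y => s * y) s y := by simpa using (hasDerivAt_id y).const_mul s
  have hh : HasDerivAt (fun y => h (s * y)) _ y := (P.dh (s * y) (by positivity)).comp y l
  have hχ := T.deriv y
  refine (((hχ.const_sub 1).mul hh).add hχ).congr_deriv ?_
  simp only [coefF']
  ring

theorem hasDerivAt_coefG (P : BoundaryProfile ξ Θ C₁ M u q h r) {δ C : ℝ} {χ χ' : ℝ → ℝ}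
    (T : Transition δ C χ χ') {s : ℝ} (hs : 0 < s) (K y : ℝ) (hy : 0 < y) :
    HasDerivAt (coefG ξ K q h r χ s) (coefG' ξ C₁ K q h r χ χ' s y) y := by
  have l : HasDerivAt (fun y => s * y) s y := by simpa using (hasDerivAt_id y).const_mul s
  have hsy : 0 < s * y := by positivity
  have hh : HasDerivAt (fun y => h (s * y)) _ y := (P.dh (s * y) hsy).comp y l
  have hq : HasDerivAt (fun y => q (s * y)) _ y := (P.dq (s * y) hsy).comp y l
  have hr : HasDerivAt (fun y => r (s * y)) _ y := (P.dr (s * y) hsy).comp y l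
  have hχ := T.deriv y
  refine ((hχ.const_sub 1).mul
    (((hq.sub (hh.mul (l.add_const ξ))).add (hr.const_mul (K / s))).const_mul s)).congr_deriv ?_
  simp only [coefG', Pi.mul_apply, Pi.add_apply, Pi.sub_apply]
  ring

theorem continuousOn_coef (P : BoundaryProfile ξ Θ C₁ M u q h r) {δ C : ℝ} {χ χ' : ℝ → ℝ}
    (T : Transition δ C χ χ') {s : ℝ} (hs : 0 < s) (K : ℝ) :
    ContinuousOn (coefF' ξ q h χ χ' s) (Ici 0) ∧
      ContinuousOn (coefG' ξ C₁ K q h r χ χ' s) (Ici 0) := by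
  have hl : ContinuousOn (fun y : ℝ => s * y) (Ici 0) := by fun_prop
  have maps : MapsTo (fun y : ℝ => s * y) (Ici 0) (Ici 0) := fun y hy => mul_nonneg hs.le hy
  obtain ⟨h', hh⟩ : ∃ h' : ℝ → ℝ, ∀ y, h (s * y) = h' y := ⟨_, fun _ => rfl⟩
  obtain ⟨q', hq⟩ : ∃ q' : ℝ → ℝ, ∀ y, q (s * y) = q' y := ⟨_, fun _ => rfl⟩
  obtain ⟨r', hr⟩ : ∃ r' : ℝ → ℝ, ∀ y, r (s * y) = r' y := ⟨_, fun _ => rfl⟩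
  have c1 : ContinuousOn h' (Ici 0) := (P.continuousOn_h.comp hl maps).congr fun y _ => (hh y).symm
  have c2 : ContinuousOn q' (Ici 0) := (P.cq.comp hl maps).congr fun y _ => (hq y).symm
  have c3 : ContinuousOn r' (Ici 0) := (P.cr.comp hl maps).congr fun y _ => (hr y).symm
  have c4 : Continuous χ := continuous_iff_continuousAt.2 fun y => (T.deriv y).continuousAt
  have c5 := T.cont
  constructor
  · unfold coefF'; simp only [hh, hq]; fun_prop
  · unfold coefG'; simp only [hh, hq, hr]; fun_prop

end BoundaryProfile

namespace BoundaryProfile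

variable {ξ Θ C₁ M δ C : ℝ} {u q h r χ χ' : ℝ → ℝ}

theorem coefF_mem (P : BoundaryProfile ξ Θ C₁ M u q h r) (T : Transition δ C χ χ') {s y : ℝ}
    (hs : 0 ≤ s) (hy : 0 ≤ y) : 0 ≤ coefF h χ s y ∧ coefF h χ s y ≤ 1 := by
  have h0 := P.h_nonneg (s * y) (by positivity)
  have h1 := P.h_le (s * y) (by positivity)
  have h2 := T.nonneg y
  have h3 := T.le_one y
  unfold coefF
  constructor <;> nlinarith

theorem coefF_le (P : BoundaryProfile ξ Θ C₁ M u q h r) (T : Transition δ C χ χ') (hδ : 0 < δ)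
    {s y : ℝ} (hs : 0 ≤ s) (hy : 0 ≤ y) : |coefF h χ s y| ≤ (M * s + 4 / δ) * y := by
  have h0 := P.h_nonneg (s * y) (by positivity)
  have h1 := P.h_small (s * y) (by positivity)
  have h2 := T.nonneg y
  have h3 := T.le_one y
  rw [abs_of_nonneg (P.coefF_mem T hs hy).1]
  have h4 : χ y ≤ 4 / δ * y := by
    rcases le_or_gt y (δ / 4) with hy' | hy'
    · rw [T.zero y hy']; positivity
    · have : 4 / δ * (δ / 4) ≤ 4 / δ * y := by gcongr
      have e : 4 / δ * (δ / 4) = 1 := by field_simp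
      linarith
  unfold coefF
  nlinarith

theorem abs_g_le (P : BoundaryProfile ξ Θ C₁ M u q h r) {τ : ℝ} (hτ : 0 ≤ τ) (e : ℝ) :
    |q τ - h τ * (τ + ξ) + e * r τ| ≤ (M + |e| * M) * τ := by
  refine (abs_add_le _ _).trans ?_
  rw [abs_of_nonneg (P.g_nonneg τ hτ), abs_mul]
  have h1 := P.g_small τ hτ
  have h2 := mul_le_mul_of_nonneg_left (P.r_small τ hτ) (abs_nonneg e)
  linarith

theorem coefG_le (P : BoundaryProfile ξ Θ C₁ M u q h r) (T : Transition δ C χ χ')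
    {s y : ℝ} (hs : 0 ≤ s) (hy : 0 ≤ y) (K : ℝ) :
    |coefG ξ K q h r χ s y| ≤ (s * ((M + |K / s| * M) * s)) * y := by
  unfold coefG
  have h2 := T.nonneg y
  have h3 := T.le_one y
  have h4 := P.abs_g_le (τ := s * y) (by positivity) (K / s)
  rw [abs_mul, abs_mul, abs_of_nonneg hs, abs_of_nonneg (sub_nonneg.2 h3)]
  calc _ ≤ 1 * (s * ((M + |K / s| * M) * (s * y))) := by gcongr; linarith
    _ = _ := by ring

theorem transition_gap_le (P : BoundaryProfile ξ Θ C₁ M u q h r) (T : Transition δ C χ χ')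
    (hδ : 0 < δ) {s y : ℝ} (hs : 0 < s) (hy : 0 < y) :
    |χ' y * (1 - h (s * y))| ≤ C * (16 * M / δ ^ 2) / s ^ 2 := by
  have hC := (abs_nonneg _).trans (T.deriv_le y)
  have hM := P.one_le
  rcases lt_or_ge y (δ / 4) with hy' | hy'
  · rw [T.deriv_zero y hy', zero_mul, abs_zero]
    positivity
  · have h1 := P.gap_upper (s * y) (by positivity)
    have h2 := P.h_le (s * y) (by positivity)
    have h3 : 1 - h (s * y) ≤ 16 * M / δ ^ 2 / s ^ 2 := by
      rw [div_div, le_div_iff₀ (by positivity)]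
      have h5 : (s * (δ / 4)) ^ 2 ≤ (1 + s * y) ^ 2 := by
        have := mul_le_mul_of_nonneg_left hy' hs.le
        gcongr
        linarith
      nlinarith [mul_le_mul_of_nonneg_left h5 (sub_nonneg.2 h2)]
    rw [abs_mul, abs_of_nonneg (sub_nonneg.2 h2), mul_div_assoc]
    exact mul_le_mul (T.deriv_le y) h3 (sub_nonneg.2 h2) hC

theorem transition_normal_le (P : BoundaryProfile ξ Θ C₁ M u q h r) (T : Transition δ C χ χ')
    (hδ : 0 < δ) {s y : ℝ} (hs : 0 < s) (hy : 0 < y) (K : ℝ) :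
    |χ' y * (s * (q (s * y) - h (s * y) * (s * y + ξ) + K / s * r (s * y)))| ≤
      C * (4 * M / δ + |K| * M) := by
  have hC := (abs_nonneg _).trans (T.deriv_le y)
  have hM := P.one_le
  rcases lt_or_ge y (δ / 4) with hy' | hy'
  · rw [T.deriv_zero y hy', zero_mul, abs_zero]
    positivity
  · obtain ⟨-, h1⟩ := P.g_le (τ := s * y) (by positivity)
    have h2 := P.g_nonneg (s * y) (by positivity)
    obtain ⟨-, -, h3⟩ := P.sq_r_le (τ := s * y) (by positivity)
    set g0 := q (s * y) - h (s * y) * (s * y + ξ)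
    have h4 : s * g0 ≤ 4 * M / δ := by
      rw [le_div_iff₀ hδ]
      have : s * (δ / 4) * g0 ≤ s * y * g0 := by gcongr
      linarith
    have h5 : s * (g0 + K / s * r (s * y)) = s * g0 + K * r (s * y) := by field_simp
    rw [abs_mul, h5]
    refine mul_le_mul (T.deriv_le y) ?_ (abs_nonneg _) hC
    refine (abs_add_le _ _).trans (add_le_add ?_ ?_)
    · rwa [abs_of_nonneg (mul_nonneg hs.le h2)]
    · rw [abs_mul]
      exact mul_le_mul_of_nonneg_left h3 (abs_nonneg _)

/-- The pointwise lower bound of the magnetic energy density in the collar, up to a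
divergence. -/
theorem collar_lower_bound (P : BoundaryProfile ξ Θ C₁ M u q h r) (T : Transition δ C χ χ')
    (hδ : 0 < δ) (hΘ : Θ < 1) {s y K D lap b Zs X ρ : ℝ} (hs : 0 < s) (hy : 0 < y)
    (hK : |K * y| ≤ 1 / 2) (hlap : -K / (1 - K * y) ≤ lap) (hD : |lap| ≤ D)
    (hZ : 0 ≤ Zs) (hρ : 0 ≤ ρ) (hX : X ^ 2 ≤ Zs * ρ) :
    (Θ * s ^ 2 - C₁ * K * s - (K ^ 2 * (M ^ 3 + M ^ 2 + 2 * M) + D * |K| * M +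
      (C₁ * K) ^ 2 / (4 * (1 - Θ)) + C * (4 * M / δ + |K| * M)) -
      C * (16 * M / δ ^ 2) / s ^ 2) * ρ -
      C * (16 * M / δ ^ 2) / s ^ 2 * Zs + coefF h χ s y * b * ρ ≤
    (1 - coefF h χ s y ^ 2) * Zs +
      (coefF' ξ q h χ χ' s y - 2 * coefF h χ s y * coefG ξ K q h r χ s y) * X +
      (coefF h χ s y * (s ^ 2 + b) +
        (coefG' ξ C₁ K q h r χ χ' s y + coefG ξ K q h r χ s y * lap) -
        coefG ξ K q h r χ s y ^ 2) * ρ := by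
  have e1 : K / s * (s * y) = K * y := by field_simp
  have hM := P.one_le
  have hD0 := (abs_nonneg _).trans hD
  have h1 := P.certificate (τ := s * y) (K := K) (s := s) (D := D) (lap := lap / s)
    (Zs := Zs / s ^ 2) (X := X / s) (U := ρ) (by positivity) hs (by rwa [e1])
    (by
      rw [e1, neg_div', div_right_comm]
      exact div_le_div_of_nonneg_right hlap hs.le)
    (by rw [abs_div, abs_of_pos hs]; gcongr) (by positivity) hρ
    (by rw [div_pow, div_mul_eq_mul_div]; gcongr)
  set w := s * y + ξ
  set Q := q (s * y)
  set H := h (s * y)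
  set R := r (s * y)
  have h2 := mul_le_mul_of_nonneg_left h1 (sq_nonneg s)
  have c4 : 0 ≤ (C₁ * K) ^ 2 / (4 * (1 - Θ)) := by
    have : 0 < 1 - Θ := by linarith
    positivity
  set c0 := K ^ 2 * (M ^ 3 + M ^ 2 + 2 * M) + D * |K| * M with hc0
  have c0pos : 0 ≤ c0 := by positivity
  have h3 := blended_lower_bound (χ := χ y) (χ' := χ' y) (h := H)
    (hp := s * (2 * Q * H - 2 * w)) (Ga := s * (Q - H * w + K / s * R))
    (Gp := s ^ 2 * (-(2 * Q * H - 2 * w) * w + K / s * (2 * Q * R + (Q - H * w) - C₁)))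
    (lap := lap) (B := s ^ 2) (b := b) (Zs := Zs) (X := X) (ρ := ρ)
    (L := Θ * s ^ 2 - C₁ * K * s - (c0 + (C₁ * K) ^ 2 / (4 * (1 - Θ))))
    (C := C * (4 * M / δ + |K| * M)) (ε := C * (16 * M / δ ^ 2) / s ^ 2)
    (T.nonneg y) (T.le_one y) hZ hρ hX ?_ ?_ (P.transition_gap_le T hδ hs hy)
    (P.transition_normal_le T hδ hs hy K)
  · simp only [coefF, coefF', coefG, coefG']
    linarith [h3]
  · have e2 : s ^ 2 * ((Θ - K / s * C₁ - c0 / s ^ 2) * ρ) =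
        (Θ * s ^ 2 - C₁ * K * s - c0) * ρ := by
      field_simp
    have e3 : s ^ 2 * ((1 - H ^ 2) * (Zs / s ^ 2) +
        (2 * Q * H - 2 * w - 2 * H * (Q - H * w + K / s * R)) * (X / s) +
        (H + (-(2 * Q * H - 2 * w) * w + K / s * (2 * Q * R + (Q - H * w) - C₁)) +
          lap / s * (Q - H * w + K / s * R) - (Q - H * w + K / s * R) ^ 2) * ρ) =
        (1 - H ^ 2) * Zs + (s * (2 * Q * H - 2 * w) - 2 * H * (s * (Q - H * w + K / s * R))) * X +
        (H * s ^ 2 + s ^ 2 * (-(2 * Q * H - 2 * w) * w +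
          K / s * (2 * Q * R + (Q - H * w) - C₁)) + s * (Q - H * w + K / s * R) * lap -
          (s * (Q - H * w + K / s * R)) ^ 2) * ρ := by
      set g := Q - H * w + K / s * R
      set g' := -(2 * Q * H - 2 * w) * w + K / s * (2 * Q * R + (Q - H * w) - C₁)
      field_simp
    rw [e2, e3] at h2
    linear_combination h2 + mul_nonneg c4 hρ
  · have h5 : 0 < 1 - Θ := by linarith
    have h4 : -(C₁ * K * s) - (C₁ * K) ^ 2 / (4 * (1 - Θ)) ≤ (1 - Θ) * s ^ 2 := by
      have : (1 - Θ) * s ^ 2 + C₁ * K * s + (C₁ * K) ^ 2 / (4 * (1 - Θ)) =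
          (2 * (1 - Θ) * s + C₁ * K) ^ 2 / (4 * (1 - Θ)) := by
        field_simp
        ring
      have h6 : 0 ≤ (2 * (1 - Θ) * s + C₁ * K) ^ 2 / (4 * (1 - Θ)) := by positivity
      linarith
    linarith

end BoundaryProfile

section

open BoundaryProfile

theorem exists_abs_le_of_continuousOn_Ici {β : ℝ → ℝ} (h : ContinuousOn β (Ici 0)) (δ : ℝ) :
    ∃ C, ∀ s, 0 < s → s < δ → |β s| ≤ C := by
  obtain ⟨C, hC⟩ := (isCompact_Icc (a := (0 : ℝ)) (b := δ)).exists_bound_of_continuousOn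
    (h.mono Icc_subset_Ici_self)
  exact ⟨C, fun s h1 h2 => hC s ⟨h1.le, h2.le⟩⟩

/-- The magnetic energy density of `a + i b` with potential `(A₁, A₂)`. -/
def magDensity (a b A₁ A₂ : Plane → ℝ) (x : Plane) : ℝ :=
  re1 a b A₁ x ^ 2 + im1 a b A₁ x ^ 2 + (re2 a b A₂ x ^ 2 + im2 a b A₂ x ^ 2)

theorem frame_lower_bound_fieldDiv {f X₁ X₂ a b A₁ A₂ : Plane → ℝ} {x : Plane}
    (ha : Differentiable ℝ a) (hb : Differentiable ℝ b) {n₁ n₂ f' G v : ℝ}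
    (hn : n₁ ^ 2 + n₂ ^ 2 = 1) (hf₁ : dx f x = f' * n₁) (hf₂ : dy f x = f' * n₂)
    (hX₁ : X₁ x = G * n₁) (hX₂ : X₂ x = G * n₂) (hv : dx X₁ x + dy X₂ x = v) :
    ∃ Zs X, 0 ≤ Zs ∧ Zs ≤ magDensity a b A₁ A₂ x ∧ X ^ 2 ≤ Zs * (a x ^ 2 + b x ^ 2) ∧
      (1 - f x ^ 2) * Zs + (f' - 2 * f x * G) * X +
        (f x * (dx A₂ x - dy A₁ x) + v - G ^ 2) * (a x ^ 2 + b x ^ 2) ≤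
      magDensity a b A₁ A₂ x + fieldDiv f X₁ X₂ a b A₁ A₂ x := by
  refine ⟨(n₂ * re1 a b A₁ x - n₁ * re2 a b A₂ x) ^ 2 +
    (n₂ * im1 a b A₁ x - n₁ * im2 a b A₂ x) ^ 2,
    a x * (n₂ * re1 a b A₁ x - n₁ * re2 a b A₂ x) +
    b x * (n₂ * im1 a b A₁ x - n₁ * im2 a b A₂ x), by positivity, ?_, ?_, ?_⟩
  · unfold magDensity
    have e : re1 a b A₁ x ^ 2 + im1 a b A₁ x ^ 2 + (re2 a b A₂ x ^ 2 + im2 a b A₂ x ^ 2) =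
      (n₁ * re1 a b A₁ x + n₂ * re2 a b A₂ x) ^ 2 + (n₁ * im1 a b A₁ x + n₂ * im2 a b A₂ x) ^ 2 +
      ((n₂ * re1 a b A₁ x - n₁ * re2 a b A₂ x) ^ 2 +
        (n₂ * im1 a b A₁ x - n₁ * im2 a b A₂ x) ^ 2) := by
      linear_combination (-(re1 a b A₁ x ^ 2 + im1 a b A₁ x ^ 2 +
        (re2 a b A₂ x ^ 2 + im2 a b A₂ x ^ 2))) * hn
    rw [e]
    have : 0 ≤ (n₁ * re1 a b A₁ x + n₂ * re2 a b A₂ x) ^ 2 +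
      (n₁ * im1 a b A₁ x + n₂ * im2 a b A₂ x) ^ 2 := by positivity
    linarith
  · set α := n₂ * re1 a b A₁ x - n₁ * re2 a b A₂ x
    set β := n₂ * im1 a b A₁ x - n₁ * im2 a b A₂ x
    nlinarith [sq_nonneg (a x * β - b x * α)]
  · have h := frame_lower_bound (p₁ := re1 a b A₁ x) (m₁ := im1 a b A₁ x) (p₂ := re2 a b A₂ x)
      (m₂ := im2 a b A₂ x) (a := a x) (b := b x) (f := f x) (f' := f') (G := G)
      (κ := dx A₂ x - dy A₁ x) (v := v) hn
    refine h.trans (le_of_eq ?_)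
    have d1 : dx (fun x => a x ^ 2 + b x ^ 2) x = 2 * (a x * dx a x + b x * dx b x) :=
      fderiv_normSq_apply ha hb x _
    have d2 : dy (fun x => a x ^ 2 + b x ^ 2) x = 2 * (a x * dy a x + b x * dy b x) :=
      fderiv_normSq_apply ha hb x _
    simp only [magDensity, fieldDiv, d1, d2, curlCurrent, cur1, cur2, hf₁, hf₂, hX₁, hX₂]
    rw [← hv]
    simp only [re1, re2, im1, im2]
    ring

/-- The certificate for the two-term lower bound: the magnetic energy density plus a
divergence of vanishing integral is bounded below pointwise. -/
theorem Collar.magnetic_certificate {Ω : Set Plane} {K δ D : ℝ} {t : Plane → ℝ}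
    {N : Plane → Plane} (hc : Collar Ω K δ D t N) (hbd : Bornology.IsBounded Ω)
    {ξ Θ C₁ M : ℝ} {u q h r : ℝ → ℝ} (P : BoundaryProfile ξ Θ C₁ M u q h r) (hΘ : Θ < 1)
    (hD : 0 ≤ D) :
    ∃ C, 0 ≤ C ∧ ∀ s, 1 ≤ s → ∃ f : Plane → ℝ, ContinuousOn f Ω ∧
      (∀ x ∈ Ω, 0 ≤ f x ∧ f x ≤ 1) ∧
      ∀ a b A₁ A₂ : Plane → ℝ, TestFun a → TestFun b → ContDiff ℝ 1 A₁ → ContDiff ℝ 1 A₂ →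
        ∃ Φ : Plane → ℝ, IntegrableOn Φ Ω ∧ ∫ x in Ω, Φ x = 0 ∧ ∀ x ∈ Ω,
          (Θ * s ^ 2 - C₁ * K * s - C) * (a x ^ 2 + b x ^ 2) +
            f x * (dx A₂ x - dy A₁ x - s ^ 2) * (a x ^ 2 + b x ^ 2) ≤
          (1 + C / s ^ 2) * magDensity a b A₁ A₂ x + Φ x := by
  classical
  have hδ := hc.δ_pos
  obtain ⟨Cχ, χ, χ', T⟩ := exists_transition hδ
  obtain ⟨c, Cc, hex⟩ := hc.exists_exhaustion
  have hM := P.one_le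
  have hCχ := (abs_nonneg _).trans (T.deriv_le 0)
  set E := Cχ * (16 * M / δ ^ 2) with hE
  have hE0 : 0 ≤ E := by positivity
  set C0 := K ^ 2 * (M ^ 3 + M ^ 2 + 2 * M) + (2 * D) * |K| * M +
      (C₁ * K) ^ 2 / (4 * (1 - Θ)) + Cχ * (4 * M / δ + |K| * M) with hC0
  have hΘ' : 0 < 1 - Θ := by linarith
  have hC00 : 0 ≤ C0 := by positivity
  refine ⟨C0 + E, by positivity, fun s hs => ?_⟩
  have hs0 : 0 < s := by linarith
  set f : Plane → ℝ := fun x => coefF h χ s (t x) with hf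
  set X₁ : Plane → ℝ := fun x => if t x < δ then coefG ξ K q h r χ s (t x) * (N x).1 else 0
    with hX₁
  set X₂ : Plane → ℝ := fun x => if t x < δ then coefG ξ K q h r χ s (t x) * (N x).2 else 0
    with hX₂
  obtain ⟨cF, cG⟩ := P.continuousOn_coef T hs0 K
  have cF' := cF.mono Ioi_subset_Ici_self
  have cG' := cG.mono Ioi_subset_Ici_self
  obtain ⟨M₁, hM₁⟩ := exists_abs_le_of_continuousOn_Ici cF δ
  obtain ⟨M₂, hM₂⟩ := exists_abs_le_of_continuousOn_Ici cG δ
  have dF := P.hasDerivAt_coefF T hs0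
  have dG := P.hasDerivAt_coefG T hs0 K
  have hG0 : ∀ y, δ / 2 ≤ y → coefG ξ K q h r χ s y = 0 := fun y hy => by
    simp [coefG, T.one y hy]
  have hF1 : ∀ y, δ / 2 ≤ y → coefF h χ s y = 1 := fun y hy => by
    simp [coefF, T.one y hy]
  have unitN : ∀ x ∈ Ω, t x < δ → |(N x).1| ≤ 1 ∧ |(N x).2| ≤ 1 := fun x hx hxδ => by
    have hu := hc.unit x hx hxδ
    exact ⟨abs_le_one_iff_mul_self_le_one.2 (by nlinarith [sq_nonneg (N x).2]),
      abs_le_one_iff_mul_self_le_one.2 (by nlinarith [sq_nonneg (N x).1])⟩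
  obtain ⟨B₁, v₁⟩ := hc.vanishing (F := f) (m := fun _ => 1) (c := 1)
    (M := max (M * s + 4 / δ) M₁) dF cF'
    (fun y h1 _ => (P.coefF_le T hδ hs0.le h1.le).trans
      (mul_le_mul_of_nonneg_right (le_max_left _ _) h1.le))
    (fun y h1 h2 => (hM₁ y h1 h2).trans (le_max_right _ _))
    (fun _ _ _ => contDiffAt_const) (by simp) (fun _ _ _ _ _ => by simpa using hD)
    (fun x _ _ => by simp [hf]) (fun x _ hx' => hF1 _ hx'.le)
  have vX : ∀ m : Plane → ℝ, (∀ x ∈ Ω, t x < δ → ContDiffAt ℝ 1 m x) →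
      (∀ x ∈ Ω, t x < δ → |m x| ≤ 1) →
      (∀ x ∈ Ω, t x < δ → ∀ v ∈ ({(1, 0), (0, 1)} : Set Plane), |fderiv ℝ m x v| ≤ D) →
      ∃ B, Vanishing Ω t B
        (fun x => if t x < δ then coefG ξ K q h r χ s (t x) * m x else 0) := by
    intro m h1 h2 h3
    refine hc.vanishing (m := m) (c := 0) (M := max (s * ((M + |K / s| * M) * s)) M₂) dG cG'
      (fun y h1 _ => (P.coefG_le T hs0.le h1.le K).trans
        (mul_le_mul_of_nonneg_right (le_max_left _ _) h1.le))
      (fun y h1 h2 => (hM₂ y h1 h2).trans (le_max_right _ _)) h1 h2 h3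
      (fun x _ hx => by simp [hx]) (fun x _ hx => by simp [hG0 _ hx.le])
  obtain ⟨B₂, v₂⟩ := vX (fun x => (N x).1) (fun x hx hxδ => (hc.smooth x hx hxδ).fst)
    (fun x hx hxδ => (unitN x hx hxδ).1) (fun x hx hxδ v hv => (hc.grad_le x hx hxδ v hv).1)
  obtain ⟨B₃, v₃⟩ := vX (fun x => (N x).2) (fun x hx hxδ => (hc.smooth x hx hxδ).snd)
    (fun x hx hxδ => (unitN x hx hxδ).2) (fun x hx hxδ v hv => (hc.grad_le x hx hxδ v hv).2)
  have tpos : ∀ x ∈ Ω, 0 ≤ t x := fun x hx => (hc.pos x hx).le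
  refine ⟨f, v₁.smooth.continuousOn, fun x hx => P.coefF_mem T hs0.le (tpos x hx),
    fun a b A₁ A₂ ha hb hA₁ hA₂ => ?_⟩
  obtain ⟨i1, i2⟩ := integral_fieldDiv hc.isOpen hbd hex
    (v₁.mono tpos (le_max_left B₁ (max B₂ B₃)))
    (v₂.mono tpos ((le_max_left _ _).trans (le_max_right B₁ (max B₂ B₃))))
    (v₃.mono tpos ((le_max_right _ _).trans (le_max_right B₁ (max B₂ B₃)))) ha hb hA₁ hA₂
  refine ⟨_, i1, i2, fun x hx => ?_⟩
  have hρ : 0 ≤ a x ^ 2 + b x ^ 2 := by positivity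
  have hEs : E / s ^ 2 ≤ E := div_le_self hE0 (by nlinarith)
  have hCEs : E / s ^ 2 ≤ (C0 + E) / s ^ 2 := by gcongr; linarith
  by_cases hxδ : t x < δ
  · have h0 := hc.pos x hx
    have hn := hc.unit x hx hxδ
    have e1 : ∀ v : Plane, fderiv ℝ f x v =
        coefF' ξ q h χ χ' s (t x) * ((N x).1 * v.1 + (N x).2 * v.2) := fun v => by
      rw [hc.hasFDerivAt_comp_mul (m := fun _ => 1) dF (fun _ _ _ => contDiffAt_const)
        (fun x _ _ => by simp [hf]) hx hxδ]
      simp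
    have e2 : ∀ v, fderiv ℝ X₁ x v = _ := fun v =>
      hc.hasFDerivAt_comp_mul (m := fun x => (N x).1) dG
        (fun x hx hxδ => (hc.smooth x hx hxδ).fst) (fun x _ hx => by simp [hX₁, hx]) hx hxδ v
    have e3 : ∀ v, fderiv ℝ X₂ x v = _ := fun v =>
      hc.hasFDerivAt_comp_mul (m := fun x => (N x).2) dG
        (fun x hx hxδ => (hc.smooth x hx hxδ).snd) (fun x _ hx => by simp [hX₂, hx]) hx hxδ v
    obtain ⟨Zs, X, hZ, hZD, hX, hmain⟩ := frame_lower_bound_fieldDiv (x := x) (f := f) (X₁ := X₁)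
      (X₂ := X₂) (A₁ := A₁) (A₂ := A₂) (n₁ := (N x).1) (n₂ := (N x).2)
      (f' := coefF' ξ q h χ χ' s (t x)) (G := coefG ξ K q h r χ s (t x))
      (v := coefG' ξ C₁ K q h r χ χ' s (t x) + coefG ξ K q h r χ s (t x) *
        (dx (fun y => (N y).1) x + dy (fun y => (N y).2) x))
      ha.differentiable hb.differentiable hn
      (by rw [dx, e1]; simp) (by rw [dy, e1]; simp) (by simp [hX₁, hxδ]) (by simp [hX₂, hxδ])
      (by
        rw [dx, dy, e2, e3, dx, dy]
        linear_combination (coefG' ξ C₁ K q h r χ χ' s (t x)) * hn)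
    have hlap := hc.laplacian x hx hxδ
    have hlD : |dx (fun y => (N y).1) x + dy (fun y => (N y).2) x| ≤ 2 * D := by
      refine (abs_add_le _ _).trans ?_
      have k1 := (hc.grad_le x hx hxδ (1, 0) (by simp)).1
      have k2 := (hc.grad_le x hx hxδ (0, 1) (by simp)).2
      rw [dx, dy]
      linarith
    have hK : |K * t x| ≤ 1 / 2 := by
      rw [abs_mul, abs_of_pos h0]
      exact (mul_le_mul_of_nonneg_left hxδ.le (abs_nonneg K)).trans hc.K_le
    have key := P.collar_lower_bound T hδ hΘ (b := dx A₂ x - dy A₁ x - s ^ 2) hs0 h0 hK hlap hlD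
      hZ hρ hX
    rw [← hC0, ← hE] at key
    have hfx : f x = coefF h χ s (t x) := rfl
    rw [hfx] at hmain ⊢
    rw [show s ^ 2 + (dx A₂ x - dy A₁ x - s ^ 2) = dx A₂ x - dy A₁ x by ring] at key
    have k1 := mul_le_mul hCEs hZD hZ (by positivity)
    have k2 := mul_le_mul_of_nonneg_right hEs hρ
    linarith
  · have hloc : {y | y ∈ Ω ∧ δ / 2 < t y} ∈ 𝓝 x :=
      (hc.isOpen_gt (δ / 2)).mem_nhds ⟨hx, by linarith⟩
    have e1 : f =ᶠ[𝓝 x] fun _ => 1 := by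
      filter_upwards [hloc] with y hy using hF1 _ hy.2.le
    have e2 : X₁ =ᶠ[𝓝 x] fun _ => 0 := by
      filter_upwards [hloc] with y hy
      simp [hX₁, hG0 _ hy.2.le]
    have e3 : X₂ =ᶠ[𝓝 x] fun _ => 0 := by
      filter_upwards [hloc] with y hy
      simp [hX₂, hG0 _ hy.2.le]
    obtain ⟨Zs, X, hZ, hZD, hX, hmain⟩ := frame_lower_bound_fieldDiv (x := x) (f := f) (X₁ := X₁)
      (X₂ := X₂) (A₁ := A₁) (A₂ := A₂) (n₁ := 1) (n₂ := 0)
      (f' := 0) (G := 0) (v := 0)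
      ha.differentiable hb.differentiable (by norm_num)
      (by rw [dx, e1.fderiv_eq]; simp) (by rw [dy, e1.fderiv_eq]; simp)
      (by rw [e2.eq_of_nhds]; simp) (by rw [e3.eq_of_nhds]; simp)
      (by rw [dx, dy, e2.fderiv_eq, e3.fderiv_eq]; simp)
    rw [e1.eq_of_nhds] at hmain ⊢
    have hm0 : 0 ≤ magDensity a b A₁ A₂ x := by unfold magDensity; positivity
    have k1 : 0 ≤ (C0 + E) / s ^ 2 * magDensity a b A₁ A₂ x := by positivity
    have k3 : Θ * s ^ 2 - C₁ * K * s - (C0 + E) - s ^ 2 ≤ 0 := by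
      have h4 : -(C₁ * K * s) - (C₁ * K) ^ 2 / (4 * (1 - Θ)) ≤ (1 - Θ) * s ^ 2 := by
        have : (1 - Θ) * s ^ 2 + C₁ * K * s + (C₁ * K) ^ 2 / (4 * (1 - Θ)) =
            (2 * (1 - Θ) * s + C₁ * K) ^ 2 / (4 * (1 - Θ)) := by
          field_simp
          ring
        have h6 : 0 ≤ (2 * (1 - Θ) * s + C₁ * K) ^ 2 / (4 * (1 - Θ)) := by positivity
        linarith
      have h7 : 0 ≤ K ^ 2 * (M ^ 3 + M ^ 2 + 2 * M) + (2 * D) * |K| * M +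
        Cχ * (4 * M / δ + |K| * M) := by positivity
      linarith
    have k2 := mul_le_mul_of_nonneg_right k3 hρ
    linarith

end

theorem exists_testFun_eqOn {Ω : Set Plane} (hbd : Bornology.IsBounded Ω) {g : Plane → ℝ}
    (hg : CNearCl 1 Ω g) : ∃ G, TestFun G ∧ EqOn G g Ω := by
  obtain ⟨U, hU, hΩU, hgU⟩ := hg
  obtain ⟨V, hV, hΩV, hVU, hVc⟩ :=
    exists_open_between_and_isCompact_closure hbd.isCompact_closure hU hΩU
  obtain ⟨χ, h0, h1, -⟩ := exists_contMDiffMap_zero_one_of_isClosed (n := 1)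
    (modelWithCornersSelf ℝ Plane) hV.isClosed_compl isClosed_closure
    (disjoint_compl_left_iff_subset.2 hΩV)
  have hχ : ContDiff ℝ 1 χ := χ.contMDiff.contDiff
  have hs : tsupport χ ⊆ closure V :=
    closure_mono fun x hx => by_contra fun h => hx (h0 h)
  have hs' : tsupport (fun x => χ x * g x) ⊆ tsupport χ :=
    closure_mono fun x hx hχx => hx (by simp [hχx])
  refine ⟨fun x => χ x * g x, ⟨contDiff_iff_contDiffAt.2 fun x => ?_,
    hVc.of_isClosed_subset (isClosed_tsupport _) (hs'.trans hs)⟩, fun x hx => ?_⟩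
  · by_cases hx : x ∈ tsupport χ
    · exact hχ.contDiffAt.mul (hgU.contDiffAt (hU.mem_nhds (hVU (hs hx))))
    · refine (contDiffAt_const (c := (0 : ℝ))).congr_of_eventuallyEq ?_
      filter_upwards [notMem_tsupport_iff_eventuallyEq.1 hx] with y hy
      simp [hy]
  · simp [h1 (subset_closure hx)]

theorem CNearCl.clm_comp {E F : Type*} [NormedAddCommGroup E] [NormedSpace ℝ E]
    [NormedAddCommGroup F] [NormedSpace ℝ F] {Ω : Set Plane} {n : ℕ} {g : Plane → E}
    (hg : CNearCl n Ω g) (l : E →L[ℝ] F) : CNearCl n Ω (fun x => l (g x)) := by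
  obtain ⟨U, hU, hΩU, hgU⟩ := hg
  exact ⟨U, hU, hΩU, l.contDiff.comp_contDiffOn hgU⟩

theorem CNearCl.differentiableAt {E : Type*} [NormedAddCommGroup E] [NormedSpace ℝ E]
    {Ω : Set Plane} {g : Plane → E} (hg : CNearCl 1 Ω g) {x : Plane} (hx : x ∈ Ω) :
    DifferentiableAt ℝ g x := by
  obtain ⟨U, hU, hΩU, hgU⟩ := hg
  exact (hgU.contDiffAt (hU.mem_nhds (hΩU (subset_closure hx)))).differentiableAt (by simp)

/-- Real representatives of a Ginzburg–Landau configuration on `Ω`. -/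
structure Representative (Ω : Set Plane) (ψ : Plane → ℂ) (A : Plane → Plane)
    (a b A₁ A₂ : Plane → ℝ) : Prop where
  ha : TestFun a
  hb : TestFun b
  hA₁ : TestFun A₁
  hA₂ : TestFun A₂
  normSq : ∀ x ∈ Ω, ‖ψ x‖ ^ 2 = a x ^ 2 + b x ^ 2
  curl : ∀ x ∈ Ω, curl2 A x = dx A₂ x - dy A₁ x
  magSq : ∀ B, ∀ x ∈ Ω,
    magSq B A ψ x = magDensity a b (fun x => B * A₁ x) (fun x => B * A₂ x) x

theorem exists_representative {Ω : Set Plane} (hΩ : IsOpen Ω) (hbd : Bornology.IsBounded Ω)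
    {ψ : Plane → ℂ} {A : Plane → Plane} (h : GLadm Ω ψ A) :
    ∃ a b A₁ A₂, Representative Ω ψ A a b A₁ A₂ := by
  obtain ⟨a, ha, ea⟩ := exists_testFun_eqOn hbd (h.1.clm_comp Complex.reCLM)
  obtain ⟨b, hb, eb⟩ := exists_testFun_eqOn hbd (h.1.clm_comp Complex.imCLM)
  obtain ⟨A₁, hA₁, e₁⟩ := exists_testFun_eqOn hbd (h.2.clm_comp (ContinuousLinearMap.fst ℝ ℝ ℝ))
  obtain ⟨A₂, hA₂, e₂⟩ := exists_testFun_eqOn hbd (h.2.clm_comp (ContinuousLinearMap.snd ℝ ℝ ℝ))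
  have loc : ∀ {F G : Plane → ℝ}, EqOn F G Ω → ∀ x ∈ Ω, fderiv ℝ F x = fderiv ℝ G x :=
    fun hFG x hx => (hFG.eventuallyEq_of_mem (hΩ.mem_nhds hx)).fderiv_eq
  refine ⟨a, b, A₁, A₂, ha, hb, hA₁, hA₂, fun x hx => ?_, fun x hx => ?_, fun B x hx => ?_⟩
  · rw [ea hx, eb hx, ← Complex.normSq_eq_norm_sq, Complex.normSq_apply]
    simp
    ring
  · rw [dx, dy, loc e₁ x hx, loc e₂ x hx]
    rfl
  · have hψ := h.1.differentiableAt hx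
    have da : ∀ v, fderiv ℝ a x v = (fderiv ℝ ψ x v).re := fun v => by
      rw [loc ea x hx]
      have : HasFDerivAt (fun x => Complex.reCLM (ψ x)) _ x :=
        Complex.reCLM.hasFDerivAt.comp x hψ.hasFDerivAt
      rw [this.fderiv]
      simp
    have db : ∀ v, fderiv ℝ b x v = (fderiv ℝ ψ x v).im := fun v => by
      rw [loc eb x hx]
      have : HasFDerivAt (fun x => Complex.imCLM (ψ x)) _ x :=
        Complex.imCLM.hasFDerivAt.comp x hψ.hasFDerivAt
      rw [this.fderiv]
      simp
    have va := ea hx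
    have vb := eb hx
    have v₁ := e₁ hx
    have v₂ := e₂ hx
    simp only [Complex.reCLM_apply, Complex.imCLM_apply, ContinuousLinearMap.coe_fst',
      ContinuousLinearMap.coe_snd'] at va vb v₁ v₂
    simp only [SC.magSq, magDensity, re1, re2, im1, im2, dx, dy, da, db, va, vb, v₁, v₂,
      ← Complex.normSq_eq_norm_sq, Complex.normSq_apply]
    simp
    ring

theorem integrableOn_of_continuous {Ω : Set Plane} (hbd : Bornology.IsBounded Ω)
    {F : Plane → ℝ} (hF : Continuous F) : IntegrableOn F Ω :=
  (hF.continuousOn.integrableOn_compact hbd.isCompact_closure).mono_set subset_closure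

theorem continuous_magDensity {a b A₁ A₂ : Plane → ℝ} (ha : TestFun a) (hb : TestFun b)
    (hA₁ : Continuous A₁) (hA₂ : Continuous A₂) : Continuous (magDensity a b A₁ A₂) := by
  have h1 := ha.continuous
  have h2 := hb.continuous
  have h3 := ha.continuous_dx
  have h4 := hb.continuous_dx
  have h5 := ha.continuous_dy
  have h6 := hb.continuous_dy
  unfold magDensity re1 re2 im1 im2
  fun_prop

theorem normalUnique_of_certificate {Ω : Set Plane} (hΩ : IsOpen Ω)
    (hbd : Bornology.IsBounded Ω) {s c E κ H : ℝ} (hκ : 1 ≤ κ) (hsH : s ^ 2 = κ * H)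
    (hE : 0 ≤ E) (hc : κ ^ 2 * (1 + E) < c) {f : Plane → ℝ} (hf : ∀ x ∈ Ω, 0 ≤ f x ∧ f x ≤ 1)
    (cert : ∀ a b A₁ A₂ : Plane → ℝ, TestFun a → TestFun b → ContDiff ℝ 1 A₁ →
      ContDiff ℝ 1 A₂ → ∃ Φ : Plane → ℝ, IntegrableOn Φ Ω ∧ ∫ x in Ω, Φ x = 0 ∧ ∀ x ∈ Ω,
        c * (a x ^ 2 + b x ^ 2) + f x * (dx A₂ x - dy A₁ x - s ^ 2) * (a x ^ 2 + b x ^ 2) ≤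
          (1 + E) * magDensity a b A₁ A₂ x + Φ x) :
    NormalUnique Ω κ H := by
  have main : ∀ ψ A, GLadm Ω ψ A → (c - κ ^ 2 * (1 + E)) * (∫ x in Ω, ‖ψ x‖ ^ 2) ≤
      (1 + E) * GLenergy Ω κ H ψ A := by
    intro ψ A hadm
    obtain ⟨a, b, A₁, A₂, R⟩ := exists_representative hΩ hbd hadm
    obtain ⟨Φ, hΦ, hΦ0, hpt⟩ := cert a b (fun x => (κ * H) * A₁ x) (fun x => (κ * H) * A₂ x)
      R.ha R.hb (contDiff_const.mul R.hA₁.1) (contDiff_const.mul R.hA₂.1)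
    set e : Plane → ℝ := fun x =>
      magDensity a b (fun x => (κ * H) * A₁ x) (fun x => (κ * H) * A₂ x) x -
      κ ^ 2 * (a x ^ 2 + b x ^ 2) + κ ^ 2 / 2 * (a x ^ 2 + b x ^ 2) ^ 2 +
      κ ^ 2 * H ^ 2 * (dx A₂ x - dy A₁ x - 1) ^ 2 with he
    have he' : GLenergy Ω κ H ψ A = ∫ x in Ω, e x := by
      refine setIntegral_congr_fun hΩ.measurableSet fun x hx => ?_
      have h4 : ‖ψ x‖ ^ 4 = (a x ^ 2 + b x ^ 2) ^ 2 := by rw [← R.normSq x hx]; ring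
      simp only [he, R.magSq _ x hx, h4, R.normSq x hx, R.curl x hx]
    have hρ : ∫ x in Ω, ‖ψ x‖ ^ 2 = ∫ x in Ω, (a x ^ 2 + b x ^ 2) :=
      setIntegral_congr_fun hΩ.measurableSet R.normSq
    have ca := R.ha.continuous
    have cb := R.hb.continuous
    have cA₁ := R.hA₁.continuous
    have cA₂ := R.hA₂.continuous
    have cdA₁ := R.hA₁.continuous_dy
    have cdA₂ := R.hA₂.continuous_dx
    have ie : IntegrableOn e Ω := by
      have k₁ : Continuous (fun x => (κ * H) * A₁ x) := continuous_const.mul cA₁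
      have k₂ : Continuous (fun x => (κ * H) * A₂ x) := continuous_const.mul cA₂
      have := continuous_magDensity R.ha R.hb k₁ k₂
      exact integrableOn_of_continuous hbd (by fun_prop)
    have iρ : IntegrableOn (fun x => a x ^ 2 + b x ^ 2) Ω :=
      integrableOn_of_continuous hbd (by fun_prop)
    rw [he', hρ, ← integral_const_mul, ← integral_const_mul]
    calc ∫ x in Ω, (c - κ ^ 2 * (1 + E)) * (a x ^ 2 + b x ^ 2)
        ≤ ∫ x in Ω, ((1 + E) * e x + Φ x) := by
          refine setIntegral_mono_on (iρ.const_mul _) ((ie.const_mul _).add hΦ)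
            hΩ.measurableSet fun x hx => ?_
          have h1 := hpt x hx
          obtain ⟨h2, h3⟩ := hf x hx
          have e1 : dx (fun x => (κ * H) * A₂ x) x = (κ * H) * dx A₂ x := by
            rw [dx, dx, fderiv_const_mul (R.hA₂.differentiable x)]; simp
          have e2 : dy (fun x => (κ * H) * A₁ x) x = (κ * H) * dy A₁ x := by
            rw [dy, dy, fderiv_const_mul (R.hA₁.differentiable x)]; simp
          rw [e1, e2, hsH] at h1
          simp only [he]
          set ρ := a x ^ 2 + b x ^ 2
          set D := magDensity a b (fun x => (κ * H) * A₁ x) (fun x => (κ * H) * A₂ x) x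
          set β := dx A₂ x - dy A₁ x - 1 with hβ
          have h4 : κ * H * dx A₂ x - κ * H * dy A₁ x - κ * H = κ * H * β := by rw [hβ]; ring
          rw [h4] at h1
          have h5 : -(κ ^ 2 / 2 * ρ ^ 2 + κ ^ 2 * H ^ 2 * β ^ 2) ≤ f x * (κ * H * β) * ρ := by
            have h6 : f x ^ 2 ≤ 1 := by nlinarith
            have h7 : (f x * ρ) ^ 2 ≤ κ ^ 2 * ρ ^ 2 := by
              rw [mul_pow]
              have : f x ^ 2 ≤ κ ^ 2 := by nlinarith
              gcongr
            nlinarith [sq_nonneg (f x * ρ + κ * H * β), sq_nonneg (κ * H * β)]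
          have h8 : 0 ≤ E * (κ ^ 2 / 2 * ρ ^ 2 + κ ^ 2 * H ^ 2 * β ^ 2) := by positivity
          linarith
      _ = ∫ x in Ω, (1 + E) * e x := by
          refine (integral_add (ie.const_mul _) hΦ).trans ?_
          rw [hΦ0, add_zero]
  have h1E : 0 < 1 + E := by linarith
  have hpos : 0 < c - κ ^ 2 * (1 + E) := by linarith
  refine ⟨fun ψ A h => ?_, fun ψ A h h0 => ?_⟩
  · have h1 := main ψ A h
    have h2 : 0 ≤ ∫ x in Ω, ‖ψ x‖ ^ 2 := integral_nonneg fun x => by positivity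
    exact nonneg_of_mul_nonneg_right ((mul_nonneg hpos.le h2).trans h1) h1E
  · have h1 := main ψ A h
    have h2 : 0 ≤ ∫ x in Ω, ‖ψ x‖ ^ 2 := integral_nonneg fun x => by positivity
    have h3 : 0 < ∫ x in Ω, ‖ψ x‖ ^ 2 := lt_of_le_of_ne h2 (Ne.symm h0)
    exact pos_of_mul_pos_right ((mul_pos hpos h3).trans_le h1) h1E.le

/-- Normal coordinates `(s, t) ↦ γ(s) + t ν(s)` along a plane curve. -/
def tube (γ : ℝ → Plane) (p : ℝ × ℝ) : Plane := γ p.1 + p.2 • nuVec γ p.1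

namespace BoundaryParam

open scoped ContDiff

variable {Ω : Set Plane} (P : BoundaryParam Ω)

theorem contDiff_deriv : ContDiff ℝ ∞ (deriv P.γ) :=
  (contDiff_infty_iff_deriv.1 P.smooth).2

theorem contDiff_deriv_deriv : ContDiff ℝ ∞ (deriv (deriv P.γ)) :=
  (contDiff_infty_iff_deriv.1 P.contDiff_deriv).2

theorem contDiff_nuVec : ContDiff ℝ ∞ (nuVec P.γ) := by
  have h := P.contDiff_deriv
  unfold nuVec
  fun_prop

theorem contDiff_curvOf : ContDiff ℝ ∞ (curvOf P.γ) := by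
  have h := P.contDiff_deriv
  have h' := P.contDiff_deriv_deriv
  unfold curvOf dot2 nuVec
  fun_prop

theorem hasDerivAt (s : ℝ) : HasDerivAt P.γ (deriv P.γ s) s :=
  ((P.smooth.differentiable (by simp)) s).hasDerivAt

theorem hasDerivAt_deriv (s : ℝ) : HasDerivAt (deriv P.γ) (curvOf P.γ s • nuVec P.γ s) s := by
  have h := ((P.contDiff_deriv.differentiable (by simp)) s).hasDerivAt
  have h1 : HasDerivAt (fun s => (deriv P.γ s).1) _ s := h.fst
  have h2 : HasDerivAt (fun s => (deriv P.γ s).2) _ s := h.snd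
  have h3 := (h1.pow 2).add (h2.pow 2)
  have h4 : (fun s => (deriv P.γ s).1) ^ 2 + (fun s => (deriv P.γ s).2) ^ 2 = fun _ => 1 :=
    funext P.unit_speed
  rw [h4] at h3
  have h5 := h3.unique (hasDerivAt_const s 1)
  have h6 := P.unit_speed s
  simp only [esq] at h6
  refine h.congr_deriv ?_
  ext
  · simp [curvOf, dot2, nuVec]
    linear_combination -(deriv (deriv P.γ) s).1 * h6 + (deriv P.γ s).1 / 2 * h5
  · simp [curvOf, dot2, nuVec]
    linear_combination -(deriv (deriv P.γ) s).2 * h6 + (deriv P.γ s).2 / 2 * h5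

theorem hasDerivAt_nuVec (s : ℝ) :
    HasDerivAt (nuVec P.γ) (-(curvOf P.γ s • deriv P.γ s)) s := by
  have h := P.hasDerivAt_deriv s
  have h1 : HasDerivAt (fun s => (deriv P.γ s).1) _ s := h.fst
  have h2 : HasDerivAt (fun s => (deriv P.γ s).2) _ s := h.snd
  refine (h2.neg.prodMk h1).congr_deriv ?_
  ext <;> simp [nuVec]

theorem nuVec_sq (s : ℝ) : (nuVec P.γ s).1 ^ 2 + (nuVec P.γ s).2 ^ 2 = 1 := by
  rw [← P.unit_speed s]
  simp only [nuVec, esq]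
  ring

theorem periodic_deriv : Function.Periodic (deriv P.γ) P.L := fun s => by
  rw [← deriv_comp_add_const, show (fun x => P.γ (x + P.L)) = P.γ from funext P.periodic]

theorem periodic_deriv_deriv : Function.Periodic (deriv (deriv P.γ)) P.L := fun s => by
  rw [← deriv_comp_add_const, show (fun x => deriv P.γ (x + P.L)) = deriv P.γ from
    funext P.periodic_deriv]

theorem periodic_nuVec : Function.Periodic (nuVec P.γ) P.L := fun s => by
  simp only [nuVec, P.periodic_deriv s]

theorem periodic_curvOf : Function.Periodic (curvOf P.γ) P.L := fun s => by
  simp only [curvOf, P.periodic_deriv_deriv s, P.periodic_nuVec s]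

theorem exists_isMaxOn_curvOf : ∃ s₀, kmaxOf P.γ = curvOf P.γ s₀ ∧
    ∀ s, curvOf P.γ s ≤ kmaxOf P.γ := by
  have hc : IsCompact (range (curvOf P.γ)) := by
    rw [← P.periodic_curvOf.image_Icc P.L_pos 0]
    exact isCompact_Icc.image P.contDiff_curvOf.continuous
  obtain ⟨s₀, h⟩ := hc.sSup_mem (range_nonempty _)
  exact ⟨s₀, h.symm, fun s => le_csSup hc.bddAbove (mem_range_self s)⟩

theorem exists_curvOf_bound : ∃ M, 1 ≤ M ∧ ∀ s, |curvOf P.γ s| ≤ M := by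
  have hc : IsCompact (range (curvOf P.γ)) := by
    rw [← P.periodic_curvOf.image_Icc P.L_pos 0]
    exact isCompact_Icc.image P.contDiff_curvOf.continuous
  obtain ⟨M, hM⟩ := hc.isBounded.exists_norm_le
  exact ⟨max M 1, le_max_right _ _, fun s => (hM _ (mem_range_self s)).trans (le_max_left _ _)⟩

theorem contDiff_tube : ContDiff ℝ ∞ (tube P.γ) := by
  have h := P.contDiff_nuVec
  have h' := P.smooth
  unfold tube
  fun_prop

/-- The inverse of the differential of the normal coordinates. -/
def tubeInv (p : ℝ × ℝ) : Plane →L[ℝ] ℝ × ℝ :=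
  ((1 - p.2 * curvOf P.γ p.1)⁻¹ • dotL (deriv P.γ p.1)).prod (dotL (nuVec P.γ p.1))

/-- The differential of the normal coordinates. -/
def tubeDeriv (p : ℝ × ℝ) : ℝ × ℝ →L[ℝ] Plane :=
  ((1 - p.2 * curvOf P.γ p.1) • ContinuousLinearMap.fst ℝ ℝ ℝ).smulRight (deriv P.γ p.1) +
    (ContinuousLinearMap.snd ℝ ℝ ℝ).smulRight (nuVec P.γ p.1)

theorem tubeInv_tubeDeriv {p : ℝ × ℝ} (hp : 1 - p.2 * curvOf P.γ p.1 ≠ 0) (v : ℝ × ℝ) :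
    P.tubeInv p (P.tubeDeriv p v) = v := by
  have h := P.unit_speed p.1
  simp only [esq] at h
  ext
  · simp [tubeInv, tubeDeriv, nuVec]
    field_simp
    linear_combination (1 - p.2 * curvOf P.γ p.1) * v.1 * h
  · simp [tubeInv, tubeDeriv, nuVec]
    linear_combination v.2 * h

theorem tubeDeriv_tubeInv {p : ℝ × ℝ} (hp : 1 - p.2 * curvOf P.γ p.1 ≠ 0) (v : Plane) :
    P.tubeDeriv p (P.tubeInv p v) = v := by
  have h := P.unit_speed p.1
  simp only [esq] at h
  ext
  · simp [tubeInv, tubeDeriv, nuVec, mul_inv_cancel_left₀ hp]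
    linear_combination v.1 * h
  · simp [tubeInv, tubeDeriv, nuVec, mul_inv_cancel_left₀ hp]
    linear_combination v.2 * h

/-- The differential of the normal coordinates as an equivalence. -/
def tubeEquiv {p : ℝ × ℝ} (hp : 1 - p.2 * curvOf P.γ p.1 ≠ 0) : (ℝ × ℝ) ≃L[ℝ] Plane :=
  ContinuousLinearEquiv.equivOfInverse (P.tubeDeriv p) (P.tubeInv p)
    (P.tubeInv_tubeDeriv hp) (P.tubeDeriv_tubeInv hp)

theorem hasFDerivAt_tube (p : ℝ × ℝ) : HasFDerivAt (tube P.γ) (P.tubeDeriv p) p := by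
  have h0 : HasFDerivAt (fun p : ℝ × ℝ => p.1) (ContinuousLinearMap.fst ℝ ℝ ℝ) p :=
    hasFDerivAt_fst
  have h1 : HasFDerivAt (fun p : ℝ × ℝ => P.γ p.1) _ p :=
    (P.hasDerivAt p.1).hasFDerivAt.comp p h0
  have h2 : HasFDerivAt (fun p : ℝ × ℝ => nuVec P.γ p.1) _ p :=
    (P.hasDerivAt_nuVec p.1).hasFDerivAt.comp p h0
  have h3 : HasFDerivAt (fun p : ℝ × ℝ => p.2) (ContinuousLinearMap.snd ℝ ℝ ℝ) p :=
    hasFDerivAt_snd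
  refine (h1.add (h3.smul h2)).congr_fderiv ?_
  refine ContinuousLinearMap.ext fun v => ?_
  ext <;> simp [tubeDeriv] <;> ring

theorem exists_local_inverse {p : ℝ × ℝ} (hp : 1 - p.2 * curvOf P.γ p.1 ≠ 0) :
    ∃ σ : Plane → ℝ × ℝ, ContDiffAt ℝ ∞ σ (tube P.γ p) ∧ σ (tube P.γ p) = p ∧
      (∀ᶠ x in 𝓝 (tube P.γ p), tube P.γ (σ x) = x) ∧ (∀ᶠ q in 𝓝 p, σ (tube P.γ q) = q) ∧
      HasFDerivAt σ (P.tubeInv p) (tube P.γ p) := by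
  have h : HasFDerivAt (tube P.γ) (P.tubeEquiv hp : (ℝ × ℝ) →L[ℝ] Plane) p :=
    P.hasFDerivAt_tube p
  have hs := P.contDiff_tube.contDiffAt.hasStrictFDerivAt' h (by simp)
  exact ⟨_, P.contDiff_tube.contDiffAt.to_localInverse h (by simp), hs.localInverse_apply_image,
    hs.eventually_right_inverse, hs.eventually_left_inverse, hs.to_localInverse.hasFDerivAt⟩

end BoundaryParam

namespace BoundaryParam

variable {Ω : Set Plane} (P : BoundaryParam Ω)

theorem tube_add_int_mul (p : ℝ × ℝ) (n : ℤ) : tube P.γ (p.1 + n * P.L, p.2) = tube P.γ p := by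
  simp only [tube, P.periodic.int_mul n p.1, P.periodic_nuVec.int_mul n p.1]

theorem exists_eq_add_int_mul {s s' : ℝ} (h : P.γ s = P.γ s') : ∃ n : ℤ, s' = s + n * P.L := by
  have h1 : ∀ s, P.γ (toIcoMod P.L_pos 0 s) = P.γ s := fun s => by
    rw [toIcoMod, zsmul_eq_mul]
    exact P.periodic.sub_int_mul_eq _
  have hm : ∀ s, toIcoMod P.L_pos 0 s ∈ Ico 0 P.L := fun s => by
    simpa using toIcoMod_mem_Ico P.L_pos 0 s
  have h2 := P.injOn (hm s) (hm s') (by rw [h1, h1, h])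
  refine ⟨toIcoDiv P.L_pos 0 s' - toIcoDiv P.L_pos 0 s, ?_⟩
  rw [toIcoMod, toIcoMod, zsmul_eq_mul, zsmul_eq_mul] at h2
  push_cast
  linarith

theorem exists_tube_injective_aux : ∃ δ > 0, ∀ p q : ℝ × ℝ, p.1 ∈ Icc 0 P.L → q.1 ∈ Icc 0 P.L →
    |p.2| < δ → |q.2| < δ → tube P.γ p = tube P.γ q → ∃ n : ℤ, q = (p.1 + n * P.L, p.2) := by
  by_contra! hcon
  choose p q hp hq hp' hq' hpq hne using fun n : ℕ => hcon (1 / ((n : ℝ) + 1)) (by positivity)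
  have hcpt : IsCompact ((Icc (0 : ℝ) P.L) ×ˢ (Icc (0 : ℝ) P.L)) := isCompact_Icc.prod isCompact_Icc
  obtain ⟨⟨s, s'⟩, -, φ, hφ, hlim⟩ := hcpt.tendsto_subseq
    (x := fun n => ((p n).1, (q n).1)) (fun n => ⟨hp n, hq n⟩)
  have h0 : ∀ {f : ℕ → ℝ}, (∀ n, |f n| < 1 / ((n : ℝ) + 1)) → Tendsto (f ∘ φ) atTop (𝓝 0) :=
    fun hf => (squeeze_zero_norm (fun n => (hf n).le)
      tendsto_one_div_add_atTop_nhds_zero_nat).comp hφ.tendsto_atTop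
  have lp : Tendsto (p ∘ φ) atTop (𝓝 (s, 0)) := hlim.fst_nhds.prodMk_nhds (h0 hp')
  have lq : Tendsto (q ∘ φ) atTop (𝓝 (s', 0)) := hlim.snd_nhds.prodMk_nhds (h0 hq')
  have hc := P.contDiff_tube.continuous
  have heq : tube P.γ (s, 0) = tube P.γ (s', 0) :=
    tendsto_nhds_unique ((hc.tendsto _).comp lp)
      (((hc.tendsto _).comp lq).congr fun n => (hpq (φ n)).symm)
  obtain ⟨m, rfl⟩ := P.exists_eq_add_int_mul (by simpa [tube] using heq)
  obtain ⟨σ, -, -, -, hσ, -⟩ := P.exists_local_inverse (p := (s, 0)) (by simp)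
  have lq' : Tendsto (fun n => ((q (φ n)).1 + ((-m : ℤ) : ℝ) * P.L, (q (φ n)).2)) atTop
      (𝓝 (s, 0)) := by
    have := (lq.fst_nhds.add_const (((-m : ℤ) : ℝ) * P.L)).prodMk_nhds lq.snd_nhds
    simpa using this
  obtain ⟨n, hn, hn'⟩ := ((lp.eventually hσ).and (lq'.eventually hσ)).exists
  rw [P.tube_add_int_mul, ← hpq] at hn'
  have h3 := hn.symm.trans hn'
  refine hne (φ n) m ?_
  have e1 := congrArg Prod.fst h3
  have e2 := congrArg Prod.snd h3
  simp only [Function.comp] at e1 e2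
  push_cast at e1
  ext
  · simp [e1]
  · exact e2.symm

theorem exists_tube_injective : ∃ δ > 0, ∀ p q : ℝ × ℝ, |p.2| < δ → |q.2| < δ →
    tube P.γ p = tube P.γ q → ∃ n : ℤ, q = (p.1 + n * P.L, p.2) := by
  obtain ⟨δ, hδ, h⟩ := P.exists_tube_injective_aux
  refine ⟨δ, hδ, fun p q hp hq hpq => ?_⟩
  have key : ∀ p : ℝ × ℝ, ∃ n : ℤ, p.1 + n * P.L ∈ Icc 0 P.L := fun p => by
    refine ⟨-toIcoDiv P.L_pos 0 p.1, ?_⟩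
    have := toIcoMod_mem_Ico P.L_pos 0 p.1
    rw [toIcoMod, zsmul_eq_mul, zero_add] at this
    rw [Int.cast_neg, neg_mul, ← sub_eq_add_neg]
    exact Ico_subset_Icc_self this
  obtain ⟨i, hi⟩ := key p
  obtain ⟨j, hj⟩ := key q
  obtain ⟨n, hn⟩ := h (p.1 + i * P.L, p.2) (q.1 + j * P.L, q.2) hi hj hp hq
    (by rw [P.tube_add_int_mul, P.tube_add_int_mul, hpq])
  refine ⟨i + n - j, ?_⟩
  have e1 := congrArg Prod.fst hn
  have e2 := congrArg Prod.snd hn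
  simp only at e1 e2
  ext
  · push_cast
    linarith
  · exact e2

theorem isOpen_tube_image {S : Set (ℝ × ℝ)} (hS : IsOpen S)
    (h : ∀ p ∈ S, 1 - p.2 * curvOf P.γ p.1 ≠ 0) : IsOpen (tube P.γ '' S) := by
  rw [isOpen_iff_mem_nhds]
  rintro _ ⟨p, hp, rfl⟩
  have hd : HasFDerivAt (tube P.γ) (P.tubeEquiv (h p hp) : (ℝ × ℝ) →L[ℝ] Plane) p :=
    P.hasFDerivAt_tube p
  have hs := P.contDiff_tube.contDiffAt.hasStrictFDerivAt' hd (by simp)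
  rw [← hs.map_nhds_eq_of_equiv]
  exact image_mem_map (hS.mem_nhds hp)

theorem tube_zero_mem_frontier (s : ℝ) : tube P.γ (s, 0) ∈ frontier Ω := by
  rw [← P.range_eq]
  exact ⟨s, by simp [tube]⟩

/-- A width on which the normal coordinates are nondegenerate and injective modulo the period. -/
structure Tubular (δ M : ℝ) : Prop where
  δ_pos : 0 < δ
  one_le : 1 ≤ M
  mul_le : M * δ ≤ 1 / 2
  curv_le : ∀ s, |curvOf P.γ s| ≤ M
  inj : ∀ p q : ℝ × ℝ, |p.2| < δ → |q.2| < δ →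
    tube P.γ p = tube P.γ q → ∃ n : ℤ, q = (p.1 + n * P.L, p.2)

theorem exists_tubular : ∃ δ M, P.Tubular δ M := by
  obtain ⟨δ, hδ, h⟩ := P.exists_tube_injective
  obtain ⟨M, hM, hk⟩ := P.exists_curvOf_bound
  have hM0 : 0 < M := by linarith
  refine ⟨min δ (1 / (2 * M)), M, by positivity, hM, ?_, hk, fun p q hp hq => h p q
    (hp.trans_le (min_le_left _ _)) (hq.trans_le (min_le_left _ _))⟩
  calc M * min δ (1 / (2 * M)) ≤ M * (1 / (2 * M)) := by gcongr; exact min_le_right _ _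
    _ = 1 / 2 := by field_simp

theorem _root_.IsPreconnected.subset_of_disjoint_frontier {X : Type*} [TopologicalSpace X]
    {S U : Set X} (hS : IsPreconnected S) (hU : IsOpen U) (hd : Disjoint S (frontier U))
    (hne : (S ∩ U).Nonempty) : S ⊆ U := by
  refine hS.subset_left_of_subset_union hU isClosed_closure.isOpen_compl
    (disjoint_compl_right_iff_subset.2 subset_closure) (fun x hx => ?_) hne
  by_contra! hc
  simp only [mem_union, mem_compl_iff, not_or, not_not] at hc
  exact disjoint_left.1 hd hx ⟨hc.2, by rw [hU.interior_eq]; exact hc.1⟩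

theorem not_isClopen_of_isBounded {S : Set Plane} (hne : S.Nonempty)
    (hbd : Bornology.IsBounded S) : ¬ IsClopen S := fun h =>
  NormedSpace.unbounded_univ ℝ Plane (h.eq_univ hne ▸ hbd)

namespace Tubular

variable {P} {δ M : ℝ} (hT : P.Tubular δ M)
include hT

theorem half_le {p : ℝ × ℝ} (hp : |p.2| < δ) : 1 / 2 ≤ 1 - p.2 * curvOf P.γ p.1 := by
  have h1 := hT.curv_le p.1
  have h2 : |p.2 * curvOf P.γ p.1| ≤ δ * M := by
    rw [abs_mul]
    have := hT.δ_pos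
    gcongr
  have h3 := hT.mul_le
  have h4 := le_abs_self (p.2 * curvOf P.γ p.1)
  linarith

theorem ne_zero {p : ℝ × ℝ} (hp : |p.2| < δ) : 1 - p.2 * curvOf P.γ p.1 ≠ 0 := by
  have := hT.half_le hp
  linarith

theorem isOpen_image {U : Set ℝ} (hU : IsOpen U) (h : ∀ t ∈ U, |t| < δ) :
    IsOpen (tube P.γ '' (univ ×ˢ U)) :=
  P.isOpen_tube_image (isOpen_univ.prod hU) fun _ hp => hT.ne_zero (h _ hp.2)

theorem tube_notMem_frontier {p : ℝ × ℝ} (hp : |p.2| < δ) (h0 : p.2 ≠ 0) :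
    tube P.γ p ∉ frontier Ω := by
  rw [← P.range_eq]
  rintro ⟨s, hs⟩
  obtain ⟨n, hn⟩ := hT.inj (s, 0) p (by simpa using hT.δ_pos) hp (by simpa [tube] using hs)
  exact h0 (congrArg Prod.snd hn)

theorem disjoint_frontier {U : Set ℝ} (h : ∀ t ∈ U, |t| < δ) (h0 : (0 : ℝ) ∉ U) :
    Disjoint (tube P.γ '' (univ ×ˢ U)) (frontier Ω) := by
  rw [disjoint_left]
  rintro _ ⟨p, hp, rfl⟩
  exact hT.tube_notMem_frontier (h _ hp.2) fun h' => h0 (h' ▸ hp.2)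

theorem tube_mem (hΩ : IsOpen Ω) {p : ℝ × ℝ} (h0 : 0 < p.2) (hp : p.2 < δ) :
    tube P.γ p ∈ Ω := by
  obtain ⟨ε, hε, hin⟩ := P.inward p.1
  have hδ := hT.δ_pos
  have hc : IsPreconnected (tube P.γ '' (univ ×ˢ Ioo 0 δ)) :=
    (isPreconnected_univ.prod isPreconnected_Ioo).image _ P.contDiff_tube.continuous.continuousOn
  refine hc.subset_of_disjoint_frontier hΩ (hT.disjoint_frontier (fun t ht => ?_) (by simp)) ?_
    ⟨p, ⟨mem_univ _, h0, hp⟩, rfl⟩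
  · rw [abs_of_pos ht.1]
    exact ht.2
  · have hm : 0 < min ε δ := lt_min hε hδ
    have h1 : min ε δ / 2 < ε := by linarith [min_le_left ε δ]
    have h2 : min ε δ / 2 < δ := by linarith [min_le_right ε δ]
    exact ⟨_, ⟨(p.1, min ε δ / 2), ⟨mem_univ _, by positivity, h2⟩, rfl⟩,
      hin _ ⟨by positivity, h1⟩⟩

theorem tube_notMem (hΩ : IsOpen Ω) (hbd : Bornology.IsBounded Ω) {p : ℝ × ℝ} (h0 : p.2 ≤ 0)
    (hp : -δ < p.2) : tube P.γ p ∉ Ω := by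
  have hδ := hT.δ_pos
  rcases h0.eq_or_lt with h0 | h0
  · obtain ⟨s, t⟩ := p
    obtain rfl : t = 0 := h0
    exact fun h => (P.tube_zero_mem_frontier s).2 (by rwa [hΩ.interior_eq])
  intro hmem
  have hneg : ∀ t ∈ Ioo (-δ) (0 : ℝ), |t| < δ := fun t ht => by
    rw [abs_of_neg ht.2]
    linarith [ht.1]
  have hc : IsPreconnected (tube P.γ '' (univ ×ˢ Ioo (-δ) 0)) :=
    (isPreconnected_univ.prod isPreconnected_Ioo).image _ P.contDiff_tube.continuous.continuousOn
  have hsub := hc.subset_of_disjoint_frontier hΩ (hT.disjoint_frontier hneg (by simp))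
    ⟨_, ⟨p, ⟨mem_univ _, hp, h0⟩, rfl⟩, hmem⟩
  have hopen : IsOpen (tube P.γ '' (univ ×ˢ Ioo (-δ) δ)) :=
    hT.isOpen_image isOpen_Ioo fun t ht => abs_lt.2 ht
  have hcl : closure Ω = Ω ∪ tube P.γ '' (univ ×ˢ Ioo (-δ) δ) := by
    refine Subset.antisymm ?_ (union_subset subset_closure ?_)
    · rw [closure_eq_self_union_frontier, ← P.range_eq]
      refine union_subset_union_right _ ?_
      rintro _ ⟨s, rfl⟩
      exact ⟨(s, 0), ⟨mem_univ _, by simpa using hδ⟩, by simp [tube]⟩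
    · rintro _ ⟨⟨s, t⟩, ⟨-, ht⟩, rfl⟩
      rcases lt_trichotomy t 0 with h | h | h
      · exact subset_closure (hsub ⟨(s, t), ⟨mem_univ _, ht.1, h⟩, rfl⟩)
      · obtain rfl : t = 0 := h
        exact (P.tube_zero_mem_frontier s).1
      · exact subset_closure (hT.tube_mem hΩ h ht.2)
  exact not_isClopen_of_isBounded (S := closure Ω) ⟨_, subset_closure hmem⟩ hbd.closure
    ⟨isClosed_closure, hcl ▸ hΩ.union hopen⟩

end Tubular

theorem image_univ_prod (U : Set ℝ) :
    tube P.γ '' (univ ×ˢ U) = tube P.γ '' (Icc 0 P.L ×ˢ U) := by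
  refine Subset.antisymm ?_ (image_mono (prod_mono_left (subset_univ _)))
  rintro _ ⟨p, hp, rfl⟩
  refine ⟨(p.1 + (-toIcoDiv P.L_pos 0 p.1 : ℤ) * P.L, p.2), ⟨?_, hp.2⟩, P.tube_add_int_mul _ _⟩
  have := toIcoMod_mem_Ico P.L_pos 0 p.1
  rw [toIcoMod, zsmul_eq_mul, zero_add] at this
  rw [Int.cast_neg, neg_mul, ← sub_eq_add_neg]
  exact Ico_subset_Icc_self this

open Classical in
/-- Normal coordinates of a point at distance less than `δ` from the boundary. -/
def normalCoord (δ : ℝ) (x : Plane) : ℝ × ℝ :=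
  if h : ∃ p : ℝ × ℝ, (0 < p.2 ∧ p.2 < δ) ∧ tube P.γ p = x then h.choose else (0, δ)

/-- The distance to the boundary, truncated at `δ`. -/
def collarDist (δ : ℝ) (x : Plane) : ℝ := (P.normalCoord δ x).2

/-- The gradient of the distance to the boundary. -/
def collarNormal (δ : ℝ) (x : Plane) : Plane := nuVec P.γ (P.normalCoord δ x).1

namespace Tubular

variable {P} {δ M : ℝ} (hT : P.Tubular δ M)
include hT

theorem collar_tube {p : ℝ × ℝ} (h0 : 0 < p.2) (hp : p.2 < δ) :
    P.collarDist δ (tube P.γ p) = p.2 ∧ P.collarNormal δ (tube P.γ p) = nuVec P.γ p.1 := by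
  have h : ∃ q : ℝ × ℝ, (0 < q.2 ∧ q.2 < δ) ∧ tube P.γ q = tube P.γ p := ⟨p, ⟨h0, hp⟩, rfl⟩
  obtain ⟨h1, h2⟩ := h.choose_spec
  rw [collarDist, collarNormal, normalCoord, dif_pos h]
  obtain ⟨n, hn⟩ := hT.inj p _ (by rwa [abs_of_pos h0]) (by rw [abs_of_pos h1.1]; exact h1.2)
    h2.symm
  rw [hn]
  exact ⟨rfl, P.periodic_nuVec.int_mul n p.1⟩

theorem collarDist_mem (x : Plane) : 0 < P.collarDist δ x ∧ P.collarDist δ x ≤ δ := by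
  rw [collarDist, normalCoord]
  split_ifs with h
  · exact ⟨h.choose_spec.1.1, h.choose_spec.1.2.le⟩
  · exact ⟨hT.δ_pos, le_rfl⟩

omit hT in
theorem exists_of_lt {x : Plane} (h : P.collarDist δ x < δ) :
    ∃ p : ℝ × ℝ, (0 < p.2 ∧ p.2 < δ) ∧ tube P.γ p = x := by
  by_contra hc
  rw [collarDist, normalCoord, dif_neg hc] at h
  exact lt_irrefl _ h

theorem lt_iff {x : Plane} {c : ℝ} (hc : c ≤ δ) :
    P.collarDist δ x < c ↔ x ∈ tube P.γ '' (univ ×ˢ Ioo 0 c) := by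
  constructor
  · intro h
    obtain ⟨p, hp, rfl⟩ := exists_of_lt (h.trans_le hc)
    rw [(hT.collar_tube hp.1 hp.2).1] at h
    exact ⟨p, ⟨mem_univ _, hp.1, h⟩, rfl⟩
  · rintro ⟨p, ⟨-, hp⟩, rfl⟩
    rw [(hT.collar_tube hp.1 (hp.2.trans_le hc)).1]
    exact hp.2

theorem le_iff {x : Plane} {c : ℝ} (hc : c < δ) :
    P.collarDist δ x ≤ c ↔ x ∈ tube P.γ '' (univ ×ˢ Ioc 0 c) := by
  constructor
  · intro h
    obtain ⟨p, hp, rfl⟩ := exists_of_lt (h.trans_lt hc)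
    rw [(hT.collar_tube hp.1 hp.2).1] at h
    exact ⟨p, ⟨mem_univ _, hp.1, h⟩, rfl⟩
  · rintro ⟨p, ⟨-, hp⟩, rfl⟩
    rw [(hT.collar_tube hp.1 (hp.2.trans_lt hc)).1]
    exact hp.2

theorem isCompact_le (hΩ : IsOpen Ω) (hbd : Bornology.IsBounded Ω) {ε : ℝ} (hε : 0 < ε) :
    IsCompact {x | x ∈ Ω ∧ ε ≤ P.collarDist δ x} := by
  have hδ := hT.δ_pos
  rcases lt_or_ge δ ε with h | h
  · have hset : {x | x ∈ Ω ∧ ε ≤ P.collarDist δ x} = ∅ :=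
      eq_empty_of_forall_notMem fun x hx => hx.2.not_gt ((hT.collarDist_mem x).2.trans_lt h)
    rw [hset]
    exact isCompact_empty
  have hopen : IsOpen (tube P.γ '' (univ ×ˢ Ioo (-δ) ε)) :=
    hT.isOpen_image isOpen_Ioo fun t ht => abs_lt.2 ⟨ht.1, ht.2.trans_le h⟩
  suffices hset : {x | x ∈ Ω ∧ ε ≤ P.collarDist δ x} =
      closure Ω \ tube P.γ '' (univ ×ˢ Ioo (-δ) ε) from
    hset ▸ hbd.isCompact_closure.diff hopen
  ext x
  constructor
  · rintro ⟨hx, hxε⟩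
    refine ⟨subset_closure hx, ?_⟩
    rintro ⟨p, ⟨-, hp⟩, rfl⟩
    rcases le_or_gt p.2 0 with h0 | h0
    · exact hT.tube_notMem hΩ hbd h0 hp.1 hx
    · rw [(hT.collar_tube h0 (hp.2.trans_le h)).1] at hxε
      exact hxε.not_gt hp.2
  · rintro ⟨hx, hx'⟩
    have hxΩ : x ∈ Ω := by
      by_contra hn
      have : x ∈ frontier Ω := ⟨hx, by rwa [hΩ.interior_eq]⟩
      rw [← P.range_eq] at this
      obtain ⟨s, rfl⟩ := this
      exact hx' ⟨(s, 0), ⟨mem_univ _, by simpa using ⟨hδ, hε⟩⟩, by simp [tube]⟩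
    refine ⟨hxΩ, not_lt.1 fun hlt => hx' ?_⟩
    exact image_mono (prod_mono_right (Ioo_subset_Ioo_left (by linarith))) ((hT.lt_iff h).1 hlt)

theorem continuousOn_collarDist (hΩ : IsOpen Ω) (hbd : Bornology.IsBounded Ω) :
    ContinuousOn (P.collarDist δ) Ω := by
  have hδ := hT.δ_pos
  intro x hx
  refine ContinuousAt.continuousWithinAt (tendsto_order.2 ⟨fun c hc => ?_, fun c hc => ?_⟩)
  · rcases le_or_gt c 0 with h0 | h0
    · exact Eventually.of_forall fun y => h0.trans_lt (hT.collarDist_mem y).1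
    have hcδ := hc.trans_le (hT.collarDist_mem x).2
    have hcpt : IsCompact (tube P.γ '' (Icc 0 P.L ×ˢ Icc 0 c)) :=
      (isCompact_Icc.prod isCompact_Icc).image P.contDiff_tube.continuous
    rw [← P.image_univ_prod] at hcpt
    have hxn : x ∉ tube P.γ '' (univ ×ˢ Icc 0 c) := by
      rintro ⟨p, ⟨-, hp⟩, rfl⟩
      rcases hp.1.eq_or_lt with h1 | h1
      · exact hT.tube_notMem hΩ hbd h1.ge (by rw [← h1]; linarith) hx
      · rw [(hT.collar_tube h1 (hp.2.trans_lt hcδ)).1] at hc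
        exact hc.not_ge hp.2
    filter_upwards [hcpt.isClosed.isOpen_compl.mem_nhds hxn] with y hy
    refine not_le.1 fun h => hy ?_
    exact image_mono (prod_mono_right Ioc_subset_Icc_self) ((hT.le_iff hcδ).1 h)
  · rcases lt_or_ge δ c with h | h
    · exact Eventually.of_forall fun y => (hT.collarDist_mem y).2.trans_lt h
    have hopen : IsOpen (tube P.γ '' (univ ×ˢ Ioo 0 c)) :=
      hT.isOpen_image isOpen_Ioo fun t ht => by rw [abs_of_pos ht.1]; exact ht.2.trans_le h
    filter_upwards [hopen.mem_nhds ((hT.lt_iff h).1 hc)] with y hy using (hT.lt_iff h).2 hy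

theorem local_eq {p : ℝ × ℝ} (h0 : 0 < p.2) (hp : p.2 < δ) :
    ∃ σ : Plane → ℝ × ℝ, ContDiffAt ℝ 1 σ (tube P.γ p) ∧ σ (tube P.γ p) = p ∧
      HasFDerivAt σ (P.tubeInv p) (tube P.γ p) ∧
      (P.collarDist δ =ᶠ[𝓝 (tube P.γ p)] fun y => (σ y).2) ∧
      (P.collarNormal δ =ᶠ[𝓝 (tube P.γ p)] fun y => nuVec P.γ (σ y).1) := by
  have hne := hT.ne_zero (p := p) (by rwa [abs_of_pos h0])
  obtain ⟨σ, h1, h2, h3, -, h5⟩ := P.exists_local_inverse hne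
  have hc : Tendsto σ (𝓝 (tube P.γ p)) (𝓝 p) := by simpa [h2] using h1.continuousAt.tendsto
  have hmem : ∀ᶠ y in 𝓝 (tube P.γ p), (σ y).2 ∈ Ioo 0 δ :=
    hc.snd_nhds.eventually (isOpen_Ioo.mem_nhds ⟨h0, hp⟩)
  refine ⟨σ, h1.of_le (by simp), h2, h5, ?_, ?_⟩
  · filter_upwards [h3, hmem] with y hy hy'
    conv_lhs => rw [← hy]
    exact (hT.collar_tube hy'.1 hy'.2).1
  · filter_upwards [h3, hmem] with y hy hy'
    conv_lhs => rw [← hy]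
    exact (hT.collar_tube hy'.1 hy'.2).2

theorem hasFDerivAt_collarNormal {p : ℝ × ℝ} (h0 : 0 < p.2) (hp : p.2 < δ) :
    HasFDerivAt (P.collarNormal δ)
      ((-(curvOf P.γ p.1 * (1 - p.2 * curvOf P.γ p.1)⁻¹)) •
        (dotL (deriv P.γ p.1)).smulRight (deriv P.γ p.1)) (tube P.γ p) := by
  obtain ⟨σ, -, h2, h3, -, h5⟩ := hT.local_eq h0 hp
  have h4 : HasDerivAt (nuVec P.γ) (-(curvOf P.γ p.1 • deriv P.γ p.1)) (σ (tube P.γ p)).1 := by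
    rw [h2]
    exact P.hasDerivAt_nuVec p.1
  have h6 : HasFDerivAt (fun y => (σ y).1) _ (tube P.γ p) := h3.fst
  have h7 := h4.hasFDerivAt.comp (tube P.γ p) h6
  refine (h7.congr_of_eventuallyEq h5).congr_fderiv ?_
  refine ContinuousLinearMap.ext fun v => ?_
  ext <;> simp [tubeInv] <;> ring

theorem collar (hΩ : IsOpen Ω) (hbd : Bornology.IsBounded Ω) :
    Collar Ω (kmaxOf P.γ) δ (2 * M) (P.collarDist δ) (P.collarNormal δ) where
  isOpen := hΩ
  δ_pos := hT.δ_pos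
  K_le := by
    obtain ⟨s, hs, -⟩ := P.exists_isMaxOn_curvOf
    rw [hs]
    have := hT.mul_le
    have h1 := mul_le_mul_of_nonneg_right (hT.curv_le s) hT.δ_pos.le
    linarith
  pos x _ := (hT.collarDist_mem x).1
  cont := hT.continuousOn_collarDist hΩ hbd
  compact ε hε := hT.isCompact_le hΩ hbd hε
  grad x _ hxδ := by
    obtain ⟨p, ⟨h0, hp⟩, rfl⟩ := exists_of_lt hxδ
    obtain ⟨σ, -, -, h3, h4, -⟩ := hT.local_eq h0 hp
    rw [(hT.collar_tube h0 hp).2]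
    have h5 : HasFDerivAt (fun y => (σ y).2) _ (tube P.γ p) := h3.snd
    refine (h5.congr_of_eventuallyEq h4).congr_fderiv ?_
    refine ContinuousLinearMap.ext fun v => ?_
    simp [tubeInv]
  unit x _ hxδ := by
    obtain ⟨p, ⟨h0, hp⟩, rfl⟩ := exists_of_lt hxδ
    rw [(hT.collar_tube h0 hp).2]
    exact P.nuVec_sq _
  smooth x _ hxδ := by
    obtain ⟨p, ⟨h0, hp⟩, rfl⟩ := exists_of_lt hxδ
    obtain ⟨σ, h1, -, -, -, h5⟩ := hT.local_eq h0 hp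
    refine ContDiffAt.congr_of_eventuallyEq ?_ h5
    exact (P.contDiff_nuVec.of_le (by simp)).contDiffAt.comp _ h1.fst
  grad_le x _ hxδ v hv := by
    obtain ⟨p, ⟨h0, hp⟩, rfl⟩ := exists_of_lt hxδ
    have h := hT.hasFDerivAt_collarNormal h0 hp
    have h1 : HasFDerivAt (fun y => (P.collarNormal δ y).1) _ (tube P.γ p) := h.fst
    have h2 : HasFDerivAt (fun y => (P.collarNormal δ y).2) _ (tube P.γ p) := h.snd
    have hu := P.unit_speed p.1
    have ha := hT.half_le (p := p) (by rwa [abs_of_pos h0])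
    have hb := hT.curv_le p.1
    set k := curvOf P.γ p.1
    have hk : |k * (1 - p.2 * k)⁻¹| ≤ 2 * M := by
      rw [abs_mul, abs_inv, abs_of_pos (by linarith : 0 < 1 - p.2 * k), ← div_eq_mul_inv,
        div_le_iff₀ (by linarith)]
      nlinarith [hT.one_le]
    have key : ∀ i j : ℝ, i ^ 2 ≤ 1 → j ^ 2 ≤ 1 →
        |-(k * (1 - p.2 * k)⁻¹) * (i * j)| ≤ 2 * M := fun i j hi hj => by
      rw [abs_mul, abs_neg]
      have h3 : |i * j| ≤ 1 := by
        rw [abs_le]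
        constructor <;> nlinarith [sq_nonneg (i + j), sq_nonneg (i - j)]
      calc _ ≤ (2 * M) * 1 := mul_le_mul hk h3 (abs_nonneg _) (by linarith [hT.one_le])
        _ = 2 * M := mul_one _
    simp only [esq] at hu
    have hi : (deriv P.γ p.1).1 ^ 2 ≤ 1 := by nlinarith
    have hj : (deriv P.γ p.1).2 ^ 2 ≤ 1 := by nlinarith
    rw [h1.fderiv, h2.fderiv]
    rcases hv with rfl | rfl
    · exact ⟨by simpa using key _ _ hi hi, by simpa using key _ _ hi hj⟩
    · exact ⟨by simpa using key _ _ hj hi, by simpa using key _ _ hj hj⟩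
  laplacian x _ hxδ := by
    obtain ⟨p, ⟨h0, hp⟩, rfl⟩ := exists_of_lt hxδ
    have h := hT.hasFDerivAt_collarNormal h0 hp
    have h1 : HasFDerivAt (fun y => (P.collarNormal δ y).1) _ (tube P.γ p) := h.fst
    have h2 : HasFDerivAt (fun y => (P.collarNormal δ y).2) _ (tube P.γ p) := h.snd
    have hu := P.unit_speed p.1
    obtain ⟨s, hs, hmax⟩ := P.exists_isMaxOn_curvOf
    have ha := hT.half_le (p := p) (by rwa [abs_of_pos h0])
    have hb := hT.half_le (p := (s, p.2)) (by rwa [abs_of_pos h0])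
    have hk := hmax p.1
    simp only [esq] at hu
    simp only [← hs] at hb
    rw [(hT.collar_tube h0 hp).1, dx, dy, h1.fderiv, h2.fderiv]
    set k := curvOf P.γ p.1
    set K := kmaxOf P.γ
    have e : ∀ i j : ℝ, i ^ 2 + j ^ 2 = 1 → -(k * (1 - p.2 * k)⁻¹) * (i * i) +
        -(k * (1 - p.2 * k)⁻¹) * (j * j) = -k / (1 - p.2 * k) := fun i j hij => by
      rw [div_eq_mul_inv]
      linear_combination -(k * (1 - p.2 * k)⁻¹) * hij
    have e' := e _ _ hu
    suffices -K / (1 - K * p.2) ≤ -k / (1 - p.2 * k) by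
      rw [← e'] at this
      simpa using this
    rw [div_le_div_iff₀ (by linarith) (by linarith)]
    nlinarith

end Tubular

end BoundaryParam

namespace BoundaryProfile

variable {ξ Θ C₁ M : ℝ} {u q h r : ℝ → ℝ} (P : BoundaryProfile ξ Θ C₁ M u q h r)

/-- A cut-off at the fixed scale `δ`, with derivative `η'`. -/
structure _root_.SC.Cutoff (δ N : ℝ) (η η' : ℝ → ℝ) : Prop where
  deriv : ∀ t, HasDerivAt η (η' t) t
  cont : Continuous η'
  nonneg : ∀ t, 0 ≤ η t
  le_one : ∀ t, η t ≤ 1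
  one : ∀ t, |t| ≤ δ / 4 → η t = 1
  zero : ∀ t, δ / 2 ≤ |t| → η t = 0
  deriv_le : ∀ t, |η' t| ≤ N

/-- The boundary layer `η(t) u(bt)`, extended to negative `t` by `u(0)`. -/
def layer (u η : ℝ → ℝ) (b t : ℝ) : ℝ := η t * u (max (b * t) 0)

/-- The derivative of `layer`. -/
def layerDeriv (u q η η' : ℝ → ℝ) (b t : ℝ) : ℝ :=
  η' t * u (max (b * t) 0) - b * (η t * (q (max (b * t) 0) * u (max (b * t) 0)))

include P in
theorem q_zero : q 0 = 0 := le_antisymm (P.q_le 0 le_rfl) (P.q_nonneg 0 le_rfl)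

include P in
theorem r_zero : r 0 = 0 := by
  have := P.r_small 0 le_rfl
  rw [mul_zero] at this
  exact abs_nonpos_iff.1 this

theorem _root_.ContinuousOn.comp_max_zero {f : ℝ → ℝ} (hf : ContinuousOn f (Ici 0)) :
    Continuous fun τ => f (max τ 0) :=
  hf.comp_continuous (by fun_prop) fun τ => le_max_right τ 0

include P in
theorem hasDerivAt_max (τ : ℝ) :
    HasDerivAt (fun τ => u (max τ 0)) (-(q (max τ 0) * u (max τ 0))) τ := by
  have hu := P.cu.comp_max_zero
  have hq := P.cq.comp_max_zero
  have key : ∀ y, y ≠ 0 → HasDerivAt (fun τ => u (max τ 0)) (-(q (max y 0) * u (max y 0))) y := by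
    intro y hy
    rcases lt_or_gt_of_ne hy with h | h
    · rw [max_eq_right h.le, P.q_zero, zero_mul, neg_zero]
      refine (hasDerivAt_const y (u 0)).congr_of_eventuallyEq ?_
      filter_upwards [Iio_mem_nhds h] with z hz
      rw [max_eq_right (le_of_lt hz)]
    · rw [max_eq_left h.le]
      refine (P.du y h).congr_of_eventuallyEq ?_
      filter_upwards [Ioi_mem_nhds h] with z hz
      rw [max_eq_left (le_of_lt hz)]
  rcases eq_or_ne τ 0 with rfl | h0
  · exact hasDerivAt_of_hasDerivAt_of_ne key hu.continuousAt (hq.mul hu).neg.continuousAt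
  · exact key τ h0

include P in
theorem hasDerivAt_layer {δ N : ℝ} {η η' : ℝ → ℝ} (hη : Cutoff δ N η η') (b t : ℝ) :
    HasDerivAt (layer u η b) (layerDeriv u q η η' b t) t := by
  have h1 : HasDerivAt (fun t : ℝ => b * t) b t := by
    simpa using (hasDerivAt_id t).const_mul b
  have h2 := (P.hasDerivAt_max (b * t)).comp t h1
  refine ((hη.deriv t).mul h2).congr_deriv ?_
  simp only [layerDeriv, Function.comp]
  ring

include P in
theorem continuous_layer {δ N : ℝ} {η η' : ℝ → ℝ} (hη : Cutoff δ N η η') (b : ℝ) :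
    Continuous (layer u η b) :=
  continuous_iff_continuousAt.2 fun t => (P.hasDerivAt_layer hη b t).continuousAt

include P in
theorem continuous_layerDeriv {δ N : ℝ} {η η' : ℝ → ℝ} (hη : Cutoff δ N η η') (b : ℝ) :
    Continuous (layerDeriv u q η η' b) := by
  have hu := P.cu.comp_max_zero
  have hq := P.cq.comp_max_zero
  have h0 : Continuous η := continuous_iff_continuousAt.2 fun t => (hη.deriv t).continuousAt
  have h1 : Continuous fun t => u (max (b * t) 0) := hu.comp (continuous_const_mul b)
  have h2 : Continuous fun t => q (max (b * t) 0) := hq.comp (continuous_const_mul b)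
  have h3 := hη.cont
  exact (h3.mul h1).sub (continuous_const.mul (h0.mul (h2.mul h1)))

include P in
theorem sq_decay {τ : ℝ} (hτ : 0 ≤ τ) :
    (1 + τ) ^ 4 * u τ ^ 2 ≤ 24 * M * Real.exp 5 * Real.exp (-τ) := by
  have h1 : (1 + τ) ^ 4 ≤ 24 * Real.exp (1 + τ) := by
    have := Real.pow_div_factorial_le_exp (1 + τ) (by linarith) 4
    norm_num [Nat.factorial] at this
    linarith
  have h2 := P.u_decay τ hτ
  have hM := P.one_le
  have h3 : Real.exp (1 + τ) * Real.exp (-(τ + ξ) ^ 2) ≤ Real.exp 5 * Real.exp (-τ) := by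
    rw [← Real.exp_add, ← Real.exp_add]
    apply Real.exp_le_exp.2
    nlinarith [sq_nonneg (τ - 2), P.lb, P.neg, sq_nonneg ξ]
  calc (1 + τ) ^ 4 * u τ ^ 2 ≤ 24 * Real.exp (1 + τ) * (M * Real.exp (-(τ + ξ) ^ 2)) :=
        mul_le_mul h1 h2 (sq_nonneg _) (by positivity)
    _ = 24 * M * (Real.exp (1 + τ) * Real.exp (-(τ + ξ) ^ 2)) := by ring
    _ ≤ 24 * M * (Real.exp 5 * Real.exp (-τ)) := by gcongr
    _ = _ := by ring

/-- The rescaled shifted potential `(τ + ξ - eτ²/2) / (1 - eτ)`. -/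
def shiftedPotential (ξ e τ : ℝ) : ℝ := (τ + ξ - e * τ ^ 2 / 2) / (1 - e * τ)

/-- The approximate logarithmic derivative of the curved half-line ground state. -/
def curvedLogDer (ξ : ℝ) (q h r : ℝ → ℝ) (e τ : ℝ) : ℝ :=
  q τ + h τ * (shiftedPotential ξ e τ - (τ + ξ)) + e * r τ

theorem hasDerivAt_shiftedPotential {e τ : ℝ} (ha : 1 - e * τ ≠ 0) :
    HasDerivAt (shiftedPotential ξ e) (1 + e / (1 - e * τ) * shiftedPotential ξ e τ) τ := by
  have h1 : HasDerivAt (fun τ : ℝ => τ + ξ - e * τ ^ 2 / 2) (1 - e * τ) τ := by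
    have := ((hasDerivAt_id τ).add_const ξ).sub
      ((((hasDerivAt_id τ).pow 2).const_mul e).div_const 2)
    refine this.congr_deriv ?_
    simp
    ring
  have h2 : HasDerivAt (fun τ : ℝ => 1 - e * τ) (-e) τ := by
    have := ((hasDerivAt_id τ).const_mul e).const_sub 1
    exact this.congr_deriv (by simp)
  refine (h1.div h2 ha).congr_deriv ?_
  simp only [shiftedPotential]
  field_simp
  ring

/-- The defect of `curvedLogDer` in the Riccati equation. -/
def riccatiDefect (ξ : ℝ) (q h r : ℝ → ℝ) (e τ : ℝ) : ℝ :=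
  (1 - h τ ^ 2) * (shiftedPotential ξ e τ - (τ + ξ)) ^ 2
    - 2 * e * r τ * h τ * (shiftedPotential ξ e τ - (τ + ξ)) - e ^ 2 * r τ ^ 2
    - (e / (1 - e * τ) - e) * (q τ - h τ * (τ + ξ)) - e ^ 2 * r τ / (1 - e * τ)

include P in
theorem hasDerivAt_curvedLogDer {e τ : ℝ} (hτ : 0 < τ) (ha : 1 - e * τ ≠ 0) :
    HasDerivAt (curvedLogDer ξ q h r e)
      (riccatiDefect ξ q h r e τ - shiftedPotential ξ e τ ^ 2 + (Θ - e * C₁)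
        + curvedLogDer ξ q h r e τ ^ 2 + e / (1 - e * τ) * curvedLogDer ξ q h r e τ) τ := by
  have h1 := hasDerivAt_shiftedPotential (ξ := ξ) ha
  have h2 := ((P.dq τ hτ).add ((P.dh τ hτ).mul (h1.sub ((hasDerivAt_id τ).add_const ξ)))).add
    ((P.dr τ hτ).const_mul e)
  refine h2.congr_deriv ?_
  have h3 := P.rel τ
  simp only [curvedLogDer, riccatiDefect, id, Pi.sub_apply]
  generalize shiftedPotential ξ e τ = W
  rw [mul_div_assoc, div_eq_mul_inv, div_eq_mul_inv]
  generalize (1 - e * τ)⁻¹ = i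
  linear_combination h3

include P in
theorem abs_shift_le {e ε τ : ℝ} (hτ : 0 ≤ τ) (he : |e| ≤ ε) (ha : 1 / 2 ≤ 1 - e * τ) :
    |shiftedPotential ξ e τ - (τ + ξ)| ≤ 2 * ε * (1 + τ) ^ 2 := by
  have h1 : shiftedPotential ξ e τ - (τ + ξ) = e * (τ * (τ / 2 + ξ)) / (1 - e * τ) := by
    have : 1 - e * τ ≠ 0 := by linarith
    rw [shiftedPotential, eq_div_iff this, sub_mul, div_mul_cancel₀ _ this]
    ring
  have h2 : |τ * (τ / 2 + ξ)| ≤ (1 + τ) ^ 2 := by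
    rw [abs_le]
    constructor <;> nlinarith [P.lb, P.neg]
  have h3 : 0 ≤ ε := (abs_nonneg e).trans he
  rw [h1, abs_div, abs_mul, abs_of_pos (show 0 < 1 - e * τ by linarith), div_le_iff₀ (by linarith)]
  calc |e| * |τ * (τ / 2 + ξ)| ≤ ε * (1 + τ) ^ 2 := mul_le_mul he h2 (abs_nonneg _) h3
    _ ≤ _ := by nlinarith [mul_nonneg h3 (sq_nonneg (1 + τ))]

include P in
theorem riccatiDefect_le {e ε τ : ℝ} (hτ : 0 ≤ τ) (he : |e| ≤ ε) (ha : 1 / 2 ≤ 1 - e * τ) :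
    riccatiDefect ξ q h r e τ ≤ 10 * M * ε ^ 2 * (1 + τ) ^ 4 := by
  have hX := P.abs_shift_le hτ he ha
  have hε : 0 ≤ ε := (abs_nonneg e).trans he
  have hr : |r τ| ≤ M := (P.sq_r_le hτ).2.2
  have hM := P.one_le
  have h0 := P.h_nonneg τ hτ
  have h1 := P.h_le τ hτ
  have he2 : e ^ 2 ≤ ε ^ 2 := sq_le_sq' (by linarith [(abs_le.1 he).1]) (abs_le.1 he).2
  have hp : 1 ≤ (1 + τ) ^ 4 := one_le_pow₀ (by linarith)
  have hp2 : (1 + τ) ^ 2 ≤ (1 + τ) ^ 4 := pow_le_pow_right₀ (by linarith) (by norm_num)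
  rw [riccatiDefect]
  set X := shiftedPotential ξ e τ - (τ + ξ)
  have t1 : (1 - h τ ^ 2) * X ^ 2 ≤ 4 * ε ^ 2 * (1 + τ) ^ 4 := by
    have : X ^ 2 ≤ (2 * ε * (1 + τ) ^ 2) ^ 2 :=
      sq_le_sq' (by linarith [(abs_le.1 hX).1]) (abs_le.1 hX).2
    nlinarith [mul_nonneg (sq_nonneg (h τ)) (sq_nonneg X)]
  have t2 : -(2 * e * r τ * h τ * X) ≤ 4 * M * ε ^ 2 * (1 + τ) ^ 4 := by
    calc -(2 * e * r τ * h τ * X) ≤ |2 * e * r τ * h τ * X| := neg_le_abs _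
      _ = 2 * (|e| * |r τ| * h τ * |X|) := by
        rw [abs_mul, abs_mul, abs_mul, abs_mul, abs_of_nonneg h0, abs_two]; ring
      _ ≤ 2 * (ε * M * 1 * (2 * ε * (1 + τ) ^ 2)) := by gcongr
      _ = 4 * M * ε ^ 2 * (1 + τ) ^ 2 := by ring
      _ ≤ _ := by gcongr
  have t3 : 0 ≤ (e / (1 - e * τ) - e) * (q τ - h τ * (τ + ξ)) := by
    refine mul_nonneg ?_ (P.g_nonneg τ hτ)
    have : e / (1 - e * τ) - e = e ^ 2 * τ / (1 - e * τ) := by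
      have : 1 - e * τ ≠ 0 := by linarith
      field_simp
      ring
    rw [this]
    have : 0 < 1 - e * τ := by linarith
    positivity
  have t4 : -(e ^ 2 * r τ / (1 - e * τ)) ≤ 2 * M * ε ^ 2 * (1 + τ) ^ 4 := by
    rw [← neg_div, div_le_iff₀ (by linarith)]
    have : -(e ^ 2 * r τ) ≤ ε ^ 2 * M := by
      calc -(e ^ 2 * r τ) ≤ |e ^ 2 * r τ| := neg_le_abs _
        _ = e ^ 2 * |r τ| := by rw [abs_mul, abs_of_nonneg (sq_nonneg e)]
        _ ≤ ε ^ 2 * M := by gcongr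
    have h5 : M * ε ^ 2 ≤ M * ε ^ 2 * (1 + τ) ^ 4 := le_mul_of_one_le_right (by positivity) hp
    have h6 : 0 ≤ (1 - e * τ - 1 / 2) * (M * ε ^ 2 * (1 + τ) ^ 4) :=
      mul_nonneg (by linarith) (by positivity)
    linarith
  have t5 : 0 ≤ e ^ 2 * r τ ^ 2 := by positivity
  have t6 : 4 * ε ^ 2 * (1 + τ) ^ 4 ≤ 4 * M * ε ^ 2 * (1 + τ) ^ 4 := by
    have : 0 ≤ 4 * ε ^ 2 * (1 + τ) ^ 4 := by positivity
    nlinarith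
  linarith

/-- The reduced energy density of the layer with curvature `k`, minus its leading order. -/
def layerDensity (ξ Θ C₁ : ℝ) (u q η η' : ℝ → ℝ) (b k t : ℝ) : ℝ :=
  (1 - t * k) * layerDeriv u q η η' b t ^ 2
    + b ^ 2 * (ξ + b * t - k * b * t ^ 2 / 2) ^ 2 / (1 - t * k) * layer u η b t ^ 2
    - (Θ * b ^ 2 - C₁ * k * b) * ((1 - t * k) * layer u η b t ^ 2)

/-- The remainder left after completing the square in `layerDensity`. -/
def layerRemainder (ξ : ℝ) (u q h r η η' : ℝ → ℝ) (b k t : ℝ) : ℝ :=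
  (1 - t * k) * (layerDeriv u q η η' b t
      + b * curvedLogDer ξ q h r (k / b) (b * t) * layer u η b t) ^ 2
    + b ^ 2 * (1 - t * k) * riccatiDefect ξ q h r (k / b) (b * t) * layer u η b t ^ 2

include P in
theorem hasDerivAt_layer_flux {δ N : ℝ} {η η' : ℝ → ℝ} (hη : Cutoff δ N η η') {b k t : ℝ}
    (hb : 0 < b) (ht : 0 < t) (ha : 1 - t * k ≠ 0) :
    HasDerivAt
      (fun t => b * (1 - t * k) * curvedLogDer ξ q h r (k / b) (b * t) * layer u η b t ^ 2)
      (layerRemainder ξ u q h r η η' b k t - layerDensity ξ Θ C₁ u q η η' b k t) t := by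
  have ha' : 1 - k / b * (b * t) = 1 - t * k := by field_simp
  have hG := P.hasDerivAt_curvedLogDer (e := k / b) (τ := b * t) (by positivity) (by rwa [ha'])
  have h1 : HasDerivAt (fun t : ℝ => b * t) b t := by
    simpa using (hasDerivAt_id t).const_mul b
  have h2 := hG.comp t h1
  have h3 : HasDerivAt (fun t : ℝ => b * (1 - t * k)) (b * (-k)) t := by
    have := (((hasDerivAt_id t).mul_const k).const_sub 1).const_mul b
    exact this.congr_deriv (by simp)
  have h4 := (P.hasDerivAt_layer hη b t).pow 2
  refine ((h3.mul h2).mul h4).congr_deriv ?_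
  simp only [Function.comp, layerRemainder, layerDensity, Pi.mul_apply, Pi.pow_apply]
  rw [ha']
  have hW : shiftedPotential ξ (k / b) (b * t) = (ξ + b * t - k * b * t ^ 2 / 2) / (1 - t * k) := by
    rw [shiftedPotential, ha']
    congr 1
    field_simp
    ring
  rw [hW]
  generalize curvedLogDer ξ q h r (k / b) (b * t) = G
  generalize riccatiDefect ξ q h r (k / b) (b * t) = Q
  generalize layer u η b t = f
  generalize layerDeriv u q η η' b t = f'
  have ha2 : 1 - k * t ≠ 0 := by rwa [mul_comm]
  field_simp
  ring

set_option maxHeartbeats 400000 in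
include P in
theorem exists_layerRemainder_le {δ N K : ℝ} {η η' : ℝ → ℝ} (hη : Cutoff δ N η η')
    (hK : 0 ≤ K) (hKδ : K * δ ≤ 1 / 2) :
    ∃ C, 0 ≤ C ∧ ∀ b, 1 ≤ b → ∀ k, |k| ≤ K → ∀ t, 0 ≤ t → t ≤ δ →
      layerRemainder ξ u q h r η η' b k t ≤ C * Real.exp (-(b * t)) := by
  set A : ℝ := (2 * (2 * N ^ 2 + 2 * (2 * K + K * M) ^ 2) + 2 * (10 * M * K ^ 2)) with hA
  have hM := P.one_le
  refine ⟨A * (24 * M * Real.exp 5), by positivity, fun b hb k hk t ht htδ => ?_⟩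
  have hb0 : 0 < b := by linarith
  have htk : |t * k| ≤ 1 / 2 := by
    rw [abs_mul, abs_of_nonneg ht]
    calc t * |k| ≤ δ * K := mul_le_mul htδ hk (abs_nonneg _) (ht.trans htδ)
      _ ≤ 1 / 2 := by linarith
  obtain ⟨h5, h6⟩ := abs_le.1 htk
  have ha' : 1 - k / b * (b * t) = 1 - t * k := by field_simp
  set τ := b * t with hτdef
  have hτ : 0 ≤ τ := by positivity
  have he : |k / b| ≤ K / b := by
    rw [abs_div, abs_of_pos hb0]
    gcongr
  have hR := P.riccatiDefect_le hτ he (by rw [ha']; linarith)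
  have hX := P.abs_shift_le hτ he (by rw [ha']; linarith)
  have hr : |r τ| ≤ M := (P.sq_r_le hτ).2.2
  have h0 := P.h_nonneg τ hτ
  have h1 := P.h_le τ hτ
  have hp2 : 1 ≤ (1 + τ) ^ 2 := one_le_pow₀ (by linarith)
  have hp : 1 ≤ (1 + τ) ^ 4 := one_le_pow₀ (by linarith)
  set Y := h τ * (shiftedPotential ξ (k / b) τ - (τ + ξ)) + k / b * r τ with hY
  have hYle : |b * Y| ≤ (2 * K + K * M) * (1 + τ) ^ 2 := by
    calc |b * Y| = b * |Y| := by rw [abs_mul, abs_of_pos hb0]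
      _ ≤ b * (1 * (2 * (K / b) * (1 + τ) ^ 2) + K / b * M) := by
        gcongr
        refine (abs_add_le _ _).trans ?_
        rw [abs_mul, abs_mul, abs_of_nonneg h0]
        gcongr
      _ = 2 * K * (1 + τ) ^ 2 + K * M := by field_simp
      _ ≤ _ := by nlinarith [mul_nonneg hK (show 0 ≤ M by linarith)]
  have hη0 := hη.nonneg t
  have hη1 := hη.le_one t
  have hN := hη.deriv_le t
  have hN0 : 0 ≤ N := (abs_nonneg _).trans hN
  have hU : layer u η b t = η t * u τ := by rw [layer, max_eq_left hτ]
  have hU' : layerDeriv u q η η' b t + b * curvedLogDer ξ q h r (k / b) τ * layer u η b t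
      = (η' t + b * Y * η t) * u τ := by
    rw [hU, layerDeriv, max_eq_left hτ, curvedLogDer, hY]
    ring
  rw [layerRemainder, hU', hU]
  have h7 : (η' t + b * Y * η t) ^ 2 ≤ (2 * N ^ 2 + 2 * (2 * K + K * M) ^ 2) * (1 + τ) ^ 4 := by
    have e1 : η' t ^ 2 ≤ N ^ 2 := sq_le_sq' (by linarith [(abs_le.1 hN).1]) (abs_le.1 hN).2
    have e2 : (b * Y) ^ 2 ≤ ((2 * K + K * M) * (1 + τ) ^ 2) ^ 2 :=
      sq_le_sq' (by linarith [(abs_le.1 hYle).1]) (abs_le.1 hYle).2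
    have e3 : (b * Y * η t) ^ 2 ≤ (b * Y) ^ 2 := by
      rw [mul_pow]
      exact mul_le_of_le_one_right (sq_nonneg _) (pow_le_one₀ hη0 hη1)
    have e4 : N ^ 2 ≤ N ^ 2 * (1 + τ) ^ 4 := le_mul_of_one_le_right (sq_nonneg _) hp
    have e5 := add_sq_le (a := η' t) (b := b * Y * η t)
    have e6 : ((2 * K + K * M) * (1 + τ) ^ 2) ^ 2 = (2 * K + K * M) ^ 2 * (1 + τ) ^ 4 := by ring
    linarith
  have h8 : b ^ 2 * riccatiDefect ξ q h r (k / b) τ ≤ 10 * M * K ^ 2 * (1 + τ) ^ 4 := by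
    calc b ^ 2 * riccatiDefect ξ q h r (k / b) τ
        ≤ b ^ 2 * (10 * M * (K / b) ^ 2 * (1 + τ) ^ 4) := by
          gcongr
      _ = _ := by field_simp
  have hu := P.sq_decay hτ
  have hη2 : η t ^ 2 ≤ 1 := pow_le_one₀ hη0 hη1
  set S := (1 + τ) ^ 4 with hS
  have h9 : (1 - t * k) * ((η' t + b * Y * η t) * u τ) ^ 2
      ≤ 2 * ((2 * N ^ 2 + 2 * (2 * K + K * M) ^ 2) * S) * u τ ^ 2 := by
    rw [mul_pow, ← mul_assoc]
    gcongr
    linarith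
  have h10 : b ^ 2 * (1 - t * k) * riccatiDefect ξ q h r (k / b) τ * (η t * u τ) ^ 2
      ≤ 2 * (10 * M * K ^ 2 * S) * u τ ^ 2 := by
    have e1 : (1 - t * k) * η t ^ 2 ≤ 2 := by
      calc (1 - t * k) * η t ^ 2 ≤ 2 * 1 := mul_le_mul (by linarith) hη2 (sq_nonneg _) zero_le_two
        _ = 2 := mul_one 2
    have e2 : 0 ≤ (1 - t * k) * η t ^ 2 := mul_nonneg (by linarith) (sq_nonneg _)
    calc _ = ((1 - t * k) * η t ^ 2) * (b ^ 2 * riccatiDefect ξ q h r (k / b) τ) * u τ ^ 2 := by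
          ring
      _ ≤ ((1 - t * k) * η t ^ 2) * (10 * M * K ^ 2 * S) * u τ ^ 2 := by gcongr
      _ ≤ _ := by gcongr
  calc _ ≤ A * (S * u τ ^ 2) := (add_le_add h9 h10).trans_eq (by rw [hA]; ring)
    _ ≤ A * (24 * M * Real.exp 5 * Real.exp (-τ)) := by gcongr
    _ = _ := by ring

include P in
theorem continuousOn_curvedLogDer {b k δ : ℝ} (hb : 0 < b)
    (ha : ∀ t ∈ Icc 0 δ, 1 - t * k ≠ 0) :
    ContinuousOn (fun t => curvedLogDer ξ q h r (k / b) (b * t)) (Icc 0 δ) := by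
  have hm : ContinuousOn (fun t : ℝ => b * t) (Icc 0 δ) := by fun_prop
  have hs : MapsTo (fun t : ℝ => b * t) (Icc 0 δ) (Ici 0) := fun t ht => mul_nonneg hb.le ht.1
  have hq : ContinuousOn (fun t => q (b * t)) (Icc 0 δ) := P.cq.comp hm hs
  have hr : ContinuousOn (fun t => r (b * t)) (Icc 0 δ) := P.cr.comp hm hs
  have hh : ContinuousOn (fun t => h (b * t)) (Icc 0 δ) := P.continuousOn_h.comp hm hs
  have hw : ContinuousOn (fun t => shiftedPotential ξ (k / b) (b * t)) (Icc 0 δ) := by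
    unfold shiftedPotential
    refine ContinuousOn.div (by fun_prop) (by fun_prop) fun t ht => ?_
    have : 1 - k / b * (b * t) = 1 - t * k := by field_simp
    rw [this]
    exact ha t ht
  unfold curvedLogDer
  exact (hq.add (hh.mul (hw.sub (by fun_prop)))).add (continuousOn_const.mul hr)

include P in
theorem continuousOn_riccatiDefect {b k δ : ℝ} (hb : 0 < b)
    (ha : ∀ t ∈ Icc 0 δ, 1 - t * k ≠ 0) :
    ContinuousOn (fun t => riccatiDefect ξ q h r (k / b) (b * t)) (Icc 0 δ) := by
  have hm : ContinuousOn (fun t : ℝ => b * t) (Icc 0 δ) := by fun_prop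
  have hs : MapsTo (fun t : ℝ => b * t) (Icc 0 δ) (Ici 0) := fun t ht => mul_nonneg hb.le ht.1
  have hq : ContinuousOn (fun t => q (b * t)) (Icc 0 δ) := P.cq.comp hm hs
  have hr : ContinuousOn (fun t => r (b * t)) (Icc 0 δ) := P.cr.comp hm hs
  have hh : ContinuousOn (fun t => h (b * t)) (Icc 0 δ) := P.continuousOn_h.comp hm hs
  have ha' : ∀ t ∈ Icc 0 δ, 1 - k / b * (b * t) ≠ 0 := fun t ht => by
    have : 1 - k / b * (b * t) = 1 - t * k := by field_simp
    rw [this]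
    exact ha t ht
  have hw : ContinuousOn (fun t => shiftedPotential ξ (k / b) (b * t)) (Icc 0 δ) := by
    unfold shiftedPotential
    exact ContinuousOn.div (by fun_prop) (by fun_prop) ha'
  have hd : ContinuousOn (fun t : ℝ => k / b / (1 - k / b * (b * t))) (Icc 0 δ) :=
    ContinuousOn.div (by fun_prop) (by fun_prop) ha'
  have hd' : ContinuousOn (fun t : ℝ => (k / b) ^ 2 * r (b * t) / (1 - k / b * (b * t)))
      (Icc 0 δ) :=
    ContinuousOn.div (continuousOn_const.mul hr) (by fun_prop) ha'
  have hx := hw.sub (show ContinuousOn (fun t : ℝ => b * t + ξ) (Icc 0 δ) by fun_prop)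
  unfold riccatiDefect
  exact (((((continuousOn_const.sub (hh.pow 2)).mul (hx.pow 2)).sub
    (((continuousOn_const.mul hr).mul hh).mul hx)).sub (continuousOn_const.mul (hr.pow 2))).sub
    ((hd.sub continuousOn_const).mul (hq.sub (hh.mul (by fun_prop))))).sub hd'

include P in
theorem integral_layerDensity {δ N : ℝ} {η η' : ℝ → ℝ} (hη : Cutoff δ N η η') {b k : ℝ}
    (hb : 0 < b) (hδ : 0 < δ) (ha : ∀ t ∈ Icc 0 δ, 1 - t * k ≠ 0) :
    ContinuousOn (layerRemainder ξ u q h r η η' b k) (Icc 0 δ) ∧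
    ∫ t in (0)..δ, layerDensity ξ Θ C₁ u q η η' b k t
      = ∫ t in (0)..δ, layerRemainder ξ u q h r η η' b k t := by
  have hf := P.continuous_layer hη b
  have hf' := P.continuous_layerDeriv hη b
  have hG := P.continuousOn_curvedLogDer hb ha
  have hQ := P.continuousOn_riccatiDefect hb ha
  have hR : ContinuousOn (layerRemainder ξ u q h r η η' b k) (Icc 0 δ) := by
    unfold layerRemainder
    fun_prop
  have hd : ContinuousOn (fun t => b ^ 2 * (ξ + b * t - k * b * t ^ 2 / 2) ^ 2 / (1 - t * k))
      (Icc 0 δ) := ContinuousOn.div (by fun_prop) (by fun_prop) ha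
  have hD : ContinuousOn (layerDensity ξ Θ C₁ u q η η' b k) (Icc 0 δ) := by
    unfold layerDensity
    fun_prop
  refine ⟨hR, ?_⟩
  have hInt : ∀ {g : ℝ → ℝ}, ContinuousOn g (Icc 0 δ) → IntervalIntegrable g volume 0 δ :=
    fun hg => ContinuousOn.intervalIntegrable (by rwa [uIcc_of_le hδ.le])
  have hF : ContinuousOn
      (fun t => b * (1 - t * k) * curvedLogDer ξ q h r (k / b) (b * t) * layer u η b t ^ 2)
      (Icc 0 δ) := by fun_prop
  have key := intervalIntegral.integral_eq_sub_of_hasDerivAt_of_le hδ.le hF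
    (fun t ht => P.hasDerivAt_layer_flux hη hb ht.1 (ha t ⟨ht.1.le, ht.2.le⟩))
    ((hInt hR).sub (hInt hD))
  rw [intervalIntegral.integral_sub (hInt hR) (hInt hD)] at key
  have h0 : curvedLogDer ξ q h r (k / b) (b * 0) = 0 := by
    simp [curvedLogDer, shiftedPotential, P.q_zero, P.r_zero]
  have h1 : layer u η b δ = 0 := by
    rw [layer, hη.zero δ (by rw [abs_of_pos hδ]; linarith), zero_mul]
  simp only [h0, h1] at key
  linarith

theorem integral_exp_neg_mul_le {b δ : ℝ} (hb : 0 < b) :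
    ∫ t in (0)..δ, Real.exp (-(b * t)) ≤ 1 / b := by
  have h1 : ∀ t ∈ uIcc 0 δ,
      HasDerivAt (fun t => -(Real.exp (-(b * t)) / b)) (Real.exp (-(b * t))) t := by
    intro t _
    have h2 : HasDerivAt (fun t : ℝ => -(b * t)) (-b) t := by
      exact ((hasDerivAt_id t).const_mul b).neg.congr_deriv (by simp)
    refine ((h2.exp).div_const b).neg.congr_deriv ?_
    field_simp
  rw [intervalIntegral.integral_eq_sub_of_hasDerivAt h1
    (Continuous.intervalIntegrable (by fun_prop) _ _)]
  have : 0 ≤ Real.exp (-(b * δ)) / b := by positivity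
  simp
  simpa using this

include P in
theorem exists_layer_mass_ge {δ N : ℝ} {η η' : ℝ → ℝ} (hη : Cutoff δ N η η') (hδ : 0 < δ) :
    ∃ c > 0, ∀ b, 4 / δ ≤ b → c / b ≤ ∫ t in (0)..δ, layer u η b t ^ 2 := by
  obtain ⟨τ₀, h0, h1⟩ := (isCompact_Icc (a := (0 : ℝ)) (b := 1)).exists_isMinOn ⟨0, by simp⟩
    (P.cu.mono fun τ hτ => hτ.1)
  have hpos := P.pos τ₀ h0.1
  refine ⟨u τ₀ ^ 2, by positivity, fun b hb => ?_⟩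
  have hb0 : 0 < b := lt_of_lt_of_le (by positivity) hb
  have hbδ : 1 / b ≤ δ / 4 := by
    rw [div_le_div_iff₀ hb0 (by norm_num)]
    rw [div_le_iff₀ hδ] at hb
    linarith
  have hb1 : 0 ≤ 1 / b := by positivity
  have hc : Continuous fun t => layer u η b t ^ 2 := (P.continuous_layer hη b).pow 2
  calc u τ₀ ^ 2 / b = ∫ t in (0)..(1 / b), u τ₀ ^ 2 := by simp; field_simp
    _ ≤ ∫ t in (0)..(1 / b), layer u η b t ^ 2 := by
      refine intervalIntegral.integral_mono_on hb1 (by simp) (hc.intervalIntegrable _ _) ?_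
      intro t ht
      have h2 : b * t ≤ 1 := by
        have := ht.2
        rwa [le_div_iff₀ hb0, mul_comm] at this
      have h3 : 0 ≤ b * t := mul_nonneg hb0.le ht.1
      have h4 : u τ₀ ≤ u (b * t) := h1 ⟨h3, h2⟩
      rw [layer, max_eq_left h3, hη.one t (by rw [abs_of_nonneg ht.1]; linarith [ht.2]), one_mul]
      gcongr
    _ ≤ ∫ t in (0)..δ, layer u η b t ^ 2 := by
      refine intervalIntegral.integral_mono_interval le_rfl hb1 (by linarith) ?_
        (hc.intervalIntegrable _ _)
      exact ae_of_all _ fun t => sq_nonneg _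

include P in
/-- The energy of the boundary layer on a cross-section with curvature `k`. -/
theorem exists_layer_energy_le {δ N K : ℝ} {η η' : ℝ → ℝ} (hη : Cutoff δ N η η')
    (hδ : 0 < δ) (hK : 0 ≤ K) (hKδ : K * δ ≤ 1 / 2) :
    ∃ C, 0 ≤ C ∧ ∀ b, 1 ≤ b → 4 / δ ≤ b → ∀ k, |k| ≤ K →
      ∫ t in (0)..δ, ((1 - t * k) * layerDeriv u q η η' b t ^ 2
        + b ^ 2 * (ξ + b * t - k * b * t ^ 2 / 2) ^ 2 / (1 - t * k) * layer u η b t ^ 2)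
      ≤ (Θ * b ^ 2 - C₁ * k * b + C) * ∫ t in (0)..δ, (1 - t * k) * layer u η b t ^ 2 := by
  obtain ⟨C, hC, hR⟩ := P.exists_layerRemainder_le hη hK hKδ
  obtain ⟨c, hc, hm⟩ := P.exists_layer_mass_ge hη hδ
  refine ⟨2 * C / c, by positivity, fun b hb hbδ k hk => ?_⟩
  have hb0 : 0 < b := by linarith
  have htk : ∀ t ∈ Icc 0 δ, 1 / 2 ≤ 1 - t * k := by
    intro t ht
    have : |t * k| ≤ 1 / 2 := by
      rw [abs_mul, abs_of_nonneg ht.1]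
      calc t * |k| ≤ δ * K := mul_le_mul ht.2 hk (abs_nonneg _) (ht.1.trans ht.2)
        _ ≤ 1 / 2 := by linarith
    linarith [(abs_le.1 this).2]
  have ha : ∀ t ∈ Icc 0 δ, 1 - t * k ≠ 0 := fun t ht => by linarith [htk t ht]
  obtain ⟨hRc, hI⟩ := P.integral_layerDensity (C₁ := C₁) hη hb0 hδ ha
  have hf := P.continuous_layer hη b
  have hf' := P.continuous_layerDeriv hη b
  have hInt : ∀ {g : ℝ → ℝ}, ContinuousOn g (Icc 0 δ) → IntervalIntegrable g volume 0 δ :=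
    fun hg => ContinuousOn.intervalIntegrable (by rwa [uIcc_of_le hδ.le])
  have hd : ContinuousOn (fun t => b ^ 2 * (ξ + b * t - k * b * t ^ 2 / 2) ^ 2 / (1 - t * k))
      (Icc 0 δ) := ContinuousOn.div (by fun_prop) (by fun_prop) ha
  have h1 : ∫ t in (0)..δ, layerRemainder ξ u q h r η η' b k t ≤ C * (1 / b) := by
    calc _ ≤ ∫ t in (0)..δ, C * Real.exp (-(b * t)) := by
          refine intervalIntegral.integral_mono_on hδ.le (hInt hRc)
            (Continuous.intervalIntegrable (by fun_prop) _ _) fun t ht => hR b hb k hk t ht.1 ht.2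
      _ ≤ _ := by
        rw [intervalIntegral.integral_const_mul]
        exact mul_le_mul_of_nonneg_left (integral_exp_neg_mul_le hb0) hC
  have h2 : c / b / 2 ≤ ∫ t in (0)..δ, (1 - t * k) * layer u η b t ^ 2 := by
    have h3 : ∫ t in (0)..δ, 1 / 2 * layer u η b t ^ 2
        ≤ ∫ t in (0)..δ, (1 - t * k) * layer u η b t ^ 2 := by
      refine intervalIntegral.integral_mono_on hδ.le
        (Continuous.intervalIntegrable (by fun_prop) _ _)
        (Continuous.intervalIntegrable (by fun_prop) _ _) fun t ht => ?_
      exact mul_le_mul_of_nonneg_right (htk t ht) (sq_nonneg _)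
    rw [intervalIntegral.integral_const_mul] at h3
    linarith [hm b hbδ]
  have h3 : C * (1 / b) ≤ 2 * C / c * ∫ t in (0)..δ, (1 - t * k) * layer u η b t ^ 2 := by
    calc C * (1 / b) = 2 * C / c * (c / b / 2) := by field_simp
      _ ≤ _ := mul_le_mul_of_nonneg_left h2 (by positivity)
  unfold layerDensity at hI
  rw [intervalIntegral.integral_sub (hInt (by fun_prop)) (hInt (by fun_prop)),
    intervalIntegral.integral_const_mul] at hI
  linarith

end BoundaryProfile

/-- Smooth cut-offs exist at every scale. -/
theorem exists_cutoff {δ : ℝ} (hδ : 0 < δ) : ∃ N η η', Cutoff δ N η η' := by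
  let φ : ContDiffBump (0 : ℝ) := ⟨δ / 4, δ / 2, by positivity, by linarith⟩
  have hφ : ContDiff ℝ 1 φ := φ.contDiff
  have hc : Continuous (deriv φ) := hφ.continuous_deriv le_rfl
  obtain ⟨N, hN⟩ := hc.bounded_above_of_compact_support φ.hasCompactSupport.deriv
  refine ⟨N, φ, deriv φ, fun t => (hφ.differentiable one_ne_zero t).hasDerivAt, hc,
    fun t => φ.nonneg, fun t => φ.le_one, fun t ht => ?_, fun t ht => ?_, hN⟩
  · exact φ.one_of_mem_closedBall (by simpa [φ] using ht)
  · exact φ.zero_of_le_dist (by simpa [φ] using ht)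

namespace BoundaryParam

variable {Ω : Set Plane} {P : BoundaryParam Ω}

theorem det_tubeDeriv (p : ℝ × ℝ) : (P.tubeDeriv p).det = 1 - p.2 * curvOf P.γ p.1 := by
  have h := P.unit_speed p.1
  simp only [esq] at h
  rw [ContinuousLinearMap.det, ← LinearMap.det_toMatrix (Module.Basis.finTwoProd ℝ),
    Matrix.det_fin_two]
  simp [LinearMap.toMatrix_apply, tubeDeriv, nuVec]
  linear_combination (1 - p.2 * curvOf P.γ p.1) * h

namespace Tubular

variable {δ M : ℝ} (hT : P.Tubular δ M)

/-- The coordinate box around the boundary point with parameter `s₀`. -/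
def box (P : BoundaryParam Ω) (δ s₀ : ℝ) : Set (ℝ × ℝ) :=
  Ioo (s₀ - P.L / 2) (s₀ + P.L / 2) ×ˢ Ioo (-δ) δ

/-- The part of the coordinate box lying over `Ω`. -/
def halfBox (P : BoundaryParam Ω) (δ s₀ : ℝ) : Set (ℝ × ℝ) :=
  Ioo (s₀ - P.L / 2) (s₀ + P.L / 2) ×ˢ Ioo 0 δ

include hT in
theorem injOn_box (s₀ : ℝ) : InjOn (tube P.γ) (box P δ s₀) := by
  intro p hp q hq h
  obtain ⟨n, hn⟩ := hT.inj p q (abs_lt.2 hp.2) (abs_lt.2 hq.2) h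
  have h1 := hp.1
  have h2 := hq.1
  rw [hn] at h2
  obtain ⟨h1l, h1r⟩ := h1
  obtain ⟨h2l, h2r⟩ := h2
  simp only at h2l h2r
  have hL := P.L_pos
  have h3 : (n : ℝ) < 1 := by
    by_contra hc
    push Not at hc
    nlinarith
  have h4 : (-1 : ℝ) < n := by
    by_contra hc
    push Not at hc
    nlinarith
  have h5 : n = 0 := by
    have : n < 1 := by exact_mod_cast h3
    have : -1 < n := by exact_mod_cast h4
    omega
  rw [hn, h5]
  simp

theorem isOpen_box (s₀ : ℝ) : IsOpen (box P δ s₀) := isOpen_Ioo.prod isOpen_Ioo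

include hT in
/-- Functions supported in the coordinate box can be transplanted to the plane. -/
theorem exists_transport {s₀ : ℝ} {g : ℝ × ℝ → ℂ} (hg : ContDiff ℝ 1 g) {K : Set (ℝ × ℝ)}
    (hK : IsCompact K) (hKb : K ⊆ box P δ s₀) (h0 : ∀ p ∉ K, g p = 0) :
    ∃ ψ : Plane → ℂ, ContDiff ℝ 1 ψ ∧
      (∀ p ∈ box P δ s₀, ψ (tube P.γ p) = g p ∧
        HasFDerivAt ψ ((fderiv ℝ g p).comp (P.tubeInv p)) (tube P.γ p)) ∧
      ∀ x ∉ tube P.γ '' box P δ s₀, ψ x = 0 ∧ fderiv ℝ ψ x = 0 := by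
  classical
  have hinj := hT.injOn_box s₀
  set ψ : Plane → ℂ := fun x => if x ∈ tube P.γ '' box P δ s₀ then
    g (Function.invFunOn (tube P.γ) (box P δ s₀) x) else 0 with hψ
  have hval : ∀ p ∈ box P δ s₀, ψ (tube P.γ p) = g p := fun p hp => by
    simp only [hψ]
    rw [if_pos (mem_image_of_mem _ hp), hinj.leftInvOn_invFunOn hp]
  have hzero : ∀ x ∉ tube P.γ '' K, ψ x = 0 := fun x hx => by
    by_cases h : x ∈ tube P.γ '' box P δ s₀
    · obtain ⟨p, hp, rfl⟩ := h
      rw [hval p hp]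
      exact h0 p fun hpK => hx (mem_image_of_mem _ hpK)
    · simp only [hψ, if_neg h]
  have hcl : IsClosed (tube P.γ '' K) := (hK.image P.contDiff_tube.continuous).isClosed
  have hloc : ∀ x ∉ tube P.γ '' K, ψ =ᶠ[𝓝 x] fun _ => 0 := fun x hx => by
    filter_upwards [hcl.isOpen_compl.mem_nhds hx] with y hy using hzero y hy
  have hin : ∀ p ∈ box P δ s₀, ContDiffAt ℝ 1 ψ (tube P.γ p) ∧
      HasFDerivAt ψ ((fderiv ℝ g p).comp (P.tubeInv p)) (tube P.γ p) := by
    intro p hp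
    obtain ⟨σ, h1, h2, h3, -, h5⟩ := P.exists_local_inverse (hT.ne_zero (abs_lt.2 hp.2))
    have hev : ψ =ᶠ[𝓝 (tube P.γ p)] fun x => g (σ x) := by
      have h6 : ∀ᶠ x in 𝓝 (tube P.γ p), σ x ∈ box P δ s₀ :=
        h1.continuousAt.eventually (by rw [h2]; exact (isOpen_box s₀).mem_nhds hp)
      filter_upwards [h3, h6] with x hx hx'
      conv_lhs => rw [← hx]
      exact hval _ hx'
    have hgd : HasFDerivAt g (fderiv ℝ g p) (σ (tube P.γ p)) := by
      rw [h2]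
      exact (hg.differentiable one_ne_zero p).hasFDerivAt
    exact ⟨(hg.contDiffAt.comp _ (h1.of_le (by simp))).congr_of_eventuallyEq hev,
      (hgd.comp _ h5).congr_of_eventuallyEq hev⟩
  refine ⟨ψ, contDiff_iff_contDiffAt.2 fun x => ?_, fun p hp => ⟨hval p hp, (hin p hp).2⟩,
    fun x hx => ?_⟩
  · by_cases h : x ∈ tube P.γ '' box P δ s₀
    · obtain ⟨p, hp, rfl⟩ := h
      exact (hin p hp).1
    · exact contDiffAt_const.congr_of_eventuallyEq
        (hloc x fun h' => h (image_mono hKb h'))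
  · have hx' : x ∉ tube P.γ '' K := fun h' => hx (image_mono hKb h')
    exact ⟨hzero x hx', by rw [(hloc x hx').fderiv_eq]; simp⟩

include hT in
theorem setIntegral_eq_halfBox (hΩ : IsOpen Ω) (hbd : Bornology.IsBounded Ω) {s₀ : ℝ}
    {F : Plane → ℝ}
    (hF : ∀ x ∉ tube P.γ '' box P δ s₀, F x = 0) :
    ∫ x in Ω, F x = ∫ p in halfBox P δ s₀, (1 - p.2 * curvOf P.γ p.1) * F (tube P.γ p) := by
  have hδ := hT.δ_pos
  have hsub : halfBox P δ s₀ ⊆ box P δ s₀ :=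
    prod_mono subset_rfl (Ioo_subset_Ioo_left (by linarith))
  have h1 : tube P.γ '' halfBox P δ s₀ ⊆ Ω := by
    rintro _ ⟨p, hp, rfl⟩
    exact hT.tube_mem hΩ hp.2.1 hp.2.2
  have hm : MeasurableSet (halfBox P δ s₀) := measurableSet_Ioo.prod measurableSet_Ioo
  have h2 : ∫ x in Ω, F x = ∫ x in tube P.γ '' halfBox P δ s₀, F x := by
    refine (setIntegral_eq_of_subset_of_forall_sdiff_eq_zero hΩ.measurableSet h1 fun x hx => ?_)
    refine hF x ?_
    rintro ⟨p, hp, rfl⟩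
    rcases le_or_gt p.2 0 with h | h
    · exact hT.tube_notMem hΩ hbd h hp.2.1 hx.1
    · exact hx.2 (mem_image_of_mem _ ⟨hp.1, h, hp.2.2⟩)
  rw [h2, integral_image_eq_integral_abs_det_fderiv_smul volume hm
    (fun p _ => (P.hasFDerivAt_tube p).hasFDerivWithinAt) ((hT.injOn_box s₀).mono hsub)]
  refine setIntegral_congr_fun hm fun p hp => ?_
  have := hT.half_le (abs_lt.2 (hsub hp).2)
  simp only [det_tubeDeriv, smul_eq_mul]
  rw [abs_of_pos (by linarith)]

end Tubular

end BoundaryParam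

/-- Multiplication of a real amplitude by a phase. -/
def polar (ρ ϑ : ℝ × ℝ → ℝ) (p : ℝ × ℝ) : ℂ := (ρ p : ℂ) * Complex.exp (Complex.I * (ϑ p : ℂ))

theorem norm_exp_I_mul (θ : ℝ) : ‖Complex.exp (Complex.I * (θ : ℂ))‖ = 1 := by
  rw [mul_comm]
  exact Complex.norm_exp_ofReal_mul_I θ

theorem norm_polar_sq (ρ ϑ : ℝ × ℝ → ℝ) (p : ℝ × ℝ) : ‖polar ρ ϑ p‖ ^ 2 = ρ p ^ 2 := by
  rw [polar, norm_mul, norm_exp_I_mul, mul_one, Complex.norm_real, Real.norm_eq_abs, sq_abs]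

theorem norm_gauge_sq (α β B ρ θ : ℝ) :
    ‖(-Complex.I) * (((α : ℂ) + Complex.I * (β : ℂ)) * Complex.exp (Complex.I * (θ : ℂ)))
      - ((B : ℝ) : ℂ) * ((ρ : ℂ) * Complex.exp (Complex.I * (θ : ℂ)))‖ ^ 2
      = α ^ 2 + (β - B * ρ) ^ 2 := by
  have h : (-Complex.I) * (((α : ℂ) + Complex.I * (β : ℂ)) * Complex.exp (Complex.I * (θ : ℂ)))
      - ((B : ℝ) : ℂ) * ((ρ : ℂ) * Complex.exp (Complex.I * (θ : ℂ)))
      = (((β - B * ρ : ℝ) : ℂ) + ((-α : ℝ) : ℂ) * Complex.I)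
        * Complex.exp (Complex.I * (θ : ℂ)) := by
    push_cast
    linear_combination (-(β : ℂ) * Complex.exp (Complex.I * (θ : ℂ))) * Complex.I_sq
  rw [h, norm_mul, norm_exp_I_mul, mul_one, Complex.sq_norm, Complex.normSq_add_mul_I]
  ring

theorem hasFDerivAt_polar {ρ ϑ : ℝ × ℝ → ℝ} {ρ' ϑ' : ℝ × ℝ →L[ℝ] ℝ} {p : ℝ × ℝ}
    (hρ : HasFDerivAt ρ ρ' p) (hϑ : HasFDerivAt ϑ ϑ' p) :
    DifferentiableAt ℝ (polar ρ ϑ) p ∧ ∀ v, fderiv ℝ (polar ρ ϑ) p v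
      = ((ρ' v : ℂ) + Complex.I * ((ρ p * ϑ' v : ℝ) : ℂ))
        * Complex.exp (Complex.I * (ϑ p : ℂ)) := by
  have h1 : HasFDerivAt (fun p => (ρ p : ℂ)) _ p := Complex.ofRealCLM.hasFDerivAt.comp p hρ
  have h2 : HasFDerivAt (fun p => (ϑ p : ℂ)) _ p := Complex.ofRealCLM.hasFDerivAt.comp p hϑ
  have h3 := h1.mul ((h2.const_mul Complex.I).cexp)
  have h4 : polar ρ ϑ = (fun p => (ρ p : ℂ)) * fun p => Complex.exp (Complex.I * (ϑ p : ℂ)) := rfl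
  refine ⟨h4 ▸ h3.differentiableAt, fun v => ?_⟩
  rw [h4, h3.fderiv]
  simp
  ring

namespace BoundaryParam

variable {Ω : Set Plane} (P : BoundaryParam Ω)

/-- The planar cross product. -/
def cross (v w : Plane) : ℝ := v.1 * w.2 - v.2 * w.1

/-- The phase `B·φ + c s` for which `A = F₀` has no normal component. -/
def phase (B c s₀ : ℝ) (p : ℝ × ℝ) : ℝ :=
  B * (p.2 / 2 * cross (P.γ p.1) (nuVec P.γ p.1)
    + 1 / 2 * ∫ s in s₀..p.1, cross (P.γ s) (deriv P.γ s)) + c * p.1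

theorem continuous_cross_deriv : Continuous fun s => cross (P.γ s) (deriv P.γ s) := by
  have h1 := P.smooth.continuous
  have h2 := P.contDiff_deriv.continuous
  unfold cross
  fun_prop

theorem contDiff_phase (B c s₀ : ℝ) : ContDiff ℝ 1 (P.phase B c s₀) := by
  have h0 : ContDiff ℝ 1 P.γ := P.smooth.of_le (by simp)
  have h1 : ContDiff ℝ 1 (nuVec P.γ) := P.contDiff_nuVec.of_le (by simp)
  have hc := P.continuous_cross_deriv
  have h2 : ContDiff ℝ 1 fun t => ∫ s in s₀..t, cross (P.γ s) (deriv P.γ s) := by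
    refine contDiff_one_iff_deriv.2
      ⟨fun t => (hc.integral_hasStrictDerivAt s₀ t).hasDerivAt.differentiableAt, ?_⟩
    convert hc using 1
    exact funext fun t => (hc.integral_hasStrictDerivAt s₀ t).hasDerivAt.deriv
  have h3 : ContDiff ℝ 1 fun p : ℝ × ℝ => ∫ s in s₀..p.1, cross (P.γ s) (deriv P.γ s) :=
    h2.comp contDiff_fst
  have h4 : ContDiff ℝ 1 fun p : ℝ × ℝ => P.γ p.1 := h0.comp contDiff_fst
  have h5 : ContDiff ℝ 1 fun p : ℝ × ℝ => nuVec P.γ p.1 := h1.comp contDiff_fst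
  have h6 : ContDiff ℝ 1 fun p : ℝ × ℝ => cross (P.γ p.1) (nuVec P.γ p.1) := by
    unfold cross
    exact (h4.fst.mul h5.snd).sub (h4.snd.mul h5.fst)
  unfold phase
  fun_prop

theorem hasFDerivAt_phase (B c s₀ : ℝ) (p : ℝ × ℝ) :
    HasFDerivAt (P.phase B c s₀)
      ((B * ((1 - p.2 * curvOf P.γ p.1) / 2 * cross (P.γ p.1) (deriv P.γ p.1) + p.2 / 2) + c) •
          ContinuousLinearMap.fst ℝ ℝ ℝ
        + (B / 2 * cross (P.γ p.1) (nuVec P.γ p.1)) • ContinuousLinearMap.snd ℝ ℝ ℝ) p := by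
  have h0 : HasFDerivAt (fun p : ℝ × ℝ => p.1) (ContinuousLinearMap.fst ℝ ℝ ℝ) p :=
    hasFDerivAt_fst
  have h3 : HasFDerivAt (fun p : ℝ × ℝ => p.2) (ContinuousLinearMap.snd ℝ ℝ ℝ) p :=
    hasFDerivAt_snd
  have h1 := P.hasDerivAt p.1
  have h2 := P.hasDerivAt_nuVec p.1
  have h1a : HasDerivAt (fun s => (P.γ s).1) _ p.1 := h1.fst
  have h1b : HasDerivAt (fun s => (P.γ s).2) _ p.1 := h1.snd
  have h2a : HasDerivAt (fun s => (nuVec P.γ s).1) _ p.1 := h2.fst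
  have h2b : HasDerivAt (fun s => (nuVec P.γ s).2) _ p.1 := h2.snd
  have h4 : HasDerivAt (fun s => cross (P.γ s) (nuVec P.γ s)) _ p.1 :=
    (h1a.mul h2b).sub (h1b.mul h2a)
  have h5 : HasFDerivAt (fun p : ℝ × ℝ => cross (P.γ p.1) (nuVec P.γ p.1)) _ p :=
    h4.hasFDerivAt.comp p h0
  have h6 : HasFDerivAt (fun p : ℝ × ℝ => ∫ s in s₀..p.1, cross (P.γ s) (deriv P.γ s)) _ p :=
    (P.continuous_cross_deriv.integral_hasStrictDerivAt s₀ p.1).hasDerivAt.hasFDerivAt.comp p h0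
  have h7 := ((((h3.mul_const (1 / 2)).mul h5).add (h6.const_mul (1 / 2))).const_mul B).add
    (h0.const_mul c)
  have h8 : HasFDerivAt (P.phase B c s₀) _ p := h7.congr_of_eventuallyEq
    (.of_forall fun q => by simp only [phase, Pi.add_apply, Pi.mul_apply]; ring)
  refine h8.congr_fderiv (ContinuousLinearMap.ext fun v => ?_)
  have hu := P.unit_speed p.1
  simp only [esq] at hu
  simp [cross, nuVec]
  linear_combination (B * p.2 * v.1 / 2) * hu

/-- The magnetic energy density of a transplanted function in normal coordinates. -/
theorem magSq_tube {ρ : ℝ × ℝ → ℝ} {α β B c s₀ : ℝ} {p : ℝ × ℝ} {ψ : Plane → ℂ}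
    (hp : 1 - p.2 * curvOf P.γ p.1 ≠ 0)
    (hρ : HasFDerivAt ρ (α • ContinuousLinearMap.fst ℝ ℝ ℝ + β • ContinuousLinearMap.snd ℝ ℝ ℝ) p)
    (hψ : ψ (tube P.γ p) = polar ρ (P.phase B c s₀) p)
    (hd : HasFDerivAt ψ ((fderiv ℝ (polar ρ (P.phase B c s₀)) p).comp (P.tubeInv p))
      (tube P.γ p)) :
    magSq B F0 ψ (tube P.γ p) = β ^ 2 + (α ^ 2
      + (c + B * (p.2 - curvOf P.γ p.1 * p.2 ^ 2 / 2)) ^ 2 * ρ p ^ 2)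
        / (1 - p.2 * curvOf P.γ p.1) ^ 2 := by
  obtain ⟨-, h⟩ := hasFDerivAt_polar hρ (P.hasFDerivAt_phase B c s₀ p)
  have h1 : ∀ v, fderiv ℝ ψ (tube P.γ p) v
      = fderiv ℝ (polar ρ (P.phase B c s₀)) p (P.tubeInv p v) := fun v => by
    rw [hd.fderiv]; rfl
  rw [magSq, h1, h1, h, h, hψ, polar, norm_gauge_sq, norm_gauge_sq]
  have hu := P.unit_speed p.1
  simp only [esq] at hu
  simp [tubeInv, F0, tube, cross, nuVec]
  set a := 1 - p.2 * curvOf P.γ p.1 with ha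
  have hk : p.2 * curvOf P.γ p.1 = 1 - a := by rw [ha]; ring
  set T₁ := (deriv P.γ p.1).1
  set T₂ := (deriv P.γ p.1).2
  set x := (P.γ p.1).1
  set y := (P.γ p.1).2
  set t := p.2
  set R := ρ p
  have hi : a * a⁻¹ = 1 := mul_inv_cancel₀ hp
  have e1 : R * ((B * (a / 2 * (x * T₂ - y * T₁) + t / 2) + c) * (a⁻¹ * T₁)
      + -(B / 2 * (x * T₁ + y * T₂) * T₂)) - B * ((-(t * T₁) + -y) / 2) * R
      = R * (a⁻¹ * (B * t / 2 + c) + B * t / 2) * T₁ := by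
    linear_combination (R * B / 2 * (x * T₂ - y * T₁) * T₁) * hi - (R * B * y / 2) * hu
  have e2 : R * ((B * (a / 2 * (x * T₂ - y * T₁) + t / 2) + c) * (a⁻¹ * T₂)
      + B / 2 * (x * T₁ + y * T₂) * T₁) - B * ((x + -(t * T₂)) / 2) * R
      = R * (a⁻¹ * (B * t / 2 + c) + B * t / 2) * T₂ := by
    linear_combination (R * B / 2 * (x * T₂ - y * T₁) * T₂) * hi + (R * B * x / 2) * hu
  have e3 : c + B * (t - curvOf P.γ p.1 * t ^ 2 / 2) = c + B * t / 2 + B * t / 2 * a := by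
    linear_combination (-(B * t / 2)) * hk
  rw [e1, e2, e3, div_eq_mul_inv _ (a ^ 2), ← inv_pow]
  linear_combination (α ^ 2 * a⁻¹ ^ 2 + β ^ 2
    + R ^ 2 * (a⁻¹ * (B * t / 2 + c) + B * t / 2) ^ 2) * hu
    - R ^ 2 * (2 * a⁻¹ * (B * t / 2 + c) * (B * t / 2) + (B * t / 2) ^ 2 * (a * a⁻¹ + 1)) * hi

end BoundaryParam

theorem contDiff_one_of_hasDerivAt {f f' : ℝ → ℝ} (h : ∀ t, HasDerivAt f (f' t) t)
    (hc : Continuous f') : ContDiff ℝ 1 f :=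
  contDiff_one_iff_deriv.2 ⟨fun t => (h t).differentiableAt, by
    rwa [show deriv f = f' from funext fun t => (h t).deriv]⟩

namespace Cutoff

variable {δ N : ℝ} {η η' : ℝ → ℝ}

theorem continuous (hη : Cutoff δ N η η') : Continuous η :=
  continuous_iff_continuousAt.2 fun t => (hη.deriv t).continuousAt

theorem deriv_zero (hη : Cutoff δ N η η') {t : ℝ} (ht : δ / 2 < |t|) : η' t = 0 := by
  have h1 : η =ᶠ[𝓝 t] fun _ => 0 := by
    have : ∀ᶠ y in 𝓝 t, δ / 2 < |y| := continuous_abs.continuousAt.eventually (lt_mem_nhds ht)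
    filter_upwards [this] with y hy using hη.zero y hy.le
  exact (hη.deriv t).unique ((hasDerivAt_const t (0 : ℝ)).congr_of_eventuallyEq h1)

theorem hasDerivAt_comp (hη : Cutoff δ N η η') (l s₀ s : ℝ) :
    HasDerivAt (fun s => η (l * (s - s₀))) (l * η' (l * (s - s₀))) s := by
  have h1 : HasDerivAt (fun s : ℝ => l * (s - s₀)) l s := by
    simpa using ((hasDerivAt_id s).sub_const s₀).const_mul l
  exact ((hη.deriv _).comp s h1).congr_deriv (mul_comm _ _)

/-- Dirichlet energy of a rescaled cut-off compared to its mass. -/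
theorem integral_deriv_sq_le (hη : Cutoff δ N η η') {l s₀ R : ℝ} (hδ : 0 < δ) (hl : 1 ≤ l)
    (hR : δ < R) :
    ∫ s in Ioo (s₀ - R) (s₀ + R), (l * η' (l * (s - s₀))) ^ 2
      ≤ 2 * N ^ 2 * l ^ 2 * ∫ s in Ioo (s₀ - R) (s₀ + R), η (l * (s - s₀)) ^ 2 := by
  have hl0 : 0 < l := by linarith
  have hc := hη.continuous
  have hc' := hη.cont
  have hd : δ / (2 * l) ≤ δ / 2 := by
    gcongr
    linarith
  have hd4 : 0 < δ / (4 * l) := by positivity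
  have hd4' : δ / (4 * l) ≤ δ / (2 * l) := by
    gcongr
    norm_num
  have h1 : ∫ s in Ioo (s₀ - R) (s₀ + R), (l * η' (l * (s - s₀))) ^ 2 ≤ N ^ 2 * l * δ := by
    have e1 : ∫ s in Ioo (s₀ - R) (s₀ + R), (l * η' (l * (s - s₀))) ^ 2
        = ∫ s in Icc (s₀ - δ / (2 * l)) (s₀ + δ / (2 * l)), (l * η' (l * (s - s₀))) ^ 2 := by
      refine setIntegral_eq_of_subset_of_forall_sdiff_eq_zero measurableSet_Ioo
        (fun s hs => ⟨by linarith [hs.1], by linarith [hs.2]⟩) fun s hs => ?_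
      rw [hη.deriv_zero, mul_zero, zero_pow two_ne_zero]
      have h2 := hs.2
      rw [mem_Icc, not_and_or, not_le, not_le] at h2
      rw [abs_mul, abs_of_pos hl0]
      have h3 : δ / (2 * l) < |s - s₀| := by
        rcases h2 with h2 | h2
        · exact lt_of_lt_of_le (by linarith) (neg_le_abs _)
        · exact lt_of_lt_of_le (by linarith) (le_abs_self _)
      calc δ / 2 = l * (δ / (2 * l)) := by field_simp
        _ < l * |s - s₀| := by gcongr
    rw [e1]
    calc _ ≤ ∫ s in Icc (s₀ - δ / (2 * l)) (s₀ + δ / (2 * l)), (l * N) ^ 2 := by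
          refine setIntegral_mono_on (Continuous.integrableOn_Icc (by fun_prop))
            continuous_const.integrableOn_Icc measurableSet_Icc fun s _ => ?_
          have := hη.deriv_le (l * (s - s₀))
          rw [mul_pow, mul_pow]
          gcongr ?_ * ?_
          exact sq_le_sq' (by linarith [(abs_le.1 this).1]) (abs_le.1 this).2
      _ = N ^ 2 * l * δ := by
        rw [setIntegral_const, smul_eq_mul, Real.volume_real_Icc_of_le (by linarith)]
        field_simp
        ring
  have h2 : δ / (2 * l) ≤ ∫ s in Ioo (s₀ - R) (s₀ + R), η (l * (s - s₀)) ^ 2 := by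
    have hInt : IntegrableOn (fun s => η (l * (s - s₀)) ^ 2) (Ioo (s₀ - R) (s₀ + R)) :=
      (Continuous.integrableOn_Icc (by fun_prop)).mono_set Ioo_subset_Icc_self
    calc δ / (2 * l) = ∫ s in Icc (s₀ - δ / (4 * l)) (s₀ + δ / (4 * l)), (1 : ℝ) := by
          rw [setIntegral_const, smul_eq_mul, Real.volume_real_Icc_of_le (by linarith)]
          field_simp
          ring
      _ = ∫ s in Icc (s₀ - δ / (4 * l)) (s₀ + δ / (4 * l)), η (l * (s - s₀)) ^ 2 := by
        refine setIntegral_congr_fun measurableSet_Icc fun s hs => ?_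
        have : |s - s₀| ≤ δ / (4 * l) := abs_le.2 ⟨by linarith [hs.1], by linarith [hs.2]⟩
        rw [hη.one, one_pow]
        rw [abs_mul, abs_of_pos hl0]
        calc l * |s - s₀| ≤ l * (δ / (4 * l)) := by gcongr
          _ = δ / 4 := by field_simp
      _ ≤ _ := by
        refine setIntegral_mono_set hInt (ae_of_all _ fun s => sq_nonneg _) ?_
        refine (LE.le.eventuallyLE fun s hs => ?_)
        exact ⟨by linarith [hs.1], by linarith [hs.2]⟩
  calc _ ≤ N ^ 2 * l * δ := h1
    _ = 2 * N ^ 2 * l ^ 2 * (δ / (2 * l)) := by field_simp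
    _ ≤ _ := by gcongr

end Cutoff

/-- Quadratic lower bound near a global maximum. -/
theorem exists_sub_le_of_isMax {k : ℝ → ℝ} (hk : ContDiff ℝ 2 k) {s₀ R : ℝ} (hR : 0 ≤ R)
    (hmax : ∀ s, k s ≤ k s₀) :
    ∃ C, 0 ≤ C ∧ ∀ s, |s - s₀| ≤ R → k s₀ - k s ≤ C * (s - s₀) ^ 2 := by
  have hk1 : ContDiff ℝ 1 (deriv k) := by
    have : ContDiff ℝ (1 + 1) k := by norm_num; exact hk
    exact (contDiff_succ_iff_deriv.1 this).2.2
  have hk2 : Continuous (deriv (deriv k)) := hk1.continuous_deriv le_rfl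
  obtain ⟨C, hC⟩ := (isCompact_closedBall s₀ R).exists_bound_of_continuousOn hk2.continuousOn
  have hC0 : 0 ≤ C := (norm_nonneg _).trans (hC s₀ (Metric.mem_closedBall_self hR))
  have h0 : deriv k s₀ = 0 := IsLocalMax.deriv_eq_zero (Eventually.of_forall hmax)
  have h1 : ∀ s ∈ Metric.closedBall s₀ R, |deriv k s| ≤ C * |s - s₀| := by
    intro s hs
    have := (convex_closedBall s₀ R).norm_image_sub_le_of_norm_deriv_le
      (fun x _ => hk1.differentiable one_ne_zero x) hC (Metric.mem_closedBall_self hR) hs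
    rwa [h0, sub_zero] at this
  refine ⟨C, hC0, fun s hs => ?_⟩
  have hs' : s ∈ Metric.closedBall s₀ |s - s₀| := by simp [Real.dist_eq]
  have := (convex_closedBall s₀ |s - s₀|).norm_image_sub_le_of_norm_deriv_le
    (f := k) (C := C * |s - s₀|)
    (fun x _ => hk.differentiable two_ne_zero x) (fun x hx => ?_)
    (Metric.mem_closedBall_self (abs_nonneg _)) hs'
  · rw [Real.norm_eq_abs, Real.norm_eq_abs, mul_assoc, abs_mul_abs_self] at this
    calc k s₀ - k s ≤ |k s - k s₀| := by rw [abs_sub_comm]; exact le_abs_self _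
      _ ≤ _ := by rw [sq]; exact this
  · have hx' : |x - s₀| ≤ |s - s₀| := by simpa [Real.dist_eq] using hx
    refine (h1 x (by simpa [Real.dist_eq] using hx'.trans hs)).trans ?_
    gcongr

theorem integrableOn_rect {G : ℝ × ℝ → ℝ} {a b δ : ℝ}
    (hG : ContinuousOn G (Icc a b ×ˢ Icc 0 δ)) : IntegrableOn G (Ioo a b ×ˢ Ioo 0 δ) :=
  (hG.integrableOn_compact (isCompact_Icc.prod isCompact_Icc)).mono_set
    (prod_mono Ioo_subset_Icc_self Ioo_subset_Icc_self)

theorem setIntegral_rect {G : ℝ × ℝ → ℝ} {a b δ : ℝ} (hδ : 0 ≤ δ)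
    (hG : ContinuousOn G (Icc a b ×ˢ Icc 0 δ)) :
    IntegrableOn (fun s => ∫ t in (0)..δ, G (s, t)) (Ioo a b) ∧
      ∫ p in Ioo a b ×ˢ Ioo 0 δ, G p = ∫ s in Ioo a b, ∫ t in (0)..δ, G (s, t) := by
  have h := integrableOn_rect hG
  have e : (fun s => ∫ t in (0)..δ, G (s, t)) = fun s => ∫ t in Ioo 0 δ, G (s, t) := by
    funext s
    rw [intervalIntegral.integral_of_le hδ, integral_Ioc_eq_integral_Ioo]
  rw [e]
  refine ⟨?_, ?_⟩
  · rw [IntegrableOn, Measure.volume_eq_prod, ← Measure.prod_restrict] at h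
    exact h.integral_prod_left
  · rw [Measure.volume_eq_prod] at h ⊢
    exact setIntegral_prod G h

namespace BoundaryProfile

variable {ξ Θ C₁ M : ℝ} {u q h r : ℝ → ℝ} (P : BoundaryProfile ξ Θ C₁ M u q h r)

/-- The energy density, with respect to `ds dt`, of a product of a tangential cut-off `χ` and a
boundary layer `f`. -/
def trialDensity (ξ b : ℝ) (k χ χ' f f' : ℝ → ℝ) (p : ℝ × ℝ) : ℝ :=
  (1 - p.2 * k p.1) * ((χ p.1 * f' p.2) ^ 2 + ((χ' p.1 * f p.2) ^ 2
    + (ξ * b + b ^ 2 * (p.2 - k p.1 * p.2 ^ 2 / 2)) ^ 2 * (χ p.1 * f p.2) ^ 2)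
      / (1 - p.2 * k p.1) ^ 2)

include P in
/-- Energy of a tangentially localized boundary layer concentrated at a maximum of `k`. -/
theorem exists_trial_energy_le {δ N K d Nd R s₀ : ℝ} {η η' χ χ' k : ℝ → ℝ}
    (hη : Cutoff δ N η η') (hδ : 0 < δ) (hχ : Cutoff d Nd χ χ') (hd : 0 < d) (hR : d < R)
    (hC₁ : 0 ≤ C₁) (hk : ContDiff ℝ 2 k) (hkK : ∀ s, |k s| ≤ K) (hKδ : K * δ ≤ 1 / 2)
    (hmax : ∀ s, k s ≤ k s₀) :
    ∃ C, 0 ≤ C ∧ ∀ l, 1 ≤ l → 4 / δ ≤ l ^ 4 →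
      ∫ p in Ioo (s₀ - R) (s₀ + R) ×ˢ Ioo 0 δ, trialDensity ξ (l ^ 4) k
        (fun s => χ (l * (s - s₀))) (fun s => l * χ' (l * (s - s₀)))
        (layer u η (l ^ 4)) (layerDeriv u q η η' (l ^ 4)) p
      ≤ (Θ * (l ^ 4) ^ 2 - C₁ * k s₀ * l ^ 4 + C * l ^ 2) *
        ∫ p in Ioo (s₀ - R) (s₀ + R) ×ˢ Ioo 0 δ, (1 - p.2 * k p.1) *
          (χ (l * (p.1 - s₀)) * layer u η (l ^ 4) p.2) ^ 2 := by
  have hK : 0 ≤ K := (abs_nonneg _).trans (hkK 0)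
  obtain ⟨C, hC, hE⟩ := P.exists_layer_energy_le hη hδ hK hKδ
  obtain ⟨C2, hC2, hquad⟩ := exists_sub_le_of_isMax hk (R := d) hd.le hmax
  refine ⟨C + C₁ * C2 * d ^ 2 + 8 * Nd ^ 2, by positivity, fun l hl hlδ => ?_⟩
  have hl0 : 0 < l := by linarith
  have hl2 : 1 ≤ l ^ 2 := one_le_pow₀ hl
  have hl4 : 1 ≤ l ^ 4 := one_le_pow₀ hl
  set b := l ^ 4 with hb
  set f := layer u η b
  set f' := layerDeriv u q η η' b
  have hcf : Continuous f := P.continuous_layer hη b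
  have hcf' : Continuous f' := P.continuous_layerDeriv hη b
  set X : ℝ → ℝ := fun s => χ (l * (s - s₀)) with hX
  set X' : ℝ → ℝ := fun s => l * χ' (l * (s - s₀)) with hX'
  have hcX : Continuous X := hχ.continuous.comp (by fun_prop)
  have hcX' : Continuous X' := continuous_const.mul (hχ.cont.comp (by fun_prop))
  have hck := hk.continuous
  have hhalf : ∀ s t, t ∈ Icc 0 δ → 1 / 2 ≤ 1 - t * k s := by
    intro s t ht
    have : t * k s ≤ δ * K :=
      (mul_le_mul_of_nonneg_left ((le_abs_self _).trans (hkK s)) ht.1).trans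
        (mul_le_mul_of_nonneg_right ht.2 hK)
    linarith
  have hcq : ContinuousOn (fun p : ℝ × ℝ => (1 - p.2 * k p.1)⁻¹)
      (Icc (s₀ - R) (s₀ + R) ×ˢ Icc 0 δ) :=
    ContinuousOn.inv₀ (by fun_prop) fun p hp => by linarith [hhalf p.1 p.2 hp.2]
  have hcqs : ∀ s, ContinuousOn (fun t : ℝ => (1 - t * k s)⁻¹) (uIcc 0 δ) := fun s =>
    ContinuousOn.inv₀ (by fun_prop) fun t ht => by
      linarith [hhalf s t (by rwa [uIcc_of_le hδ.le] at ht)]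
  set e : ℝ → ℝ → ℝ := fun s t => (1 - t * k s) * f' t ^ 2
    + b ^ 2 * (ξ + b * t - k s * b * t ^ 2 / 2) ^ 2 / (1 - t * k s) * f t ^ 2 with he
  have h1 : ContinuousOn (fun p : ℝ × ℝ => X p.1 ^ 2 * e p.1 p.2)
      (Icc (s₀ - R) (s₀ + R) ×ˢ Icc 0 δ) := by
    simp only [he, div_eq_mul_inv (b ^ 2 * _)]
    fun_prop
  have h2 : ContinuousOn (fun p : ℝ × ℝ => X' p.1 ^ 2 * (f p.2 ^ 2 * (1 - p.2 * k p.1)⁻¹))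
      (Icc (s₀ - R) (s₀ + R) ×ˢ Icc 0 δ) := by
    fun_prop
  have h3 : ContinuousOn (fun p : ℝ × ℝ => X p.1 ^ 2 * ((1 - p.2 * k p.1) * f p.2 ^ 2))
      (Icc (s₀ - R) (s₀ + R) ×ˢ Icc 0 δ) := by
    fun_prop
  obtain ⟨i1, j1⟩ := setIntegral_rect hδ.le h1
  obtain ⟨i2, j2⟩ := setIntegral_rect hδ.le h2
  obtain ⟨i3, j3⟩ := setIntegral_rect hδ.le h3
  simp only [intervalIntegral.integral_const_mul] at i1 i2 i3 j1 j2 j3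
  have eL : ∫ p in Ioo (s₀ - R) (s₀ + R) ×ˢ Ioo 0 δ, trialDensity ξ b k X X' f f' p
      = (∫ p in Ioo (s₀ - R) (s₀ + R) ×ˢ Ioo 0 δ, X p.1 ^ 2 * e p.1 p.2)
        + ∫ p in Ioo (s₀ - R) (s₀ + R) ×ˢ Ioo 0 δ,
          X' p.1 ^ 2 * (f p.2 ^ 2 * (1 - p.2 * k p.1)⁻¹) := by
    rw [← integral_add (integrableOn_rect h1) (integrableOn_rect h2)]
    refine setIntegral_congr_fun (measurableSet_Ioo.prod measurableSet_Ioo) fun p hp => ?_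
    have : 1 - p.2 * k p.1 ≠ 0 := by
      have := hhalf p.1 p.2 (Ioo_subset_Icc_self hp.2)
      linarith
    simp only [trialDensity, he]
    field_simp
    ring
  have eR : ∫ p in Ioo (s₀ - R) (s₀ + R) ×ˢ Ioo 0 δ, (1 - p.2 * k p.1) * (X p.1 * f p.2) ^ 2
      = ∫ p in Ioo (s₀ - R) (s₀ + R) ×ˢ Ioo 0 δ,
        X p.1 ^ 2 * ((1 - p.2 * k p.1) * f p.2 ^ 2) := by
    congr 1
    funext p
    ring
  set n : ℝ → ℝ := fun s => ∫ t in (0)..δ, (1 - t * k s) * f t ^ 2 with hn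
  set m := ∫ t in (0)..δ, f t ^ 2 with hm
  have hm0 : 0 ≤ m := intervalIntegral.integral_nonneg hδ.le fun t _ => sq_nonneg _
  have hmn : ∀ s, m ≤ 2 * n s := by
    intro s
    rw [hn, ← intervalIntegral.integral_const_mul]
    refine intervalIntegral.integral_mono_on hδ.le (Continuous.intervalIntegrable (by fun_prop) _ _)
      (Continuous.intervalIntegrable (by fun_prop) _ _) fun t ht => ?_
    nlinarith [hhalf s t ht, sq_nonneg (f t)]
  have hD : ∀ s, ∫ t in (0)..δ, f t ^ 2 * (1 - t * k s)⁻¹ ≤ 2 * m := by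
    intro s
    rw [hm, ← intervalIntegral.integral_const_mul]
    refine intervalIntegral.integral_mono_on hδ.le (ContinuousOn.intervalIntegrable ?_)
      (Continuous.intervalIntegrable (by fun_prop) _ _) fun t ht => ?_
    · have := hcqs s
      fun_prop
    · have := hhalf s t ht
      have h4 : (1 - t * k s)⁻¹ ≤ 2 := inv_le_of_inv_le₀ (by norm_num) (by linarith)
      nlinarith [sq_nonneg (f t)]
  have hX2 : IntegrableOn (fun s => X s ^ 2) (Ioo (s₀ - R) (s₀ + R)) :=
    (Continuous.integrableOn_Icc (by fun_prop)).mono_set Ioo_subset_Icc_self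
  have hX2' : IntegrableOn (fun s => X' s ^ 2) (Ioo (s₀ - R) (s₀ + R)) :=
    (Continuous.integrableOn_Icc (by fun_prop)).mono_set Ioo_subset_Icc_self
  have b1 : ∫ s in Ioo (s₀ - R) (s₀ + R), X s ^ 2 * ∫ t in (0)..δ, e s t
      ≤ (Θ * b ^ 2 - C₁ * k s₀ * b + (C + C₁ * C2 * d ^ 2) * l ^ 2)
        * ∫ s in Ioo (s₀ - R) (s₀ + R), X s ^ 2 * n s := by
    rw [← integral_const_mul]
    refine setIntegral_mono_on i1 (i3.const_mul _) measurableSet_Ioo fun s _ => ?_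
    by_cases hs : d / 2 ≤ |l * (s - s₀)|
    · have : X s = 0 := hχ.zero _ hs
      simp [this]
    · have hs1 : l * |s - s₀| ≤ d / 2 := by
        rw [not_le, abs_mul, abs_of_pos hl0] at hs
        exact hs.le
      have hs2 : |s - s₀| ≤ d := by nlinarith [abs_nonneg (s - s₀)]
      have hs3 : l ^ 2 * (s - s₀) ^ 2 ≤ d ^ 2 := by
        rw [← sq_abs (s - s₀), ← mul_pow]
        exact pow_le_pow_left₀ (by positivity) (by linarith) 2
      have h4 := hE b hl4 hlδ (k s) (hkK s)
      have h5 : (Θ * b ^ 2 - C₁ * k s * b + C) ≤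
          Θ * b ^ 2 - C₁ * k s₀ * b + (C + C₁ * C2 * d ^ 2) * l ^ 2 := by
        have h6 := hquad s hs2
        have h7 : C₁ * b * (k s₀ - k s) ≤ C₁ * b * (C2 * (s - s₀) ^ 2) := by gcongr
        have h8 : C₁ * C2 * l ^ 2 * (l ^ 2 * (s - s₀) ^ 2) ≤ C₁ * C2 * l ^ 2 * d ^ 2 := by gcongr
        have h9 : C * 1 ≤ C * l ^ 2 := by gcongr
        rw [hb] at h7 ⊢
        linarith
      have hn0 : 0 ≤ n s := by linarith [hmn s]
      calc X s ^ 2 * ∫ t in (0)..δ, e s t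
          ≤ X s ^ 2 * ((Θ * b ^ 2 - C₁ * k s * b + C) * n s) := by
            gcongr
        _ ≤ X s ^ 2 * ((Θ * b ^ 2 - C₁ * k s₀ * b + (C + C₁ * C2 * d ^ 2) * l ^ 2) * n s) := by
            gcongr
        _ = _ := by ring
  have b2 : ∫ s in Ioo (s₀ - R) (s₀ + R), X' s ^ 2 * ∫ t in (0)..δ, f t ^ 2 * (1 - t * k s)⁻¹
      ≤ 8 * Nd ^ 2 * l ^ 2 * ∫ s in Ioo (s₀ - R) (s₀ + R), X s ^ 2 * n s := by
    have c1 : ∫ s in Ioo (s₀ - R) (s₀ + R), X' s ^ 2 * ∫ t in (0)..δ, f t ^ 2 * (1 - t * k s)⁻¹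
        ≤ (∫ s in Ioo (s₀ - R) (s₀ + R), X' s ^ 2) * (2 * m) := by
      rw [← integral_mul_const]
      refine setIntegral_mono_on i2 (hX2'.mul_const _) measurableSet_Ioo fun s _ => ?_
      gcongr
      exact hD s
    have c2 : (∫ s in Ioo (s₀ - R) (s₀ + R), X s ^ 2) * m
        ≤ 2 * ∫ s in Ioo (s₀ - R) (s₀ + R), X s ^ 2 * n s := by
      rw [← integral_mul_const, ← integral_const_mul]
      refine setIntegral_mono_on (hX2.mul_const _) (i3.const_mul _) measurableSet_Ioo fun s _ => ?_
      nlinarith [hmn s, sq_nonneg (X s)]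
    have c3 := hχ.integral_deriv_sq_le (s₀ := s₀) hd hl hR
    calc _ ≤ (∫ s in Ioo (s₀ - R) (s₀ + R), X' s ^ 2) * (2 * m) := c1
      _ ≤ (2 * Nd ^ 2 * l ^ 2 * ∫ s in Ioo (s₀ - R) (s₀ + R), X s ^ 2) * (2 * m) := by gcongr
      _ = 4 * Nd ^ 2 * l ^ 2 * ((∫ s in Ioo (s₀ - R) (s₀ + R), X s ^ 2) * m) := by ring
      _ ≤ 4 * Nd ^ 2 * l ^ 2 * (2 * ∫ s in Ioo (s₀ - R) (s₀ + R), X s ^ 2 * n s) := by gcongr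
      _ = _ := by ring
  rw [eL, eR, j1, j2, j3]
  linarith

end BoundaryProfile

theorem integrableOn_sq_norm {Ω : Set Plane} (hbd : Bornology.IsBounded Ω) {ψ : Plane → ℂ}
    (hψ : ContDiff ℝ 1 ψ) : IntegrableOn (fun x => ‖ψ x‖ ^ 2) Ω :=
  integrableOn_of_continuous hbd (hψ.continuous.norm.pow 2)

theorem setIntegral_normSq_pos {Ω : Set Plane} (hΩ : IsOpen Ω) (hbd : Bornology.IsBounded Ω)
    {ψ : Plane → ℂ} (hψ : ContDiff ℝ 1 ψ) {x : Plane} (hx : x ∈ Ω) (h0 : ψ x ≠ 0) :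
    0 < ∫ x in Ω, ‖ψ x‖ ^ 2 := by
  rw [setIntegral_pos_iff_support_of_nonneg_ae (ae_of_all _ fun x => sq_nonneg _)
    (integrableOn_sq_norm hbd hψ)]
  have hc : Continuous fun x => ‖ψ x‖ ^ 2 := hψ.continuous.norm.pow 2
  exact (hc.isOpen_support.inter hΩ).measure_pos _ ⟨x, by simpa using h0, hx⟩

theorem magSq_eq_zero {B : ℝ} {A : Plane → Plane} {ψ : Plane → ℂ} {x : Plane} (h0 : ψ x = 0)
    (h1 : fderiv ℝ ψ x = 0) : magSq B A ψ x = 0 := by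
  simp [magSq, h0, h1]

namespace BoundaryParam.Tubular

variable {Ω : Set Plane} {P : BoundaryParam Ω} {δ M : ℝ} (hT : P.Tubular δ M)

include hT in
/-- Surface superconductivity trial state at a boundary point of maximal curvature. -/
theorem exists_trial (hΩ : IsOpen Ω) (hbd : Bornology.IsBounded Ω) {ξ Θ C₁ M' : ℝ}
    {u q h r : ℝ → ℝ} (PF : BoundaryProfile ξ Θ C₁ M' u q h r) (hC₁ : 0 ≤ C₁) {s₀ : ℝ}
    (hs₀ : ∀ s, curvOf P.γ s ≤ curvOf P.γ s₀) :
    ∃ C l₀, 0 ≤ C ∧ ∀ l, l₀ ≤ l → ∃ ψ : Plane → ℂ, ContDiff ℝ 1 ψ ∧ 0 < ∫ x in Ω, ‖ψ x‖ ^ 2 ∧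
      ∫ x in Ω, magSq ((l ^ 4) ^ 2) F0 ψ x
        ≤ (Θ * (l ^ 4) ^ 2 - C₁ * curvOf P.γ s₀ * l ^ 4 + C * l ^ 2) * ∫ x in Ω, ‖ψ x‖ ^ 2 := by
  have hδ := hT.δ_pos
  have hL := P.L_pos
  obtain ⟨N, η, η', hη⟩ := exists_cutoff hδ
  obtain ⟨Nd, χ, χ', hχ⟩ := exists_cutoff (show 0 < P.L / 4 by positivity)
  obtain ⟨C, hC, H⟩ := PF.exists_trial_energy_le hη hδ hχ (by positivity)
    (show P.L / 4 < P.L / 2 by linarith) hC₁ (contDiff_infty.1 P.contDiff_curvOf 2)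
    hT.curv_le hT.mul_le hs₀
  refine ⟨C, max 1 (4 / δ), hC, fun l hl => ?_⟩
  have hl1 : 1 ≤ l := (le_max_left _ _).trans hl
  have hl0 : 0 < l := by linarith
  have hlδ : 4 / δ ≤ l ^ 4 := ((le_max_right _ _).trans hl).trans (le_self_pow₀ hl1 (by norm_num))
  have key := H l hl1 hlδ
  set b := l ^ 4 with hb
  set X : ℝ → ℝ := fun s => χ (l * (s - s₀)) with hX
  set X' : ℝ → ℝ := fun s => l * χ' (l * (s - s₀)) with hX'
  set f := BoundaryProfile.layer u η b with hf
  set f' := BoundaryProfile.layerDeriv u q η η' b with hf'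
  have dX : ∀ s, HasDerivAt X (X' s) s := fun s => hχ.hasDerivAt_comp l s₀ s
  have df : ∀ t, HasDerivAt f (f' t) t := fun t => PF.hasDerivAt_layer hη b t
  have cX : ContDiff ℝ 1 X :=
    contDiff_one_of_hasDerivAt dX (continuous_const.mul (hχ.cont.comp (by fun_prop)))
  have cf : ContDiff ℝ 1 f := contDiff_one_of_hasDerivAt df (PF.continuous_layerDeriv hη b)
  set ρ : ℝ × ℝ → ℝ := fun p => X p.1 * f p.2 with hρ
  have cρ : ContDiff ℝ 1 ρ := (cX.comp contDiff_fst).mul (cf.comp contDiff_snd)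
  have dρ : ∀ p, HasFDerivAt ρ ((X' p.1 * f p.2) • ContinuousLinearMap.fst ℝ ℝ ℝ
      + (X p.1 * f' p.2) • ContinuousLinearMap.snd ℝ ℝ ℝ) p := fun p => by
    have h1 := (dX p.1).hasFDerivAt.comp p (hasFDerivAt_fst (𝕜 := ℝ) (E := ℝ) (F := ℝ))
    have h2 := (df p.2).hasFDerivAt.comp p (hasFDerivAt_snd (𝕜 := ℝ) (E := ℝ) (F := ℝ))
    refine (h1.mul h2).congr_fderiv ?_
    ext <;> simp [mul_comm]
  have cθ := P.contDiff_phase (b ^ 2) (ξ * b) s₀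
  set g := polar ρ (P.phase (b ^ 2) (ξ * b) s₀) with hg
  have cg : ContDiff ℝ 1 g := by
    have h1 : ContDiff ℝ 1 fun p => (ρ p : ℂ) := Complex.ofRealCLM.contDiff.comp cρ
    have h2 : ContDiff ℝ 1 fun p => (P.phase (b ^ 2) (ξ * b) s₀ p : ℂ) :=
      Complex.ofRealCLM.contDiff.comp cθ
    exact h1.mul (contDiff_const.mul h2).cexp
  obtain ⟨ψ, cψ, hψ, hψ0⟩ := hT.exists_transport (s₀ := s₀) cg
    (K := Icc (s₀ - P.L / 4) (s₀ + P.L / 4) ×ˢ Icc (-(δ / 2)) (δ / 2))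
    (isCompact_Icc.prod isCompact_Icc)
    (prod_mono (Icc_subset_Ioo (by linarith) (by linarith)) (Icc_subset_Ioo (by linarith)
      (by linarith)))
    (fun p hp => by
      have : ρ p = 0 := by
        rw [mem_prod, not_and_or] at hp
        rcases hp with hp | hp
        · have h1 : X p.1 = 0 := by
            apply hχ.zero
            have : P.L / 4 < |p.1 - s₀| := by
              by_contra! h
              exact hp ⟨by linarith [(abs_le.1 h).1], by linarith [(abs_le.1 h).2]⟩
            rw [abs_mul, abs_of_pos hl0]
            nlinarith
          simp [hρ, h1]
        · have h1 : η p.2 = 0 := by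
            apply hη.zero
            by_contra! h
            exact hp (abs_le.1 h.le)
          simp [hρ, hf, BoundaryProfile.layer, h1]
      simp [hg, polar, this])
  have hsub : halfBox P δ s₀ ⊆ box P δ s₀ :=
    prod_mono subset_rfl (Ioo_subset_Ioo_left (by linarith))
  have hm : MeasurableSet (halfBox P δ s₀) := measurableSet_Ioo.prod measurableSet_Ioo
  have e1 : ∫ x in Ω, magSq (b ^ 2) F0 ψ x
      = ∫ p in halfBox P δ s₀, BoundaryProfile.trialDensity ξ b (curvOf P.γ) X X' f f' p := by
    rw [hT.setIntegral_eq_halfBox hΩ hbd (s₀ := s₀)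
      fun x hx => magSq_eq_zero (hψ0 x hx).1 (hψ0 x hx).2]
    refine setIntegral_congr_fun hm fun p hp => ?_
    have hp' := hψ p (hsub hp)
    have hpδ : |p.2| < δ := by
      rw [abs_of_pos hp.2.1]
      exact hp.2.2
    rw [P.magSq_tube (hT.ne_zero hpδ) (dρ p) hp'.1 hp'.2]
    rfl
  have e2 : ∫ x in Ω, ‖ψ x‖ ^ 2
      = ∫ p in halfBox P δ s₀, (1 - p.2 * curvOf P.γ p.1) * (X p.1 * f p.2) ^ 2 := by
    rw [hT.setIntegral_eq_halfBox hΩ hbd (s₀ := s₀) fun x hx => by simp [(hψ0 x hx).1]]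
    refine setIntegral_congr_fun hm fun p hp => ?_
    rw [(hψ p (hsub hp)).1, norm_polar_sq]
  refine ⟨ψ, cψ, ?_, ?_⟩
  · refine setIntegral_normSq_pos hΩ hbd cψ
      (hT.tube_mem hΩ (p := (s₀, δ / 8)) (by positivity) (by simp only; linarith)) ?_
    rw [(hψ (s₀, δ / 8) ⟨⟨by simp only; linarith, by simp only; linarith⟩,
      ⟨by simp only; linarith, by simp only; linarith⟩⟩).1, ← norm_ne_zero_iff, ← pow_ne_zero_iff
      two_ne_zero, norm_polar_sq]
    have h1 : X s₀ = 1 := hχ.one _ (by rw [sub_self, mul_zero, abs_zero]; positivity)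
    have h2 : η (δ / 8) = 1 := hη.one _ (by rw [abs_of_pos (by positivity)]; linarith)
    have h3 := PF.pos (max (b * (δ / 8)) 0) (le_max_right _ _)
    simp only [hρ, h1, hf, BoundaryProfile.layer, h2]
    positivity
  · rw [e1, e2]
    exact key

end BoundaryParam.Tubular

theorem contDiff_F0 : ContDiff ℝ 1 F0 := by
  unfold F0
  fun_prop

theorem curl2_F0 (x : Plane) : curl2 F0 x = 1 := by
  have h1 : HasFDerivAt (fun y : Plane => (F0 y).2) ((1 / 2 : ℝ) • ContinuousLinearMap.fst ℝ ℝ ℝ)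
      x := by
    have := (hasFDerivAt_fst (𝕜 := ℝ) (E := ℝ) (F := ℝ) (p := x)).const_mul (1 / 2 : ℝ)
    exact this.congr_of_eventuallyEq (Eventually.of_forall fun y => by simp only [F0]; ring)
  have h2 : HasFDerivAt (fun y : Plane => (F0 y).1)
      ((-1 / 2 : ℝ) • ContinuousLinearMap.snd ℝ ℝ ℝ) x := by
    have := (hasFDerivAt_snd (𝕜 := ℝ) (E := ℝ) (F := ℝ) (p := x)).const_mul (-1 / 2 : ℝ)
    exact this.congr_of_eventuallyEq (Eventually.of_forall fun y => by simp only [F0]; ring)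
  rw [curl2, h1.fderiv, h2.fderiv]
  norm_num

theorem magSq_smul {ψ : Plane → ℂ} (hψ : ContDiff ℝ 1 ψ) (ε B : ℝ) (A : Plane → Plane)
    (x : Plane) : magSq B A (fun x => ε • ψ x) x = ε ^ 2 * magSq B A ψ x := by
  have h : fderiv ℝ (fun x => ε • ψ x) x = ε • fderiv ℝ ψ x :=
    fderiv_fun_const_smul (hψ.differentiable one_ne_zero x) ε
  have key : ∀ z w : ℂ, ∀ t : ℝ, ‖(-Complex.I) * (ε • z) - (t : ℂ) * (ε • w)‖ ^ 2
      = ε ^ 2 * ‖(-Complex.I) * z - (t : ℂ) * w‖ ^ 2 := fun z w t => by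
    rw [show (-Complex.I) * (ε • z) - (t : ℂ) * (ε • w)
      = ε • ((-Complex.I) * z - (t : ℂ) * w) by
        simp only [Complex.real_smul]
        ring, norm_smul, mul_pow, Real.norm_eq_abs, sq_abs]
  simp only [magSq, h, smul_apply, key]
  ring

theorem continuous_magSq {ψ : Plane → ℂ} (hψ : ContDiff ℝ 1 ψ) {A : Plane → Plane}
    (hA : Continuous A) (B : ℝ) : Continuous (magSq B A ψ) := by
  have h1 := hψ.continuous
  have h2 := hψ.continuous_fderiv one_ne_zero
  unfold magSq
  fun_prop

/-- A trial state with small enough magnetic energy destabilizes the normal state. -/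
theorem not_normalMin_of_magSq_lt {Ω : Set Plane} (hbd : Bornology.IsBounded Ω) {κ H : ℝ}
    {ψ : Plane → ℂ} (hψ : ContDiff ℝ 1 ψ)
    (hlt : ∫ x in Ω, magSq (κ * H) F0 ψ x < κ ^ 2 * ∫ x in Ω, ‖ψ x‖ ^ 2) :
    ¬ NormalMin Ω κ H := by
  intro hmin
  set I := ∫ x in Ω, magSq (κ * H) F0 ψ x
  set m := ∫ x in Ω, ‖ψ x‖ ^ 2
  set Q := ∫ x in Ω, ‖ψ x‖ ^ 4
  have hQ : 0 ≤ Q := integral_nonneg fun x => by positivity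
  have iI := integrableOn_of_continuous hbd (continuous_magSq hψ contDiff_F0.continuous (κ * H))
  have im : IntegrableOn (fun x => ‖ψ x‖ ^ 2) Ω :=
    integrableOn_of_continuous hbd (hψ.continuous.norm.pow 2)
  have iQ : IntegrableOn (fun x => ‖ψ x‖ ^ 4) Ω :=
    integrableOn_of_continuous hbd (hψ.continuous.norm.pow 4)
  have hE : ∀ ε : ℝ, GLenergy Ω κ H (fun x => ε • ψ x) F0
      = ε ^ 2 * I - κ ^ 2 * ε ^ 2 * m + κ ^ 2 / 2 * ε ^ 4 * Q := by
    intro ε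
    rw [← integral_const_mul, ← integral_const_mul, ← integral_const_mul,
      ← integral_sub (iI.const_mul _) (im.const_mul _),
      ← integral_add (f := fun x => ε ^ 2 * magSq (κ * H) F0 ψ x - κ ^ 2 * ε ^ 2 * ‖ψ x‖ ^ 2)
        ((iI.const_mul _).sub (im.const_mul _)) (iQ.const_mul _)]
    refine integral_congr_ae (ae_of_all _ fun x => ?_)
    have h4 : |ε| ^ 4 = ε ^ 4 := Even.pow_abs (by decide) ε
    simp only [magSq_smul hψ, curl2_F0, norm_smul, mul_pow, Real.norm_eq_abs, sq_abs, h4]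
    ring
  have hneg : ∃ ε : ℝ, ε ^ 2 * I - κ ^ 2 * ε ^ 2 * m + κ ^ 2 / 2 * ε ^ 4 * Q < 0 := by
    have hg : 0 < κ ^ 2 * m - I := by linarith
    have hD : 0 < κ ^ 2 * Q + 1 := by positivity
    refine ⟨√((κ ^ 2 * m - I) / (κ ^ 2 * Q + 1)), ?_⟩
    set w := (κ ^ 2 * m - I) / (κ ^ 2 * Q + 1) with hw
    have hw0 : 0 < w := by positivity
    have e2 : √w ^ 2 = w := Real.sq_sqrt hw0.le
    have e4 : √w ^ 4 = w ^ 2 := by rw [show √w ^ 4 = (√w ^ 2) ^ 2 by ring, e2]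
    have e5 : w * (κ ^ 2 * Q + 1) = κ ^ 2 * m - I := by
      rw [hw]
      field_simp
    rw [e2, e4]
    have e6 : w * I - κ ^ 2 * w * m + κ ^ 2 / 2 * w ^ 2 * Q
        = -(w * (w * (κ ^ 2 * Q / 2 + 1))) := by
      linear_combination w * e5
    rw [e6, neg_lt_zero]
    positivity
  obtain ⟨ε, hε⟩ := hneg
  rw [← hE] at hε
  exact absurd (hmin _ F0 ⟨⟨univ, isOpen_univ, subset_univ _, (hψ.const_smul ε).contDiffOn⟩,
    ⟨univ, isOpen_univ, subset_univ _, contDiff_F0.contDiffOn⟩⟩) (not_le.2 hε)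

/-- At bounded magnetic field `κ H` the normal state is unstable for large `κ`. -/
theorem exists_not_normalMin_of_le {Ω : Set Plane} (hΩ : IsOpen Ω) (hbd : Bornology.IsBounded Ω)
    (hne : Ω.Nonempty) (B : ℝ) :
    ∃ κ₀, ∀ κ, κ₀ ≤ κ → ∀ H, 0 ≤ κ * H → κ * H ≤ B → ¬ NormalMin Ω κ H := by
  set J := ∫ x in Ω, ((F0 x).1 ^ 2 + (F0 x).2 ^ 2)
  have hJ : 0 ≤ J := integral_nonneg fun x => by positivity
  obtain ⟨x₀, hx₀⟩ := hne
  have hm : 0 < ∫ x in Ω, ‖(1 : ℂ)‖ ^ 2 :=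
    setIntegral_normSq_pos hΩ hbd (ψ := fun _ => 1) contDiff_const hx₀ one_ne_zero
  set m := ∫ x in Ω, ‖(1 : ℂ)‖ ^ 2
  refine ⟨1 + B ^ 2 * J / m, fun κ hκ H h0 hH => ?_⟩
  refine not_normalMin_of_magSq_lt hbd (ψ := fun _ => 1) contDiff_const ?_
  have e : ∫ x in Ω, magSq (κ * H) F0 (fun _ => 1) x = (κ * H) ^ 2 * J := by
    rw [← integral_const_mul]
    refine integral_congr_ae (ae_of_all _ fun x => ?_)
    simp only [magSq, fderiv_fun_const, Pi.zero_apply, zero_apply, mul_zero,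
      zero_sub, mul_one, norm_neg, Complex.norm_real, Real.norm_eq_abs, sq_abs]
    ring
  rw [e]
  have h1 : (κ * H) ^ 2 * J ≤ B ^ 2 * J := by gcongr
  have h2 : 0 ≤ B ^ 2 * J / m := by positivity
  have h3 : B ^ 2 * J / m < κ ^ 2 := by nlinarith
  rw [div_lt_iff₀ hm] at h3
  exact h1.trans_lt h3

theorem exists_upper_threshold {θ c C : ℝ} (hθ : 0 < θ) (hC : 0 ≤ C) :
    ∃ C' S, 0 ≤ C' ∧ 1 ≤ S ∧ ∀ σ, S ≤ σ → ∀ m, 0 ≤ m →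
      (m ^ 2) ^ 2 < σ ^ 4 / θ ^ 2 + c * σ ^ 2 / θ ^ 3 - C' * σ →
      θ ^ 2 * (m ^ 2) ^ 2 - c * m ^ 2 + C * m < σ ^ 4 := by
  set a := 1 + 1 / θ with ha
  clear_value a
  have ha1 : 1 ≤ a := by
    have : 0 < 1 / θ := by positivity
    linarith
  refine ⟨4 * (C + 1) * a / θ ^ 2, 1 + |c| / θ + C * a, by positivity, ?_, ?_⟩
  · have : 0 ≤ |c| / θ + C * a := by positivity
    linarith
  intro σ hσ m hm hb
  have hcθ : 0 ≤ |c| / θ := by positivity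
  have hCa : 0 ≤ C * a := by positivity
  have hσ1 : 1 ≤ σ := by linarith
  have hσ0 : 0 < σ := by linarith
  set b := m ^ 2 with hbdef
  have hb0 : 0 ≤ b := sq_nonneg m
  clear_value b
  set β := σ ^ 2 / θ with hβ
  clear_value β
  have hβ0 : 0 < β := by
    rw [hβ]
    positivity
  set e := c / (2 * θ ^ 2) with he
  clear_value e
  have heβ : |e| < β := by
    rw [he, hβ, abs_div, abs_of_pos (show 0 < 2 * θ ^ 2 by positivity), div_lt_div_iff₀
      (by positivity) hθ]
    have h1 : |c| / θ < σ ^ 2 := by nlinarith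
    rw [div_lt_iff₀ hθ] at h1
    nlinarith
  set y := β + e with hy
  clear_value y
  have hy0 : 0 < y := by linarith [neg_abs_le e]
  have hy2 : y ≤ 2 * β := by linarith [le_abs_self e]
  have hby : b ^ 2 < y ^ 2 - 4 * (C + 1) * a / θ ^ 2 * σ := by
    have : y ^ 2 = σ ^ 4 / θ ^ 2 + c * σ ^ 2 / θ ^ 3 + e ^ 2 := by
      rw [hy, hβ, he]
      field_simp
      ring
    linarith [sq_nonneg e]
  have hw : 0 ≤ 4 * (C + 1) * a / θ ^ 2 * σ := by positivity
  have hlt : b < y := lt_of_pow_lt_pow_left₀ 2 hy0.le (by linarith)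
  have hmσ : m ≤ a * σ := by
    refine le_of_sq_le_sq ?_ (by positivity)
    have h1 : 1 / θ * 2 ≤ a ^ 2 := by
      rw [ha]
      nlinarith [sq_nonneg (1 / θ)]
    calc m ^ 2 ≤ 2 * β := by linarith
      _ = (1 / θ * 2) * σ ^ 2 := by rw [hβ]; ring
      _ ≤ a ^ 2 * σ ^ 2 := by gcongr
      _ = (a * σ) ^ 2 := by ring
  have hCm : C * m ≤ C * (a * σ) := by gcongr
  set v := y - b with hv
  clear_value v
  have hv0 : 0 < v := by linarith
  have hvσ : (C + 1) * a < θ * σ * v := by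
    have h1 : 4 * (C + 1) * a / θ ^ 2 * σ < v * (4 * β) := by
      have : v * (y + b) ≤ v * (4 * β) := by
        gcongr
        linarith
      have h2 : v * (y + b) = y ^ 2 - b ^ 2 := by rw [hv]; ring
      linarith
    rw [hβ] at h1
    have h2 : 4 * (C + 1) * a / θ ^ 2 * σ = (4 * σ / θ ^ 2) * ((C + 1) * a) := by ring
    have h3 : v * (4 * (σ ^ 2 / θ)) = (4 * σ / θ ^ 2) * (θ * σ * v) := by
      field_simp
    rw [h2, h3] at h1
    exact lt_of_mul_lt_mul_left h1 (by positivity)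
  set z := b - e with hz
  clear_value z
  have hzv : z = β - v := by rw [hz, hv, hy]; ring
  have hid : θ ^ 2 * b ^ 2 - c * b = θ ^ 2 * z ^ 2 - θ ^ 2 * e ^ 2 := by
    rw [hz, he]
    field_simp
    ring
  rcases le_or_gt 0 z with h0 | h0
  · have h1 : θ * v ≤ σ ^ 2 := by
      have : v ≤ β := by linarith
      calc θ * v ≤ θ * β := by gcongr
        _ = σ ^ 2 := by rw [hβ]; field_simp
    have h2 : θ ^ 2 * z ^ 2 = (σ ^ 2 - θ * v) ^ 2 := by
      rw [hzv, hβ]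
      field_simp
    have h3 : (σ ^ 2 - θ * v) ^ 2 ≤ σ ^ 4 - σ * (θ * σ * v) := by
      have : 0 ≤ (θ * v) * (σ ^ 2 - θ * v) := mul_nonneg (by positivity) (by linarith)
      nlinarith
    have h4 : σ * ((C + 1) * a) < σ * (θ * σ * v) := by gcongr
    have h5 : 0 < σ * a := by positivity
    have h6 : 0 ≤ θ ^ 2 * e ^ 2 := by positivity
    linarith
  · have h1 : z ^ 2 ≤ e ^ 2 := by nlinarith
    have h2 : θ ^ 2 * z ^ 2 ≤ θ ^ 2 * e ^ 2 := by gcongr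
    have h3 : C * a * σ < σ * σ := by
      gcongr
      linarith
    have h4 : σ * σ ≤ σ ^ 4 := by
      rw [← sq]
      exact pow_le_pow_right₀ hσ1 (by norm_num)
    linarith

theorem exists_lower_threshold {θ c C : ℝ} (hθ : 0 < θ) (hC : 0 ≤ C) :
    ∃ S, 1 ≤ S ∧ ∀ σ, S ≤ σ → 0 < σ ^ 4 / θ ^ 2 + c * σ ^ 2 / θ ^ 3 + σ ∧ ∀ s, 0 ≤ s →
      σ ^ 4 / θ ^ 2 + c * σ ^ 2 / θ ^ 3 + σ ≤ s ^ 2 →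
      1 ≤ s ∧ σ ^ 4 * (1 + C / s ^ 2) < θ ^ 2 * s ^ 2 - c * s - C := by
  set e := c / (2 * θ ^ 2) with he
  clear_value e
  set G := θ ^ 2 * e ^ 2 + C + 4 * C * θ ^ 2 with hG
  clear_value G
  have hG0 : 0 ≤ G := by
    rw [hG]
    positivity
  refine ⟨1 + 2 * |e| * θ + 2 * e ^ 2 + 2 * θ + G / θ + 10 * G / θ ^ 2, ?_, ?_⟩
  · have : 0 ≤ 2 * |e| * θ + 2 * e ^ 2 + 2 * θ + G / θ + 10 * G / θ ^ 2 := by positivity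
    linarith
  intro σ hσ
  have t1 : 0 ≤ 2 * |e| * θ := by positivity
  have t2 : 0 ≤ 2 * e ^ 2 := by positivity
  have t3 : 0 ≤ G / θ := by positivity
  have t4 : 0 ≤ 10 * G / θ ^ 2 := by positivity
  have hσ1 : 1 ≤ σ := by linarith
  have hσ0 : 0 < σ := by linarith
  have hσ2 : σ ≤ σ ^ 2 := le_self_pow₀ hσ1 two_ne_zero
  set β := σ ^ 2 / θ with hβ
  clear_value β
  have hβ0 : 0 < β := by
    rw [hβ]
    positivity
  have hβ2 : 2 ≤ β := by
    rw [hβ, le_div_iff₀ hθ]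
    linarith
  have heβ : 2 * |e| ≤ β := by
    rw [hβ, le_div_iff₀ hθ]
    linarith
  set y := β + e with hy
  clear_value y
  have hy1 : β / 2 ≤ y := by linarith [neg_abs_le e]
  have hy2 : y ≤ 2 * β := by linarith [le_abs_self e]
  have hyσ : y ^ 2 + σ / 2 ≤ σ ^ 4 / θ ^ 2 + c * σ ^ 2 / θ ^ 3 + σ := by
    have : y ^ 2 = σ ^ 4 / θ ^ 2 + c * σ ^ 2 / θ ^ 3 + e ^ 2 := by
      rw [hy, hβ, he]
      field_simp
      ring
    linarith
  refine ⟨by nlinarith [sq_nonneg y], fun s hs0 hs => ?_⟩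
  have hsy : y ^ 2 + σ / 2 ≤ s ^ 2 := hyσ.trans hs
  have hys : y ≤ s := le_of_sq_le_sq (by linarith) hs0
  have hs1 : 1 ≤ s := by linarith
  refine ⟨hs1, ?_⟩
  set v := s - y with hv
  clear_value v
  have hv0 : 0 ≤ v := by linarith
  have hid : θ ^ 2 * s ^ 2 - c * s = (σ ^ 2 + θ * v) ^ 2 - θ ^ 2 * e ^ 2 := by
    rw [hv, hy, hβ, he]
    field_simp
    ring
  have hdiv : σ ^ 4 * (C / s ^ 2) ≤ 4 * C * θ ^ 2 := by
    have h1 : (β / 2) ^ 2 ≤ s ^ 2 := by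
      gcongr
      linarith
    have h2 : σ ^ 4 ≤ 4 * θ ^ 2 * s ^ 2 := by
      have : σ ^ 4 = 4 * θ ^ 2 * (β / 2) ^ 2 := by
        rw [hβ]
        field_simp
        ring
      rw [this]
      gcongr
    rw [mul_div_assoc', div_le_iff₀ (by positivity)]
    nlinarith
  have hmain : G < 2 * σ ^ 2 * (θ * v) := by
    have g1 : G < θ * σ := by
      have : G / θ < σ := by linarith
      rwa [div_lt_iff₀' hθ] at this
    have g2 : 10 * G < σ * θ ^ 2 := by
      have : 10 * G / θ ^ 2 < σ := by linarith
      rwa [div_lt_iff₀ (by positivity)] at this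
    rcases le_or_gt 1 v with h1 | h1
    · calc G < θ * σ := g1
        _ ≤ θ * σ ^ 2 := by gcongr
        _ ≤ 2 * σ ^ 2 * (θ * 1) := by nlinarith
        _ ≤ _ := by gcongr
    · have h2 : σ / 2 ≤ v * (5 * β) := by
        have : v * (s + y) ≤ v * (5 * β) := by
          gcongr
          linarith
        have h4 : v * (s + y) = s ^ 2 - y ^ 2 := by rw [hv]; ring
        linarith
      have h3 : v * (5 * β) * θ ^ 2 = 5 * (σ ^ 2 * (θ * v)) := by
        rw [hβ]
        field_simp
      have h4 : σ / 2 * θ ^ 2 ≤ v * (5 * β) * θ ^ 2 := by gcongr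
      linarith
  have : 0 ≤ (θ * v) ^ 2 := sq_nonneg _
  linarith

theorem abs_csInf_sub_le {S : Set ℝ} {a r : ℝ} (h1 : a + r ∈ S) (h2 : ∀ x ∈ S, a - r ≤ x) :
    |sInf S - a| ≤ r := by
  have h3 : sInf S ≤ a + r := csInf_le ⟨a - r, h2⟩ h1
  have h4 : a - r ≤ sInf S := le_csInf ⟨_, h1⟩ h2
  exact abs_le.2 ⟨by linarith, by linarith⟩

/-- Both critical fields are controlled by an interval outside of which stability is decided. -/
theorem abs_criticalField_sub_le {Ω : Set Plane} {κ a r : ℝ} (h0 : 0 < a + r)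
    (hu : ∀ H, a + r ≤ H → NormalUnique Ω κ H)
    (hl : ∀ H, 0 < H → H < a - r → ¬ NormalMin Ω κ H) :
    |HC3low Ω κ - a| ≤ r ∧ |HC3up Ω κ - a| ≤ r := by
  refine ⟨abs_csInf_sub_le ⟨h0, (hu _ le_rfl).1⟩ fun H hH => ?_,
    abs_csInf_sub_le ⟨h0, fun H hH => hu H hH.le⟩ fun H hH => ?_⟩
  · by_contra! h
    exact hl H hH.1 h hH.2
  · by_contra! h
    have h1 := hH.1
    exact hl ((H + (a - r)) / 2) (by linarith) (by linarith)
      (hH.2 ((H + (a - r)) / 2) (by linarith)).1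

namespace BoundaryParam

variable {Ω : Set Plane} (P : BoundaryParam Ω)

/-- Instability of the normal state below the critical field. -/
theorem exists_not_normalMin (hΩ : IsOpen Ω) (hbd : Bornology.IsBounded Ω) {ξ Θ C₁ M : ℝ}
    {u q h r : ℝ → ℝ} (PF : BoundaryProfile ξ Θ C₁ M u q h r) (hC₁ : 0 ≤ C₁) :
    ∃ C S, 0 ≤ C ∧ 1 ≤ S ∧ ∀ σ, S ≤ σ → ∀ H, 0 < H →
      σ ^ 2 * H < σ ^ 4 / √Θ ^ 2 + C₁ * kmaxOf P.γ * σ ^ 2 / √Θ ^ 3 - C * σ →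
      ¬ NormalMin Ω (σ ^ 2) H := by
  obtain ⟨δ, M, hT⟩ := P.exists_tubular
  have hδ := hT.δ_pos
  obtain ⟨s₀, hk, hs₀⟩ := P.exists_isMaxOn_curvOf
  rw [hk] at hs₀
  obtain ⟨C, l₀, hC, htrial⟩ := hT.exists_trial hΩ hbd PF hC₁ hs₀
  have hθ : 0 < √Θ := Real.sqrt_pos.2 PF.theta_pos
  have hθ2 : √Θ ^ 2 = Θ := Real.sq_sqrt PF.theta_pos.le
  obtain ⟨C', S, hC', hS, halg⟩ := exists_upper_threshold (c := C₁ * kmaxOf P.γ) hθ hC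
  obtain ⟨κ₀, hκ₀⟩ := exists_not_normalMin_of_le hΩ hbd
    ⟨_, hT.tube_mem hΩ (p := (0, δ / 2)) (by positivity) (by simp only; linarith)⟩
    ((max l₀ 0 ^ 4) ^ 2)
  refine ⟨C', max S κ₀, hC', hS.trans (le_max_left _ _), fun σ hσ H hH hlt => ?_⟩
  have hσS : S ≤ σ := (le_max_left _ _).trans hσ
  have hσκ : κ₀ ≤ σ := (le_max_right _ _).trans hσ
  have hσ1 : 1 ≤ σ := hS.trans hσS
  have hB : 0 < σ ^ 2 * H := by positivity
  obtain ⟨l, hl, hlB⟩ : ∃ l : ℝ, 0 ≤ l ∧ (l ^ 4) ^ 2 = σ ^ 2 * H := by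
    refine ⟨√√√(σ ^ 2 * H), Real.sqrt_nonneg _, ?_⟩
    have h1 := Real.sq_sqrt hB.le
    have h2 := Real.sq_sqrt (Real.sqrt_nonneg (σ ^ 2 * H))
    have h3 := Real.sq_sqrt (Real.sqrt_nonneg (√(σ ^ 2 * H)))
    rw [show (√√√(σ ^ 2 * H) ^ 4) ^ 2 = ((√√√(σ ^ 2 * H) ^ 2) ^ 2) ^ 2 by ring, h3, h2, h1]
  rcases le_total l l₀ with h | h
  · refine hκ₀ _ (hσκ.trans (le_self_pow₀ hσ1 two_ne_zero)) H hB.le ?_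
    rw [← hlB]
    gcongr
    exact h.trans (le_max_left _ _)
  · obtain ⟨ψ, cψ, hm, hE⟩ := htrial l h
    refine not_normalMin_of_magSq_lt hbd cψ ?_
    rw [hlB] at hE
    refine hE.trans_lt ?_
    gcongr
    have h1 := halg σ hσS (l ^ 2) (sq_nonneg l) (by
      rw [show ((l ^ 2) ^ 2) ^ 2 = (l ^ 4) ^ 2 by ring, hlB]
      exact hlt)
    rw [hθ2, hk, show (l ^ 2) ^ 2 = l ^ 4 by ring, hlB, show σ ^ 4 = (σ ^ 2) ^ 2 by ring] at h1
    exact h1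

/-- Stability of the normal state above the critical field. -/
theorem exists_normalUnique (hΩ : IsOpen Ω) (hbd : Bornology.IsBounded Ω) {ξ Θ C₁ M : ℝ}
    {u q h r : ℝ → ℝ} (PF : BoundaryProfile ξ Θ C₁ M u q h r) (hΘ : Θ < 1) :
    ∃ S, 1 ≤ S ∧ ∀ σ, S ≤ σ →
      0 < σ ^ 4 / √Θ ^ 2 + C₁ * kmaxOf P.γ * σ ^ 2 / √Θ ^ 3 + σ ∧ ∀ H,
      σ ^ 4 / √Θ ^ 2 + C₁ * kmaxOf P.γ * σ ^ 2 / √Θ ^ 3 + σ ≤ σ ^ 2 * H →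
      NormalUnique Ω (σ ^ 2) H := by
  obtain ⟨δ, M, hT⟩ := P.exists_tubular
  have hM : 0 ≤ 2 * M := by linarith [hT.one_le]
  obtain ⟨C, hC, hcert⟩ := (hT.collar hΩ hbd).magnetic_certificate hbd PF hΘ hM
  have hθ : 0 < √Θ := Real.sqrt_pos.2 PF.theta_pos
  have hθ2 : √Θ ^ 2 = Θ := Real.sq_sqrt PF.theta_pos.le
  obtain ⟨S, hS, halg⟩ := exists_lower_threshold (c := C₁ * kmaxOf P.γ) hθ hC
  refine ⟨S, hS, fun σ hσ => ⟨(halg σ hσ).1, fun H hH => ?_⟩⟩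
  have hB : 0 < σ ^ 2 * H := (halg σ hσ).1.trans_le hH
  have hs2 := Real.sq_sqrt hB.le
  obtain ⟨hs1, hlt⟩ := (halg σ hσ).2 (√(σ ^ 2 * H)) (Real.sqrt_nonneg _) (by rwa [hs2])
  obtain ⟨f, -, hf, cert⟩ := hcert _ hs1
  refine normalUnique_of_certificate hΩ hbd (one_le_pow₀ (hS.trans hσ)) hs2
    (E := C / √(σ ^ 2 * H) ^ 2) (by positivity) ?_ hf cert
  rw [show (σ ^ 2) ^ 2 = σ ^ 4 by ring, ← hθ2]
  exact hlt

end BoundaryParam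

end SC

/-- Asymptotics of the global critical fields for general smooth domains:
`H_{C3}(κ) = κ/Θ₀ + C₁ k_max Θ₀^{-3/2} + O(κ^{-1/2})` for both the lower and upper field. -/
theorem hc3_asymptotics_general
    (Ω : Set SC.Plane) (hΩ_open : IsOpen Ω) (hΩ_bdd : Bornology.IsBounded Ω)
    (hΩ_sc : SimplyConnectedSpace ↥Ω) (P : SC.BoundaryParam Ω) (D : SC.DeGennes) :
    ∃ C > 0, ∃ κ₀ > 0, ∀ κ ≥ κ₀,
      |SC.HC3low Ω κ - κ / SC.Theta0 - D.C1 * SC.kmaxOf P.γ * SC.Theta0 ^ (-(3 : ℝ) / 2)|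
          ≤ C * κ ^ (-(1 : ℝ) / 2) ∧
      |SC.HC3up Ω κ - κ / SC.Theta0 - D.C1 * SC.kmaxOf P.γ * SC.Theta0 ^ (-(3 : ℝ) / 2)|
          ≤ C * κ ^ (-(1 : ℝ) / 2) := by
  obtain ⟨M, u, q, h, r, PF⟩ := D.boundaryProfile
  have hC₁ : 0 ≤ D.C1 := by
    unfold SC.DeGennes.C1
    positivity
  obtain ⟨S, hS, hu⟩ := P.exists_normalUnique hΩ_open hΩ_bdd PF D.theta_ub
  obtain ⟨C, S', hC, hS', hl⟩ := P.exists_not_normalMin hΩ_open hΩ_bdd PF hC₁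
  have hΘ := PF.theta_pos
  have hθ : 0 < √SC.Theta0 := Real.sqrt_pos.2 hΘ
  have hθ2 : √SC.Theta0 ^ 2 = SC.Theta0 := Real.sq_sqrt hΘ.le
  refine ⟨C + 1, by positivity, max S S' ^ 2, by positivity, fun κ hκ => ?_⟩
  have hκ0 : 0 < κ := lt_of_lt_of_le (by positivity) hκ
  have hσm : max S S' ≤ √κ := Real.le_sqrt_of_sq_le hκ
  have hσ0 : 0 < √κ := Real.sqrt_pos.2 hκ0
  have hσ2 : √κ ^ 2 = κ := Real.sq_sqrt hκ0.le
  have e1 : κ ^ (-(1 : ℝ) / 2) = 1 / √κ := by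
    rw [neg_div, Real.rpow_neg hκ0.le, ← Real.sqrt_eq_rpow, one_div]
  have e3 : SC.Theta0 ^ (-(3 : ℝ) / 2) = 1 / √SC.Theta0 ^ 3 := by
    rw [neg_div, Real.rpow_neg hΘ.le, Real.sqrt_eq_rpow, ← Real.rpow_natCast, ← Real.rpow_mul hΘ.le,
      one_div]
    norm_num
  have e4 : κ / SC.Theta0 = κ / √SC.Theta0 ^ 2 := by rw [hθ2]
  obtain ⟨hpos, hu⟩ := hu _ ((le_max_left _ _).trans hσm)
  have hl := hl _ ((le_max_right _ _).trans hσm)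
  rw [e1, e3, e4, sub_sub, sub_sub]
  rw [hσ2] at hu hl hpos
  set σ := √κ
  set θ := √SC.Theta0
  set c := D.C1 * SC.kmaxOf P.γ
  have id : ∀ t : ℝ, σ ^ 4 / θ ^ 2 + c * κ / θ ^ 3 + t * σ
      = κ * (κ / θ ^ 2 + c * (1 / θ ^ 3) + t * (1 / σ)) := fun t => by
    rw [← hσ2]
    field_simp
  have id1 : σ ^ 4 / θ ^ 2 + c * κ / θ ^ 3 + σ
      = κ * (κ / θ ^ 2 + c * (1 / θ ^ 3) + 1 * (1 / σ)) := by
    rw [← id 1, one_mul]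
  have hr : 0 ≤ C * (1 / σ) := by positivity
  have hr' : 0 ≤ 1 / σ := by positivity
  refine SC.abs_criticalField_sub_le ?_ (fun H hH => hu H ?_) fun H hH0 hH => hl H hH0 ?_
  · rw [id1] at hpos
    have h1 := pos_of_mul_pos_right hpos hκ0.le
    linarith
  · rw [id1]
    gcongr
    linarith
  · rw [sub_eq_add_neg, ← neg_mul, id (-C)]
    gcongr
    linarith
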